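/- Let p be an odd prime and H a non-copointed Hopf algebra of dimension p³. Then H has no simple 4-dimensional subcoalgebra stable under the antipode S; in particular H₀ is not isomorphic as a coalgebra to k·1 ⊕ M*(2,k). Moreover, if H₀ ≅ k·1 ⊕ M*(2,k)^t as coalgebras with t > 1, then dim H ≥ dim H₀ + 24 if p ≡ 1 (mod 4), and dim H ≥ dim H₀ + 22 if p ≡ 3 (mod 4). -/

import Mathlib

open TensorProduct

namespace HopfClass

variable (k : Type*) [Field k]

section Wrt

variable {M : Type*} [AddCommGroup M] [Module k M]

/-- A subspace `C` is a subcoalgebra with respect to a comultiplication-like map `Δ`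
if `Δ` maps `C` into the image of `C ⊗ C` in `M ⊗ M`. -/
def IsSubcoalgWrt (Δ : M →ₗ[k] M ⊗[k] M) (C : Submodule k M) : Prop :=
  ∀ x ∈ C, Δ x ∈ LinearMap.range (TensorProduct.map C.subtype C.subtype)

/-- A simple subcoalgebra: a nonzero subcoalgebra with no nonzero proper subcoalgebras. -/
def IsSimpleSubcoalgWrt (Δ : M →ₗ[k] M ⊗[k] M) (C : Submodule k M) : Prop :=
  IsSubcoalgWrt k Δ C ∧ C ≠ ⊥ ∧
    ∀ D : Submodule k M, IsSubcoalgWrt k Δ D → D < C → D = ⊥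

/-- Pointedness: every simple subcoalgebra is one-dimensional. -/
def IsPointedWrt (Δ : M →ₗ[k] M ⊗[k] M) : Prop :=
  ∀ C : Submodule k M, IsSimpleSubcoalgWrt k Δ C → Module.finrank k C = 1

/-- Grouplike element with respect to `Δ`. -/
def IsGrouplikeWrt (Δ : M →ₗ[k] M ⊗[k] M) (g : M) : Prop :=
  g ≠ 0 ∧ Δ g = g ⊗ₜ[k] g

/-- `y` is a `(h, g)`-skew-primitive with respect to `Δ`, i.e. `Δ y = g ⊗ y + y ⊗ h`. -/
def IsSkewPrimitiveWrt (Δ : M →ₗ[k] M ⊗[k] M) (g h y : M) : Prop :=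
  Δ y = g ⊗ₜ[k] y + y ⊗ₜ[k] h

/-- There are no nontrivial skew-primitive elements: every skew-primitive between grouplikes
is a scalar multiple of the difference of the grouplikes. -/
def HasNoNontrivialSkewPrimitivesWrt (Δ : M →ₗ[k] M ⊗[k] M) : Prop :=
  ∀ g h y : M, IsGrouplikeWrt k Δ g → IsGrouplikeWrt k Δ h →
    IsSkewPrimitiveWrt k Δ g h y → ∃ c : k, y = c • (g - h)

end Wrt

section Coalg

variable (H : Type*) [AddCommGroup H] [Module k H] [Coalgebra k H]

/-- The comultiplication of a coalgebra, as a linear map. -/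
noncomputable abbrev comulL : H →ₗ[k] H ⊗[k] H := CoalgebraStruct.comul

/-- The coradical of a coalgebra: the sum of all its simple subcoalgebras. -/
noncomputable def coradical : Submodule k H :=
  sSup {C : Submodule k H | IsSimpleSubcoalgWrt k (comulL k H) C}

/-- A coalgebra is cosemisimple if it equals its coradical. -/
def IsCosemisimple : Prop := coradical k H = ⊤

/-- A coalgebra is pointed if all its simple subcoalgebras are one-dimensional. -/
def IsPointed : Prop := IsPointedWrt k (comulL k H)

/-- The set of grouplike elements. -/
def grouplikes : Set H := {g : H | IsGrouplikeWrt k (comulL k H) g}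

/-- `e` is a multiplicative matrix of size `n` spanning the subspace `C`, i.e. a
linearly independent family with `Δ(e i j) = ∑ l, e i l ⊗ e l j` and `ε(e i j) = δ_ij`
whose span is `C`; this says precisely that `C` is a simple matrix subcoalgebra
isomorphic to `M*(n,k)`, the dual of the `n × n` matrix algebra. -/
def IsMultMatrix (n : ℕ) (C : Submodule k H) (e : Fin n → Fin n → H) : Prop :=
  LinearIndependent k (fun p : Fin n × Fin n => e p.1 p.2) ∧
  C = Submodule.span k (Set.range fun p : Fin n × Fin n => e p.1 p.2) ∧
  (∀ i j, CoalgebraStruct.comul (R := k) (e i j) = ∑ l : Fin n, e i l ⊗ₜ[k] e l j) ∧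
  (∀ i j, Coalgebra.counit (R := k) (e i j) = if i = j then (1 : k) else 0)

/-- `C` is a (simple matrix) subcoalgebra isomorphic to the matrix coalgebra `M*(n,k)`. -/
def IsMatrixSubcoalg (n : ℕ) (C : Submodule k H) : Prop :=
  ∃ e : Fin n → Fin n → H, IsMultMatrix k H n C e

end Coalg

section Dual

variable (H : Type*) [Ring H] [Algebra k H] [FiniteDimensional k H]

/-- The comultiplication on the dual of a finite-dimensional algebra:
the dual map of the multiplication, composed with the canonical identification
`(H ⊗ H)* ≃ H* ⊗ H*`. -/
noncomputable def dualComul :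
    Module.Dual k H →ₗ[k] Module.Dual k H ⊗[k] Module.Dual k H :=
  (TensorProduct.dualDistribEquiv k H H).symm.toLinearMap ∘ₗ
    (LinearMap.mul' k H).dualMap

/-- A finite-dimensional Hopf algebra is copointed if its dual is pointed. -/
def IsCopointed : Prop := IsPointedWrt k (dualComul k H)

/-- The grouplike elements of the dual Hopf algebra. -/
def dualGrouplikes : Set (Module.Dual k H) :=
  {f : Module.Dual k H | IsGrouplikeWrt k (dualComul k H) f}

end Dual

section Taft

variable (p : ℕ) (q : k)

/-- `B` is (isomorphic to) the Taft Hopf algebra `T_q` of dimension `p²`: `q` is a primitive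
`p`-th root of unity, `B` has dimension `p²` and is generated as an algebra by a grouplike `g`
and a `(1,g)`-skew-primitive `x` with `g^p = 1`, `x^p = 0` and `g x = q x g`. -/
def IsTaftAlgebra (B : Type*) [Ring B] [Bialgebra k B] : Prop :=
  IsPrimitiveRoot q p ∧ Module.finrank k B = p ^ 2 ∧
  ∃ g x : B,
    IsGrouplikeWrt k (comulL k B) g ∧
    CoalgebraStruct.comul (R := k) x = x ⊗ₜ[k] (1 : B) + g ⊗ₜ[k] x ∧
    g ^ p = 1 ∧ x ^ p = 0 ∧ g * x = q • (x * g) ∧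
    Algebra.adjoin k {g, x} = (⊤ : Subalgebra k B)

variable {H : Type*} [Ring H] [Bialgebra k H]

/-- The subalgebra `T` of `H` is a sub-Hopf algebra isomorphic to the Taft algebra `T_q` of
dimension `p²`, generated by a grouplike `g` and a `(1,g)`-skew-primitive `x` satisfying the
Taft relations. -/
def IsTaftSubalgebra (T : Subalgebra k H) : Prop :=
  IsPrimitiveRoot q p ∧ Module.finrank k T = p ^ 2 ∧
  ∃ g x : H,
    IsGrouplikeWrt k (comulL k H) g ∧
    CoalgebraStruct.comul (R := k) x = x ⊗ₜ[k] (1 : H) + g ⊗ₜ[k] x ∧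
    g ^ p = 1 ∧ x ^ p = 0 ∧ g * x = q • (x * g) ∧
    Algebra.adjoin k {g, x} = T

/-- The right coinvariants `H^{co π}` of a linear map `π : H → B` on a bialgebra `H`:
elements `h` with `(id ⊗ π)(Δ h) = h ⊗ 1`. -/
def rightCoinvariants {B : Type*} [Ring B] [Bialgebra k B] (π : H →ₗ[k] B) : Set H :=
  {h : H | (TensorProduct.map LinearMap.id π) (CoalgebraStruct.comul (R := k) h)
      = h ⊗ₜ[k] (1 : B)}

end Taft

end HopfClass

section

open TensorProduct

namespace HopfClass

/-- `β` is a Drazin inverse of `b`. -/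
structure IsDrazin {A : Type*} [Ring A] (b β : A) (N : ℕ) : Prop where
  comm : b * β = β * b
  idem : b * β * β = β
  nil : b ^ N * (1 - b * β) = 0

theorem exists_isDrazin (k : Type*) [Field k] {A : Type*} [Ring A] [Algebra k A]
    [FiniteDimensional k A] (b : A) :
    ∃ (β : A) (N : ℕ), IsDrazin b β N ∧ β ∈ Algebra.adjoin k {b} := by
  have hInt : IsIntegral k b := IsIntegral.of_finite k b
  have hm : minpoly k b ≠ 0 := minpoly.ne_zero hInt
  obtain ⟨h, hh, hroot⟩ := Polynomial.exists_eq_pow_rootMultiplicity_mul_and_not_dvd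
    (minpoly k b) hm 0
  set N := (minpoly k b).rootMultiplicity 0
  rw [map_zero, sub_zero] at hh hroot
  have hcop : IsCoprime (Polynomial.X ^ (N + 1) : Polynomial k) h :=
    IsCoprime.pow_left ((Irreducible.coprime_iff_not_dvd Polynomial.irreducible_X).2 hroot)
  obtain ⟨v, w, hvw⟩ := hcop
  set V := Polynomial.aeval b v
  have hcV : b * V = V * b := by
    have := congrArg (Polynomial.aeval b) (mul_comm Polynomial.X v)
    simpa using this
  have h0 : b ^ N * Polynomial.aeval b h = 0 := by
    have := congrArg (Polynomial.aeval b) hh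
    simpa [minpoly.aeval] using this.symm
  have h1 : V * b ^ (N + 1) + Polynomial.aeval b w * Polynomial.aeval b h = 1 := by
    have := congrArg (Polynomial.aeval b) hvw
    simpa using this
  set g := V * b ^ (N + 1)
  have hwh : Polynomial.aeval b w * Polynomial.aeval b h =
      Polynomial.aeval b h * Polynomial.aeval b w := by
    rw [← map_mul, mul_comm, map_mul]
  have hN : b ^ N * (1 - g) = 0 := by
    rw [← h1, add_sub_cancel_left, hwh, ← mul_assoc, h0, zero_mul]
  have hgi : g * g = g := by
    have : g * (1 - g) = 0 := by
      change V * b ^ (N + 1) * (1 - g) = 0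
      rw [pow_succ', mul_assoc, mul_assoc, hN, mul_zero, mul_zero]
    rw [mul_sub, mul_one, sub_eq_zero] at this
    exact this.symm
  have hbg : b * g = g * b := by
    change b * (V * b ^ (N + 1)) = V * b ^ (N + 1) * b
    rw [← mul_assoc, hcV, mul_assoc, mul_assoc, ← pow_succ, ← pow_succ']
  have hb0 : b * (V * b ^ N) = g := by
    change b * (V * b ^ N) = V * b ^ (N + 1)
    rw [← mul_assoc, hcV, mul_assoc, ← pow_succ']
  have hWb : V * b ^ N * b = g := by rw [mul_assoc, ← pow_succ]
  have hbβ : b * (g * (V * b ^ N)) = g := by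
    rw [← mul_assoc, hbg, mul_assoc, hb0, hgi]
  refine ⟨g * (V * b ^ N), N, ⟨?_, ?_, ?_⟩, ?_⟩
  · rw [hbβ, mul_assoc, hWb, hgi]
  · rw [hbβ, ← mul_assoc, hgi]
  · rw [hbβ, hN]
  · have hb : b ∈ Algebra.adjoin k {b} := Algebra.self_mem_adjoin_singleton k b
    have hV : V ∈ Algebra.adjoin k {b} := Polynomial.aeval_mem_adjoin_singleton k b
    exact mul_mem (mul_mem hV (pow_mem hb _)) (mul_mem hV (pow_mem hb _))

namespace IsDrazin
variable {A : Type*} [Ring A] {b β : A} {N : ℕ}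

theorem idem_mul (h : IsDrazin b β N) : b * β * (b * β) = b * β := by
  conv_lhs => rw [mul_assoc, ← mul_assoc β, ← h.comm, h.idem]

theorem comm' (h : IsDrazin b β N) : b * (b * β) = b * β * b := by
  rw [mul_assoc, h.comm]

theorem pow_eq (h : IsDrazin b β N) (n : ℕ) : β ^ n * b ^ n * (b * β) = b * β := by
  induction n with
  | zero => simp
  | succ n ih =>
    calc β ^ (n+1) * b ^ (n+1) * (b * β) = β * (β ^ n * b ^ n * (b * (b * β))) := by
          rw [pow_succ' β, pow_succ b]; simp only [mul_assoc]
      _ = β * (β ^ n * b ^ n * (b * β)) * b := by rw [h.comm']; simp only [mul_assoc]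
      _ = b * β := by
          rw [ih, ← mul_assoc, ← h.comm, mul_assoc, ← h.comm, h.idem_mul]

theorem pow_eq' (h : IsDrazin b β N) (n : ℕ) : (b * β) * (b ^ n * β ^ n) = b * β := by
  have hc : Commute b β := h.comm
  have h1 := h.pow_eq n
  have h2 : Commute (b * β) (b ^ n * β ^ n) :=
    Commute.mul_left (Commute.mul_right
      ((Commute.refl b).pow_right n) (hc.pow_right n))
      (Commute.mul_right (hc.symm.pow_right n) ((Commute.refl β).pow_right n))
  rw [h2.eq, (hc.pow_pow n n).eq]
  exact h1

theorem nil' (h : IsDrazin b β N) : (1 - b * β) * b ^ N = 0 := by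
  have hc : Commute b (b * β) := h.comm'
  have : Commute (1 - b * β) (b ^ N) := ((Commute.one_left b).sub_left hc.symm).pow_right N
  rw [this.eq, h.nil]

theorem commute_idem {k : Type*} [Field k] [Algebra k A] (h : IsDrazin b β N) {a : A} {q : k}
    (hab : a * b = q • (b * a)) (hq : q ≠ 0) : a * (b * β) = b * β * a := by
  have hpow : ∀ n, a * b ^ n = q ^ n • (b ^ n * a) := by
    intro n
    induction n with
    | zero => simp
    | succ n ih =>
      rw [pow_succ, ← mul_assoc, ih, smul_mul_assoc, mul_assoc, hab, mul_smul_comm, smul_smul,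
        ← pow_succ, mul_assoc]
  have h1 : b * β * a * (1 - b * β) = 0 := by
    have e1 : b ^ N * a * (1 - b * β) = 0 := by
      have e2 : q ^ N • (b ^ N * a * (1 - b * β)) = 0 := by
        rw [← smul_mul_assoc, ← hpow, mul_assoc, h.nil, mul_zero]
      exact (smul_eq_zero.1 e2).resolve_left (pow_ne_zero _ hq)
    have hc : Commute b β := h.comm
    have hh : b * β = (b * β) * β ^ N * b ^ N := by
      rw [mul_assoc, ← (hc.pow_pow N N).eq, h.pow_eq']
    rw [hh, mul_assoc (b * β * β ^ N), mul_assoc (b * β * β ^ N), ← hh, e1, mul_zero]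
  have h2 : (1 - b * β) * a * (b * β) = 0 := by
    have hc : Commute b β := h.comm
    have hh : b * β = b ^ N * (β ^ N * (b * β)) := by
      rw [← mul_assoc, (hc.pow_pow N N).eq, h.pow_eq]
    have e1 : (1 - b * β) * a * (b ^ N * (β ^ N * (b * β))) = 0 := by
      rw [mul_assoc, ← mul_assoc a, hpow, smul_mul_assoc, mul_smul_comm, mul_assoc (b ^ N),
        ← mul_assoc, h.nil', zero_mul, smul_zero]
    rwa [← hh] at e1
  rw [mul_sub, mul_one, sub_eq_zero] at h1
  rw [mul_assoc, sub_mul, one_mul, sub_eq_zero] at h2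
  rw [h2, h1, ← mul_assoc]

theorem q_comm {k : Type*} [Field k] [Algebra k A] (h : IsDrazin b β N) {a : A} {q : k}
    (hab : a * b = q • (b * a)) (hq : q ≠ 0) : a * β = q⁻¹ • (β * a) := by
  have hg := h.commute_idem hab hq
  calc a * β = a * (b * β) * β := by rw [mul_assoc, h.idem]
    _ = b * β * a * β := by rw [hg]
    _ = β * (b * a) * β := by rw [h.comm]; simp only [mul_assoc]
    _ = q⁻¹ • (β * (a * b) * β) := by
        rw [hab, mul_smul_comm, smul_mul_assoc, smul_smul, inv_mul_cancel₀ hq, one_smul]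
    _ = q⁻¹ • (β * (a * (b * β))) := by simp only [mul_assoc]
    _ = q⁻¹ • (β * (b * β) * a) := by rw [hg, ← mul_assoc]
    _ = q⁻¹ • (β * a) := by rw [← mul_assoc β, ← h.comm, h.idem]

theorem commute {k : Type*} [Field k] [Algebra k A] (h : IsDrazin b β N) {a : A}
    (hab : Commute a b) : Commute a β := by
  have := h.q_comm (k := k) (q := 1) (a := a) (by rw [one_smul]; exact hab) one_ne_zero
  rwa [inv_one, one_smul] at this

end IsDrazin
end HopfClass

end

section

open TensorProduct

namespace HopfClass

section Twist
variable {k : Type*} [Field k] {K : Type*} [Ring K] [HopfAlgebra k K]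
  {Q : Type*} [AddCommGroup Q] [Module k Q]

open Coalgebra

/-- The map `x ⊗ q ↦ x₁ ⊗ f(x₂) q`. -/
noncomputable def twistR (f : K →ₗ[k] Module.End k Q) : K ⊗[k] Q →ₗ[k] K ⊗[k] Q :=
  LinearMap.lTensor K (TensorProduct.lift f) ∘ₗ (TensorProduct.assoc k K K Q).toLinearMap ∘ₗ
    LinearMap.rTensor Q comul

/-- The map `x ⊗ q ↦ x₂ ⊗ f(x₁) q`. -/
noncomputable def twistL (f : K →ₗ[k] Module.End k Q) : K ⊗[k] Q →ₗ[k] K ⊗[k] Q :=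
  LinearMap.lTensor K (TensorProduct.lift f) ∘ₗ (TensorProduct.assoc k K K Q).toLinearMap ∘ₗ
    LinearMap.rTensor Q ((TensorProduct.comm k K K).toLinearMap ∘ₗ comul)

theorem twistR_tmul (f : K →ₗ[k] Module.End k Q) {x : K} {ι : Type*} (r : Repr k x ι) (q : Q) :
    twistR f (x ⊗ₜ q) = ∑ i ∈ r.index, r.left i ⊗ₜ f (r.right i) q := by
  simp only [twistR, LinearMap.comp_apply, LinearMap.rTensor_tmul, ← r.eq, TensorProduct.sum_tmul,
    map_sum]
  simp

theorem twistL_tmul (f : K →ₗ[k] Module.End k Q) {x : K} {ι : Type*} (r : Repr k x ι) (q : Q) :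
    twistL f (x ⊗ₜ q) = ∑ i ∈ r.index, r.right i ⊗ₜ f (r.left i) q := by
  simp only [twistL, LinearMap.comp_apply, LinearMap.rTensor_tmul, ← r.eq, TensorProduct.sum_tmul,
    map_sum]
  simp

theorem twistR_twistR (f g : K →ₗ[k] Module.End k Q)
    (h : ∀ x, LinearMap.mul' k _ (TensorProduct.map f g (comul x)) =
      counit (R := k) x • 1) (z : K ⊗[k] Q) :
    twistR f (twistR g z) = z := by
  induction z with
  | zero => simp
  | add a b ha hb => simp [ha, hb]
  | tmul x q =>
    let Ψ : K ⊗[k] (K ⊗[k] K) →ₗ[k] K ⊗[k] Q := LinearMap.lTensor K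
      (LinearMap.applyₗ q ∘ₗ LinearMap.mul' k _ ∘ₗ TensorProduct.map f g)
    have key : ∀ t : K ⊗[k] K, twistR f (LinearMap.lTensor K (g.flip q) t) =
        Ψ (TensorProduct.assoc k K K K (LinearMap.rTensor K comul t)) := by
      intro t
      induction t with
      | zero => simp
      | add a b ha hb => simp only [map_add, ha, hb]
      | tmul l r =>
        rw [LinearMap.lTensor_tmul, LinearMap.rTensor_tmul, twistR_tmul f (Repr.arbitrary k l)]
        conv_rhs => rw [← (Repr.arbitrary k l).eq]
        simp [Ψ, TensorProduct.sum_tmul, map_sum]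
    have e1 : twistR g (x ⊗ₜ q) = LinearMap.lTensor K (g.flip q) (comul x) := by
      rw [twistR_tmul g (Repr.arbitrary k x)]
      conv_rhs => rw [← (Repr.arbitrary k x).eq]
      simp [map_sum]
    rw [e1, key, coassoc_apply]
    have e2 : ∀ t : K ⊗[k] K, Ψ (LinearMap.lTensor K comul t) =
        LinearMap.lTensor K ((LinearMap.toSpanSingleton k Q q) ∘ₗ counit) t := by
      intro t
      rw [← LinearMap.comp_apply]
      congr 1
      rw [← LinearMap.lTensor_comp]
      congr 1
      ext y
      simp [h]
    rw [e2, LinearMap.lTensor_comp, LinearMap.comp_apply, lTensor_counit_comul]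
    simp

theorem twistL_twistL (f g : K →ₗ[k] Module.End k Q)
    (h : ∀ x, LinearMap.mul' k _ (TensorProduct.map f g (TensorProduct.comm k K K (comul x))) =
      counit (R := k) x • 1) (z : K ⊗[k] Q) :
    twistL f (twistL g z) = z := by
  induction z with
  | zero => simp
  | add a b ha hb => simp [ha, hb]
  | tmul x q =>
    let Ψ : (K ⊗[k] K) ⊗[k] K →ₗ[k] K ⊗[k] Q := LinearMap.lTensor K
      (LinearMap.applyₗ q ∘ₗ LinearMap.mul' k _ ∘ₗ TensorProduct.map f g ∘ₗ
        (TensorProduct.comm k K K).toLinearMap) ∘ₗ (TensorProduct.comm k _ _).toLinearMap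
    have key : ∀ t : K ⊗[k] K, twistL f (LinearMap.lTensor K (g.flip q) (TensorProduct.comm k K K t)) =
        Ψ ((TensorProduct.assoc k K K K).symm (LinearMap.lTensor K comul t)) := by
      intro t
      induction t with
      | zero => simp
      | add a b ha hb => simp only [map_add, ha, hb]
      | tmul l r =>
        rw [TensorProduct.comm_tmul, LinearMap.lTensor_tmul, LinearMap.lTensor_tmul,
          twistL_tmul f (Repr.arbitrary k r)]
        conv_rhs => rw [← (Repr.arbitrary k r).eq]
        simp [Ψ, TensorProduct.tmul_sum, map_sum]
    have e1 : twistL g (x ⊗ₜ q) = LinearMap.lTensor K (g.flip q) (TensorProduct.comm k K K (comul x)) := by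
      rw [twistL_tmul g (Repr.arbitrary k x)]
      conv_rhs => rw [← (Repr.arbitrary k x).eq]
      simp [map_sum]
    rw [e1, key, coassoc_symm_apply]
    have e2 : ∀ t : K ⊗[k] K, Ψ (LinearMap.rTensor K comul t) =
        LinearMap.lTensor K ((LinearMap.toSpanSingleton k Q q))
          (TensorProduct.comm k _ _ (LinearMap.rTensor K counit t)) := by
      intro t
      induction t with
      | zero => simp
      | add a b ha hb => simp only [map_add, ha, hb]
      | tmul l r =>
        have := h l
        simp only [Ψ, LinearMap.comp_apply, LinearMap.rTensor_tmul, LinearEquiv.coe_coe,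
          TensorProduct.comm_tmul, LinearMap.lTensor_tmul, this]
        simp
    rw [e2, rTensor_counit_comul]
    simp

theorem twistR_injective (ρ : K →ₐ[k] Module.End k Q) :
    Function.Injective (twistR ρ.toLinearMap) := by
  refine Function.LeftInverse.injective (g := twistR (ρ.toLinearMap ∘ₗ HopfAlgebra.antipode k))
    (twistR_twistR _ _ fun x => ?_)
  have := congrArg ρ (HopfAlgebra.mul_antipode_rTensor_comul_apply (R := k) x)
  rw [AlgHom.commutes, Algebra.algebraMap_eq_smul_one] at this
  rw [← this]
  induction (comul x : K ⊗[k] K) with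
  | zero => simp
  | add a b ha hb => simp only [map_add, ha, hb]
  | tmul l r => simp

/-- A linear map satisfying the defining property of the antipode of the co-opposite bialgebra. -/
def IsSkewAntipode (T : K →ₗ[k] K) : Prop :=
  ∀ x, LinearMap.mul' k _ (LinearMap.rTensor K T (TensorProduct.comm k K K (comul x))) =
      counit (R := k) x • 1

theorem exists_isSkewAntipode (hS : Function.Bijective (HopfAlgebra.antipode k (A := K))) :
    ∃ T : K →ₗ[k] K, IsSkewAntipode (k := k) T := by
  let e := LinearEquiv.ofBijective (HopfAlgebra.antipode k (A := K)) hS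
  refine ⟨e.symm.toLinearMap, fun x => ?_⟩
  apply hS.1
  rw [map_smul, HopfAlgebra.antipode_one]
  have := HopfAlgebra.mul_antipode_rTensor_comul_apply (R := k) x
  rw [Algebra.algebraMap_eq_smul_one] at this
  rw [← this]
  induction (comul x : K ⊗[k] K) with
  | zero => simp
  | add a b ha hb => simp only [map_add, ha, hb]
  | tmul l r =>
    have : HopfAlgebra.antipode k (e.symm r) = r := e.apply_symm_apply r
    simp [HopfAlgebra.antipode_mul_antidistrib, this]

theorem twistL_injective (hS : Function.Bijective (HopfAlgebra.antipode k (A := K)))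
    (ρ : K →ₐ[k] Module.End k Q) :
    Function.Injective (twistL ρ.toLinearMap) := by
  obtain ⟨T, hT⟩ := exists_isSkewAntipode hS
  refine Function.LeftInverse.injective (g := twistL (ρ.toLinearMap ∘ₗ T))
    (twistL_twistL _ _ fun x => ?_)
  have := congrArg ρ (hT x)
  rw [map_smul, map_one] at this
  rw [← this]
  induction (comul x : K ⊗[k] K) with
  | zero => simp
  | add a b ha hb => simp only [map_add, ha, hb]
  | tmul l r => simp

end Twist
end HopfClass

end

section

open TensorProduct

namespace HopfClass

section Rank
variable {k : Type*} [Field k]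

theorem finrank_range_rTensor {V F : Type*} [AddCommGroup V] [Module k V] [FiniteDimensional k V]
    [AddCommGroup F] [Module k F] [FiniteDimensional k F] (g : V →ₗ[k] V) :
    Module.finrank k (LinearMap.range (LinearMap.rTensor F g)) =
      Module.finrank k (LinearMap.range g) * Module.finrank k F := by
  have h1 : LinearMap.rTensor F g =
      LinearMap.rTensor F (LinearMap.range g).subtype ∘ₗ LinearMap.rTensor F g.rangeRestrict := by
    rw [← LinearMap.rTensor_comp]; rfl
  have hs : LinearMap.range (LinearMap.rTensor F g.rangeRestrict) = ⊤ :=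
    LinearMap.range_eq_top.2 (LinearMap.rTensor_surjective F g.surjective_rangeRestrict)
  rw [h1, LinearMap.range_comp, hs, Submodule.map_top, LinearMap.finrank_range_of_inj,
    Module.finrank_tensorProduct]
  exact Module.Flat.rTensor_preserves_injective_linearMap _ (Submodule.subtype_injective _)

theorem finrank_range_bounds {X Y : Type*} [AddCommGroup X] [Module k X] [FiniteDimensional k X]
    [AddCommGroup Y] [Module k Y] [FiniteDimensional k Y] {j : X →ₗ[k] Y}
    (hj : Function.Injective j) {T : Y →ₗ[k] Y} {T' : X →ₗ[k] X} (h : ∀ x, j (T' x) = T (j x)) :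
    Module.finrank k (LinearMap.range T') ≤ Module.finrank k (LinearMap.range T) ∧
    Module.finrank k (LinearMap.range T) + Module.finrank k X ≤
      Module.finrank k (LinearMap.range T') + Module.finrank k Y := by
  constructor
  · rw [← LinearMap.finrank_range_of_inj
      (f := j ∘ₗ (LinearMap.range T').subtype)
      (hj.comp (Submodule.subtype_injective _))]
    apply Submodule.finrank_mono
    rintro _ ⟨⟨_, x, rfl⟩, rfl⟩
    exact ⟨j x, (h x).symm⟩
  · have h1 := LinearMap.finrank_range_add_finrank_ker T
    have h2 := LinearMap.finrank_range_add_finrank_ker T'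
    have h3 : Module.finrank k (LinearMap.ker T') ≤ Module.finrank k (LinearMap.ker T) := by
      rw [← LinearMap.finrank_range_of_inj
        (f := j ∘ₗ (LinearMap.ker T').subtype)
        (hj.comp (Submodule.subtype_injective _))]
      apply Submodule.finrank_mono
      rintro _ ⟨⟨x, hx⟩, rfl⟩
      have : T' x = 0 := hx
      simp [← h, this]
    omega

end Rank

section NZ
open Coalgebra
variable {k : Type*} [Field k] {K : Type*} [Ring K] [HopfAlgebra k K]
  {L : Type*} [Ring L] [HopfAlgebra k L]

/-- The diagonal action of a bialgebra on the tensor product of the regular representation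
with another representation. -/
noncomputable def diagRep {Y : Type*} [AddCommGroup Y] [Module k Y] (π : L →ₐ[k] Module.End k Y) :
    L →ₐ[k] Module.End k (L ⊗[k] Y) :=
  (Module.endTensorEndAlgHom (R := k) (A := k) (S := k)).comp
    ((Algebra.TensorProduct.map (Algebra.lmul k L) π).comp (Bialgebra.comulAlgHom k L))

theorem diagRep_apply {Y : Type*} [AddCommGroup Y] [Module k Y] (π : L →ₐ[k] Module.End k Y)
    {h : L} {ι : Type*} (r : Repr k h ι) (l : L) (y : Y) :
    diagRep π h (l ⊗ₜ y) = ∑ i ∈ r.index, (r.left i * l) ⊗ₜ π (r.right i) y := by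
  simp only [diagRep, AlgHom.comp_apply, Bialgebra.comulAlgHom_apply, ← r.eq, map_sum]
  simp only [Algebra.TensorProduct.map_tmul, LinearMap.sum_apply, Module.endTensorEndAlgHom_apply]
  rfl

theorem diagRep_twistR {Y : Type*} [AddCommGroup Y] [Module k Y] (π : L →ₐ[k] Module.End k Y)
    (h : L) (z : L ⊗[k] Y) :
    diagRep π h (twistR π.toLinearMap z) =
      twistR π.toLinearMap (LinearMap.rTensor Y (LinearMap.mulLeft k h) z) := by
  have key : ∀ (x : L) (y : Y), twistR π.toLinearMap (x ⊗ₜ y) = diagRep π x (1 ⊗ₜ y) := by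
    intro x y
    rw [diagRep_apply π (Repr.arbitrary k x), twistR_tmul _ (Repr.arbitrary k x)]
    simp
  induction z with
  | zero => simp
  | add a b ha hb => simp only [map_add, ha, hb]
  | tmul x y => simp [key]

theorem finrank_range_diagRep {Y : Type*} [AddCommGroup Y] [Module k Y] [FiniteDimensional k L]
    [FiniteDimensional k Y] (π : L →ₐ[k] Module.End k Y) (h : L) :
    Module.finrank k (LinearMap.range (diagRep π h)) =
      Module.finrank k (LinearMap.range (LinearMap.mulLeft k h)) * Module.finrank k Y := by
  have hb := finrank_range_bounds (twistR_injective π) (T := diagRep π h)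
    (fun z => (diagRep_twistR π h z).symm)
  rw [finrank_range_rTensor] at hb
  omega

/-- The left action of a subalgebra on the quotient of the big algebra by it. -/
noncomputable def quotRep (ι : K →ₐ[k] L) :
    K →ₐ[k] Module.End k (L ⧸ LinearMap.range ι.toLinearMap) :=
  AlgHom.ofLinearMap
    { toFun := fun x => (LinearMap.range ι.toLinearMap).mapQ _ (LinearMap.mulLeft k (ι x))
        (by rintro _ ⟨y, rfl⟩; exact ⟨x * y, by simp⟩)
      map_add' := fun x y => by ext l; simp [add_mul]
      map_smul' := fun c x => by ext l; simp }
    (by ext l; simp) (fun x y => by ext l; simp)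

theorem quotRep_mk (ι : K →ₐ[k] L) (x : K) (l : L) :
    quotRep ι x (Submodule.Quotient.mk l) = Submodule.Quotient.mk (ι x * l) := by
  simp [quotRep]

theorem exists_free_diagRep [FiniteDimensional k K] [FiniteDimensional k L]
    (hS : Function.Bijective (HopfAlgebra.antipode k (A := K)))
    (ι : K →ₐc[k] L) (hι : Function.Injective ι)
    {Y F : Type*} [AddCommGroup Y] [Module k Y] [AddCommGroup F] [Module k F]
    (π : L →ₐ[k] Module.End k Y) (j : K ⊗[k] F →ₗ[k] Y) (hj : Function.Injective j)
    (hπ : ∀ x z, j (LinearMap.rTensor F (LinearMap.mulLeft k x) z) = π (ι x) (j z)) :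
    ∃ j' : K ⊗[k] (Y × ((L ⧸ LinearMap.range (ι : K →ₐ[k] L).toLinearMap) ⊗[k] F)) →ₗ[k] L ⊗[k] Y,
      Function.Injective j' ∧
      ∀ x z, j' (LinearMap.rTensor _ (LinearMap.mulLeft k x) z) = diagRep π (ι x) (j' z) := by
  set R := LinearMap.range (ι : K →ₐ[k] L).toLinearMap
  obtain ⟨σ, hσ⟩ := R.mkQ.exists_rightInverse_of_surjective (Submodule.range_mkQ R)
  let i1 : Y →ₗ[k] L ⊗[k] Y := TensorProduct.mk k L Y 1
  let i2 : (L ⧸ R) ⊗[k] F →ₗ[k] L ⊗[k] Y :=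
    TensorProduct.map σ (j ∘ₗ TensorProduct.mk k K F 1)
  let act : K →ₗ[k] Module.End k (L ⊗[k] Y) :=
    ((diagRep π).comp (ι : K →ₐ[k] L)).toLinearMap
  have hact : ∀ {x : K} {I : Type _} (r : Repr k x I) (l : L) (y : Y), act x (l ⊗ₜ y) =
      ∑ i ∈ r.index, (ι (r.left i) * l) ⊗ₜ π (ι (r.right i)) y := by
    intro x I r l y
    have := diagRep_apply π (r.induced ι) l y
    simpa [act] using this
  let j1 : K ⊗[k] Y →ₗ[k] L ⊗[k] Y := TensorProduct.lift (act.compl₂ i1)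
  let j2 : K ⊗[k] ((L ⧸ R) ⊗[k] F) →ₗ[k] L ⊗[k] Y := TensorProduct.lift (act.compl₂ i2)
  have hj1 : j1 = LinearMap.rTensor Y (ι : K →ₐ[k] L).toLinearMap ∘ₗ
      twistR (π.comp (ι : K →ₐ[k] L)).toLinearMap := by
    ext x y
    simp only [j1, TensorProduct.AlgebraTensorModule.curry_apply, TensorProduct.curry_apply,
      LinearMap.restrictScalars_self, LinearMap.comp_apply, TensorProduct.lift.tmul,
        LinearMap.compl₂_apply]
    rw [twistR_tmul _ (Repr.arbitrary k x), map_sum]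
    change act x (1 ⊗ₜ y) = _
    rw [hact (Repr.arbitrary k x)]
    simp
  have hj1i : Function.Injective j1 := by
    rw [hj1]
    exact (Module.Flat.rTensor_preserves_injective_linearMap _ hι).comp (twistR_injective _)
  have hQj1 : ∀ z, LinearMap.rTensor Y R.mkQ (j1 z) = 0 := by
    intro z
    rw [hj1, LinearMap.comp_apply, ← LinearMap.comp_apply, ← LinearMap.rTensor_comp]
    have : R.mkQ ∘ₗ (ι : K →ₐ[k] L).toLinearMap = 0 := by
      ext x
      exact (Submodule.Quotient.mk_eq_zero R).2 ⟨x, rfl⟩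
    rw [this]; simp
  have hj2 : LinearMap.rTensor Y R.mkQ ∘ₗ j2 =
      LinearMap.lTensor (L ⧸ R) j ∘ₗ (TensorProduct.assoc k (L ⧸ R) K F).toLinearMap ∘ₗ
      LinearMap.rTensor F ((TensorProduct.comm k K (L ⧸ R)).toLinearMap ∘ₗ
        twistL (quotRep (ι : K →ₐ[k] L)).toLinearMap) ∘ₗ
      (TensorProduct.assoc k K (L ⧸ R) F).symm.toLinearMap := by
    refine LinearMap.ext fun z => ?_
    induction z with
    | zero => simp only [map_zero]
    | add a b ha hb => simp only [map_add, ha, hb]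
    | tmul x u =>
    induction u with
    | zero => simp only [TensorProduct.tmul_zero, map_zero]
    | add a b ha hb => simp only [TensorProduct.tmul_add, map_add, ha, hb]
    | tmul q w =>
    change LinearMap.rTensor Y R.mkQ (act x (i2 (q ⊗ₜ w))) =
      LinearMap.lTensor (L ⧸ R) j (TensorProduct.assoc k (L ⧸ R) K F
        ((TensorProduct.comm k K (L ⧸ R) (twistL (quotRep (ι : K →ₐ[k] L)).toLinearMap (x ⊗ₜ q))) ⊗ₜ w))
    have e1 : i2 (q ⊗ₜ w) = σ q ⊗ₜ j (1 ⊗ₜ w) := rfl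
    have e2 : q = Submodule.Quotient.mk (σ q) := (LinearMap.congr_fun hσ q).symm
    rw [e1, hact (Repr.arbitrary k x), twistL_tmul _ (Repr.arbitrary k x), map_sum, map_sum,
      TensorProduct.sum_tmul, map_sum, map_sum]
    refine Finset.sum_congr rfl fun i _ => ?_
    conv_rhs => rw [e2]
    rw [← hπ]
    simp only [LinearMap.rTensor_tmul, AlgHom.toLinearMap_apply, quotRep_mk]
    simp
  have hj2i : Function.Injective (LinearMap.rTensor Y R.mkQ ∘ₗ j2) := by
    rw [hj2]
    simp only [LinearMap.coe_comp, LinearEquiv.coe_coe]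
    refine (Module.Flat.lTensor_preserves_injective_linearMap _ hj).comp
      ((LinearEquiv.injective _).comp (Function.Injective.comp ?_ (LinearEquiv.injective _)))
    refine Module.Flat.rTensor_preserves_injective_linearMap _ ?_
    simp only [LinearMap.coe_comp, LinearEquiv.coe_coe]
    exact (LinearEquiv.injective _).comp (twistL_injective hS _)
  refine ⟨(j1.coprod j2) ∘ₗ (TensorProduct.prodRight k k K Y ((L ⧸ R) ⊗[k] F)).toLinearMap, ?_, ?_⟩
  · simp only [LinearMap.coe_comp, LinearEquiv.coe_coe]
    refine Function.Injective.comp ?_ (LinearEquiv.injective _)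
    change Function.Injective (j1.coprod j2)
    rw [← LinearMap.ker_eq_bot, LinearMap.ker_eq_bot']
    rintro ⟨z1, z2⟩ hz
    rw [LinearMap.coprod_apply] at hz
    have h2 : z2 = 0 := by
      apply hj2i
      have := congrArg (LinearMap.rTensor Y R.mkQ) hz
      rw [map_add, hQj1, zero_add] at this
      simpa using this
    subst h2
    rw [map_zero, add_zero] at hz
    have : z1 = 0 := hj1i (by simpa using hz)
    rw [this]; rfl
  · intro x z
    induction z with
    | zero => simp
    | add a b ha hb => simp only [map_add, ha, hb]
    | tmul y u =>
      obtain ⟨u1, u2⟩ := u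
      simp [j1, j2, act]

end NZ
end HopfClass

end

section

open TensorProduct

namespace HopfClass
universe u v w
variable {k : Type w} [Field k] {K : Type u} [Ring K] [HopfAlgebra k K]
  {L : Type v} [Ring L] [HopfAlgebra k L]

theorem exists_rep_free_up_to [FiniteDimensional k K] [FiniteDimensional k L]
    (hS : Function.Bijective (HopfAlgebra.antipode k (A := K)))
    (ι : K →ₐc[k] L) (hι : Function.Injective ι) (m : ℕ) :
    ∃ (Y : Type v) (_ : AddCommGroup Y) (_ : Module k Y) (_ : FiniteDimensional k Y)
      (F : Type v) (_ : AddCommGroup F) (_ : Module k F) (_ : FiniteDimensional k F)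
      (π : L →ₐ[k] Module.End k Y) (j : K ⊗[k] F →ₗ[k] Y),
      Function.Injective j ∧
      (∀ x z, j (LinearMap.rTensor F (LinearMap.mulLeft k x) z) = π (ι x) (j z)) ∧
      (∀ h, Module.finrank k L * Module.finrank k (LinearMap.range (π h)) =
        Module.finrank k Y * Module.finrank k (LinearMap.range (LinearMap.mulLeft k h))) ∧
      Module.finrank k Y = Module.finrank k L ^ (m + 1) ∧
      (Module.finrank k Y : ℤ) - Module.finrank k K * Module.finrank k F =
        Module.finrank k L * ((Module.finrank k L : ℤ) - Module.finrank k K) ^ m := by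
  induction m with
  | zero =>
    refine ⟨L, inferInstance, inferInstance, inferInstance, PUnit, inferInstance, inferInstance,
      inferInstance, Algebra.lmul k L, 0, ?_, ?_, ?_, ?_, ?_⟩
    · have : Subsingleton (K ⊗[k] PUnit.{v+1}) := by
        rw [← Module.finrank_zero_iff (R := k), Module.finrank_tensorProduct,
          Module.finrank_zero_of_subsingleton (M := PUnit.{v+1}), mul_zero]
      exact Function.injective_of_subsingleton _
    · simp
    · intro h; rfl
    · simp
    · simp [Module.finrank_zero_of_subsingleton (M := PUnit.{v+1})]
  | succ m ih =>
    obtain ⟨Y, _, _, _, F, _, _, _, π, j, hj, hπ, hr, hY, hF⟩ := ih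
    obtain ⟨j', hj', hπ'⟩ := exists_free_diagRep hS ι hι π j hj hπ
    refine ⟨L ⊗[k] Y, inferInstance, inferInstance, inferInstance,
      Y × ((L ⧸ LinearMap.range (ι : K →ₐ[k] L).toLinearMap) ⊗[k] F), inferInstance, inferInstance,
      inferInstance, diagRep π, j', hj', hπ', ?_, ?_, ?_⟩
    · intro h
      rw [finrank_range_diagRep, Module.finrank_tensorProduct]
      ring
    · rw [Module.finrank_tensorProduct, hY]; ring
    · have hq := Submodule.finrank_quotient_add_finrank
        (LinearMap.range (ι : K →ₐ[k] L).toLinearMap)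
      rw [LinearMap.finrank_range_of_inj (by exact hι)] at hq
      rw [Module.finrank_tensorProduct, Module.finrank_prod, Module.finrank_tensorProduct, pow_succ]
      have hq' : (Module.finrank k (L ⧸ LinearMap.range (ι : K →ₐ[k] L).toLinearMap) : ℤ) =
        Module.finrank k L - Module.finrank k K := by omega
      push_cast
      rw [hq', ← mul_assoc, ← hF]
      ring

theorem finrank_range_mulLeft_mul [FiniteDimensional k K] [FiniteDimensional k L]
    (hS : Function.Bijective (HopfAlgebra.antipode k (A := K)))
    (ι : K →ₐc[k] L) (hι : Function.Injective ι) (s : K) :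
    Module.finrank k (LinearMap.range (LinearMap.mulLeft k s)) * Module.finrank k L =
      Module.finrank k K * Module.finrank k (LinearMap.range (LinearMap.mulLeft k (ι s))) := by
  have hK : 0 < Module.finrank k K := by
    have := Bialgebra.nontrivial (R := k) (A := K)
    exact Module.finrank_pos
  have hKL : Module.finrank k K ≤ Module.finrank k L :=
    LinearMap.finrank_le_finrank_of_injective (f := (ι : K →ₐ[k] L).toLinearMap) hι
  set d := Module.finrank k K
  set n := Module.finrank k L
  set rK := Module.finrank k (LinearMap.range (LinearMap.mulLeft k s)) with hrK
  set rL := Module.finrank k (LinearMap.range (LinearMap.mulLeft k (ι s)))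
  have hrKd : rK ≤ d := Submodule.finrank_le _
  have hn : 0 < n := hK.trans_le hKL
  set a : ℤ := (rK * n : ℕ) - (d * rL : ℕ)
  have key : ∀ m : ℕ, |a| * n ^ (m + 1) ≤ d * n * (n * ((n : ℤ) - d) ^ m) := by
    intro m
    obtain ⟨Y, _, _, _, F, _, _, _, π, j, hj, hπ, hr, hY, hF⟩ := exists_rep_free_up_to hS ι hι m
    have hb := finrank_range_bounds hj (hπ s)
    rw [finrank_range_rTensor, Module.finrank_tensorProduct, ← hrK] at hb
    have hr := hr (ι s)
    set R := Module.finrank k (LinearMap.range (π (ι s)))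
    set f := Module.finrank k F
    set y := Module.finrank k Y
    have hY' : (y : ℤ) = n ^ (m + 1) := by exact_mod_cast hY
    set e : ℤ := n * ((n : ℤ) - d) ^ m
    have he : 0 ≤ e := by
      have : (0 : ℤ) ≤ (n : ℤ) - d := by omega
      positivity
    rw [← hY']
    have h1 : (rK : ℤ) * f ≤ R := by exact_mod_cast hb.1
    have h2 : (R : ℤ) + d * f ≤ rK * f + y := by exact_mod_cast hb.2
    have h3 : (n : ℤ) * R = y * rL := by exact_mod_cast hr
    have hF' : (y : ℤ) - d * f = e := hF
    have hdn : (0 : ℤ) ≤ d * n := by positivity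
    have ha : a * y = d * n * (rK * f - R) + n * e * rK := by
      simp only [a]; push_cast
      linear_combination (d : ℤ) * h3 + n * rK * hF'
    have hb1 : (n : ℤ) * e * rK ≤ d * n * e := by
      have : (rK : ℤ) ≤ d := by exact_mod_cast hrKd
      nlinarith [mul_nonneg (Int.natCast_nonneg n) he]
    have hb2 : (0 : ℤ) ≤ n * e * rK := by positivity
    have habs : |a| * y = |a * y| := by rw [abs_mul, Nat.abs_cast]
    rw [habs, abs_le, ha]
    constructor
    · nlinarith
    · nlinarith
  by_contra hne
  have ha : 1 ≤ |a| := by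
    rw [← Int.sub_one_lt_iff, sub_self]
    apply abs_pos.2
    simp only [a]
    intro h
    apply hne
    have : ((rK * n : ℕ) : ℤ) = (d * rL : ℕ) := by linarith
    exact_mod_cast this
  have hn' : (0 : ℝ) < n := by exact_mod_cast hn
  have hK' : (0 : ℝ) < d := by exact_mod_cast hK
  have hKL' : (d : ℝ) ≤ n := by exact_mod_cast hKL
  obtain ⟨m, hm⟩ := exists_pow_lt_of_lt_one (show (0 : ℝ) < 1 / (d * n) by positivity)
    (show ((n : ℝ) - d) / n < 1 by rw [div_lt_one hn']; linarith)
  have h := key m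
  have h' : (n : ℝ) ^ (m + 1) ≤ d * n * (n * ((n : ℝ) - d) ^ m) := by
    have h2 : (n : ℤ) ^ (m + 1) ≤ d * n * (n * ((n : ℤ) - d) ^ m) := by
      refine le_trans ?_ h
      nlinarith [pow_pos (show (0 : ℤ) < n by exact_mod_cast hn) (m + 1)]
    exact_mod_cast h2
  rw [div_pow, div_lt_div_iff₀ (by positivity) (by positivity)] at hm
  rw [pow_succ] at h'
  nlinarith

/-- If a nonzero element `s` of `K` satisfies `s K ⊆ k s` then `dim K` divides `dim L`. -/
theorem finrank_dvd_of_mul_mem_span [FiniteDimensional k K] [FiniteDimensional k L]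
    (hS : Function.Bijective (HopfAlgebra.antipode k (A := K)))
    (ι : K →ₐc[k] L) (hι : Function.Injective ι) {s : K} (hs : s ≠ 0)
    (h : ∀ x, s * x ∈ Submodule.span k {s}) : Module.finrank k K ∣ Module.finrank k L := by
  have h1 : LinearMap.range (LinearMap.mulLeft k s) = Submodule.span k {s} := by
    apply le_antisymm
    · rintro _ ⟨x, rfl⟩; exact h x
    · rw [Submodule.span_singleton_le_iff_mem]; exact ⟨1, by simp⟩
  have := finrank_range_mulLeft_mul hS ι hι s
  rw [h1, finrank_span_singleton hs, one_mul] at this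
  exact ⟨_, this⟩

end HopfClass

end

section

open TensorProduct

namespace HopfClass
open Coalgebra
variable {k : Type*} [Field k] {B : Type*} [Ring B] [HopfAlgebra k B]

/-- The algebra endomorphism `h ↦ α(h₁) h₂`. -/
noncomputable def lact (α : WithConv (B →ₐ[k] k)) : B →ₐ[k] B :=
  (Algebra.TensorProduct.lid k B).toAlgHom.comp
    ((Algebra.TensorProduct.map α.ofConv (AlgHom.id k B)).comp (Bialgebra.comulAlgHom k B))

/-- The algebra endomorphism `h ↦ h₁ α(h₂)`. -/
noncomputable def ract (α : WithConv (B →ₐ[k] k)) : B →ₐ[k] B :=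
  (Algebra.TensorProduct.rid k k B).toAlgHom.comp
    ((Algebra.TensorProduct.map (AlgHom.id k B) α.ofConv).comp (Bialgebra.comulAlgHom k B))

theorem lact_apply (α : WithConv (B →ₐ[k] k)) (h : B) :
    lact α h = TensorProduct.lid k B (LinearMap.rTensor B α.ofConv.toLinearMap (comul h)) := rfl

theorem ract_apply (α : WithConv (B →ₐ[k] k)) (h : B) :
    ract α h = TensorProduct.rid k B (LinearMap.lTensor B α.ofConv.toLinearMap (comul h)) := rfl

theorem ract_repr (α : WithConv (B →ₐ[k] k)) {h : B} {I : Type*} (r : Repr k h I) :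
    ract α h = ∑ i ∈ r.index, α.ofConv (r.right i) • r.left i := by
  rw [ract_apply, ← r.eq, map_sum, map_sum]; simp

theorem convMul_ofConv_apply (α β : WithConv (B →ₐ[k] k)) (h : B) :
    (α * β).ofConv h = LinearMap.mul' k k
      (TensorProduct.map α.ofConv.toLinearMap β.ofConv.toLinearMap (comul h)) := rfl

theorem ract_ract (α β : WithConv (B →ₐ[k] k)) (h : B) :
    ract α (ract β h) = ract (α * β) h := by
  let Ω : B ⊗[k] (B ⊗[k] B) →ₗ[k] B := (TensorProduct.rid k B).toLinearMap ∘ₗ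
    LinearMap.lTensor B (LinearMap.mul' k k ∘ₗ
      TensorProduct.map α.ofConv.toLinearMap β.ofConv.toLinearMap)
  have key : ∀ t : B ⊗[k] B, ract α (TensorProduct.rid k B (LinearMap.lTensor B β.ofConv.toLinearMap t))
      = Ω (TensorProduct.assoc k B B B (LinearMap.rTensor B comul t)) := by
    intro t
    induction t with
    | zero => simp
    | add a b ha hb => simp only [map_add, ha, hb]
    | tmul l r =>
      rw [LinearMap.lTensor_tmul, TensorProduct.rid_tmul, map_smul,
        ract_repr α (Repr.arbitrary k l)]
      conv_rhs => rw [LinearMap.rTensor_tmul, ← (Repr.arbitrary k l).eq]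
      simp [Ω, TensorProduct.sum_tmul, Finset.smul_sum, smul_smul, mul_comm]
  rw [ract_apply β, key, coassoc_apply, ract_apply]
  have e : ∀ t : B ⊗[k] B, Ω (LinearMap.lTensor B comul t)
      = TensorProduct.rid k B (LinearMap.lTensor B (α * β).ofConv.toLinearMap t) := by
    intro t
    induction t with
    | zero => simp
    | add a b ha hb => simp only [map_add, ha, hb]
    | tmul l r => simp [Ω, convMul_ofConv_apply]
  exact e _

theorem ract_one : ract (1 : WithConv (B →ₐ[k] k)) = AlgHom.id k B := by
  ext h
  rw [ract_apply]
  have := lTensor_counit_comul (R := k) h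
  change TensorProduct.rid k B (LinearMap.lTensor B counit (comul h)) = h
  rw [this]; simp

theorem ract_pow (α : WithConv (B →ₐ[k] k)) (n : ℕ) :
    (ract α).toLinearMap ^ n = (ract (α ^ n)).toLinearMap := by
  induction n with
  | zero => rw [pow_zero, pow_zero, ract_one]; rfl
  | succ n ih => rw [pow_succ, ih, pow_succ]; ext h; exact ract_ract _ _ h

theorem counit_ract (α : WithConv (B →ₐ[k] k)) (h : B) :
    counit (R := k) (ract α h) = α.ofConv h := by
  rw [ract_repr α (Repr.arbitrary k h), map_sum]
  conv_rhs => rw [← sum_counit_smul (Repr.arbitrary k h)]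
  simp [mul_comm]

theorem lTensor_lact_comul (α : WithConv (B →ₐ[k] k)) (h : B) :
    LinearMap.lTensor B (lact α).toLinearMap (comul h) =
      LinearMap.rTensor B (ract α).toLinearMap (comul h) := by
  have h1 : (lact α).toLinearMap = ((TensorProduct.lid k B).toLinearMap ∘ₗ
    LinearMap.rTensor B α.ofConv.toLinearMap) ∘ₗ comul := rfl
  have h2 : (ract α).toLinearMap = ((TensorProduct.rid k B).toLinearMap ∘ₗ
    LinearMap.lTensor B α.ofConv.toLinearMap) ∘ₗ comul := rfl
  rw [h1, h2, LinearMap.lTensor_comp, LinearMap.rTensor_comp, LinearMap.comp_apply,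
    LinearMap.comp_apply, ← coassoc_apply]
  generalize LinearMap.rTensor B comul (comul h : B ⊗[k] B) = t
  induction t with
  | zero => simp
  | add a b ha hb => simp only [map_add, ha, hb]
  | tmul u z =>
    induction u with
    | zero => simp
    | add a b ha hb => simp only [map_add, TensorProduct.add_tmul, ha, hb]
    | tmul x y => simp [TensorProduct.smul_tmul]

theorem map_ract_lact_comul {α α' : WithConv (B →ₐ[k] k)} (h : α' * α = 1) (x : B) :
    TensorProduct.map (ract α').toLinearMap (lact α).toLinearMap (comul x) = comul x := by
  have : TensorProduct.map (ract α').toLinearMap (lact α).toLinearMap =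
    LinearMap.rTensor B (ract α').toLinearMap ∘ₗ LinearMap.lTensor B (lact α).toLinearMap :=
    (LinearMap.rTensor_comp_lTensor ..).symm
  rw [this, LinearMap.comp_apply, lTensor_lact_comul, ← LinearMap.comp_apply,
    ← LinearMap.rTensor_comp]
  have : (ract α').toLinearMap ∘ₗ (ract α).toLinearMap = LinearMap.id := by
    ext y; simp [ract_ract, h, ract_one]
  rw [this]; simp

theorem trace_ract_mul_trace_lact [FiniteDimensional k B] {α α' : WithConv (B →ₐ[k] k)}
    (h : α' * α = 1) :
    LinearMap.trace k B (ract α').toLinearMap * LinearMap.trace k B (lact α).toLinearMap =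
      Module.finrank k B * LinearMap.trace k B (lact α).toLinearMap := by
  have hinj := twistR_injective (Algebra.lmul k B)
  have hbij : Function.Bijective (twistR (Algebra.lmul k B).toLinearMap) :=
    ⟨hinj, LinearMap.surjective_of_injective hinj⟩
  let e := LinearEquiv.ofBijective _ hbij
  have key : ∀ z, TensorProduct.map (ract α').toLinearMap (lact α).toLinearMap (e z) =
      e (LinearMap.lTensor B (lact α).toLinearMap z) := by
    intro z
    induction z with
    | zero => simp
    | add a b ha hb => simp only [map_add, ha, hb]
    | tmul x y =>
      have hT : ∀ w, e (x ⊗ₜ w) = LinearMap.lTensor B (LinearMap.mulRight k w) (comul x) := by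
        intro w
        change twistR _ _ = _
        rw [twistR_tmul _ (Repr.arbitrary k x)]
        conv_rhs => rw [← (Repr.arbitrary k x).eq]
        simp
      rw [LinearMap.lTensor_tmul, hT, hT]
      conv_rhs => rw [← map_ract_lact_comul h x]
      generalize (comul x : B ⊗[k] B) = t
      induction t with
      | zero => simp
      | add a b ha hb => simp only [map_add, ha, hb]
      | tmul l r => simp
  have h1 : TensorProduct.map (ract α').toLinearMap (lact α).toLinearMap =
      e.conj (LinearMap.lTensor B (lact α).toLinearMap) := by
    refine LinearMap.ext fun z => ?_
    rw [LinearEquiv.conj_apply_apply, ← key, e.apply_symm_apply]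
  rw [← LinearMap.trace_tensorProduct', h1, LinearMap.trace_conj']
  change LinearMap.trace k _ (TensorProduct.map LinearMap.id _) = _
  rw [LinearMap.trace_tensorProduct', LinearMap.trace_id]

theorem trace_lact_mul_trace_ract [FiniteDimensional k B] {α α' : WithConv (B →ₐ[k] k)}
    (h : α * α' = 1) :
    LinearMap.trace k B (lact α').toLinearMap * LinearMap.trace k B (ract α).toLinearMap =
      Module.finrank k B * LinearMap.trace k B (ract α).toLinearMap := by
  let mr : B →ₗ[k] Module.End k B := (LinearMap.mul k B).flip
  have hinj : Function.Injective (twistL mr) := by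
    refine Function.LeftInverse.injective (g := twistL (mr ∘ₗ HopfAlgebra.antipode k))
      (twistL_twistL _ _ fun x => ?_)
    have := HopfAlgebra.mul_antipode_lTensor_comul_apply (R := k) x
    refine LinearMap.ext fun q => ?_
    rw [Algebra.algebraMap_eq_smul_one] at this
    have h2 := congrArg (q * ·) this
    simp only [mul_smul_comm, mul_one] at h2
    simp only [LinearMap.smul_apply, Module.End.one_apply]
    rw [← h2]
    generalize (comul x : B ⊗[k] B) = t
    induction t with
    | zero => simp
    | add a b ha hb => simp only [map_add, LinearMap.add_apply, ha, hb, mul_add]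
    | tmul l r => simp [mr, mul_assoc]
  have hbij : Function.Bijective (twistL mr) :=
    ⟨hinj, LinearMap.surjective_of_injective hinj⟩
  let e := LinearEquiv.ofBijective _ hbij
  have key : ∀ z, TensorProduct.map (lact α').toLinearMap (ract α).toLinearMap (e z) =
      e (LinearMap.lTensor B (ract α).toLinearMap z) := by
    intro z
    induction z with
    | zero => simp
    | add a b ha hb => simp only [map_add, ha, hb]
    | tmul x y =>
      have hT : ∀ w, e (x ⊗ₜ w) = LinearMap.lTensor B (LinearMap.mulLeft k w)
          (TensorProduct.comm k B B (comul x)) := by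
        intro w
        change twistL _ _ = _
        rw [twistL_tmul _ (Repr.arbitrary k x)]
        conv_rhs => rw [← (Repr.arbitrary k x).eq]
        simp [mr]
      rw [LinearMap.lTensor_tmul, hT, hT]
      conv_rhs => rw [← map_ract_lact_comul h x]
      generalize (comul x : B ⊗[k] B) = t
      induction t with
      | zero => simp
      | add a b ha hb => simp only [map_add, ha, hb]
      | tmul l r => simp
  have h1 : TensorProduct.map (lact α').toLinearMap (ract α).toLinearMap =
      e.conj (LinearMap.lTensor B (ract α).toLinearMap) := by
    refine LinearMap.ext fun z => ?_
    rw [LinearEquiv.conj_apply_apply, ← key, e.apply_symm_apply]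
  rw [← LinearMap.trace_tensorProduct', h1, LinearMap.trace_conj']
  change LinearMap.trace k _ (TensorProduct.map LinearMap.id _) = _
  rw [LinearMap.trace_tensorProduct', LinearMap.trace_id]

theorem trace_ract_eq_zero_or [FiniteDimensional k B] [CharZero k] {α α' : WithConv (B →ₐ[k] k)}
    (h : α * α' = 1) :
    LinearMap.trace k B (ract α).toLinearMap = 0 ∨
      LinearMap.trace k B (ract α).toLinearMap = Module.finrank k B := by
  by_cases h0 : LinearMap.trace k B (ract α).toLinearMap = 0
  · exact Or.inl h0
  right
  have h1 := mul_right_cancel₀ h0 (trace_lact_mul_trace_ract h)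
  have := Bialgebra.nontrivial (R := k) (A := B)
  have hd : (Module.finrank k B : k) ≠ 0 := by
    exact_mod_cast (Module.finrank_pos (R := k) (M := B)).ne'
  have h2 := trace_ract_mul_trace_lact h
  rw [h1] at h2
  exact mul_right_cancel₀ hd h2

/-- The order of a character divides the dimension, for characters of prime order. -/
theorem prime_dvd_finrank [FiniteDimensional k B] [CharZero k] {α : WithConv (B →ₐ[k] k)} {r : ℕ}
    (hr : r.Prime) (h : α ^ r = 1) (h1 : α ≠ 1) : r ∣ Module.finrank k B := by
  classical
  set d := Module.finrank k B with hd
  set R := (ract α).toLinearMap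
  have hRr : R ^ r = 1 := by rw [ract_pow, h, ract_one]; rfl
  have hrk : (r : k) ≠ 0 := by exact_mod_cast hr.ne_zero
  have htr : ∀ j ∈ Finset.range r, LinearMap.trace k B (R ^ j) = 0 ∨
      LinearMap.trace k B (R ^ j) = d := by
    intro j hj
    rw [ract_pow]
    apply trace_ract_eq_zero_or (α' := α ^ (r - j))
    rw [← pow_add, Nat.add_sub_cancel' (Finset.mem_range.1 hj).le, h]
  set P : Module.End k B := (r : k)⁻¹ • ∑ j ∈ Finset.range r, R ^ j
  have hRP : R * P = P := by
    simp only [P, mul_smul_comm, Finset.mul_sum]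
    congr 1
    have e := Finset.sum_range_succ (fun j => R ^ j) r
    rw [Finset.sum_range_succ'] at e
    simp only [pow_succ', pow_zero, hRr] at e
    exact add_right_cancel e
  have hRjP : ∀ j, R ^ j * P = P := by
    intro j
    induction j with
    | zero => simp
    | succ j ih => rw [pow_succ, mul_assoc, hRP, ih]
  have hP : IsIdempotentElem P := by
    change P * P = P
    conv_lhs => rw [show P = (r : k)⁻¹ • ∑ j ∈ Finset.range r, R ^ j from rfl]
    rw [smul_mul_assoc, Finset.sum_mul]
    simp only [P] at hRjP ⊢
    rw [Finset.sum_congr rfl (fun j _ => hRjP j)]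
    rw [Finset.sum_const, Finset.card_range, ← Nat.cast_smul_eq_nsmul k, smul_smul,
      inv_mul_cancel₀ hrk, one_smul]
  have htP : (r : k) * Module.finrank k (LinearMap.range P) =
      ∑ j ∈ Finset.range r, LinearMap.trace k B (R ^ j) := by
    have e2 : (r : k) • P = ∑ j ∈ Finset.range r, R ^ j := by
      simp only [P, smul_smul, mul_inv_cancel₀ hrk, one_smul]
    rw [← (LinearMap.IsIdempotentElem.isProj_range P hP).trace, ← smul_eq_mul, ← map_smul, e2,
      map_sum]
  set s := (Finset.range r).filter (fun j => LinearMap.trace k B (R ^ j) = d)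
  have hsum : ∑ j ∈ Finset.range r, LinearMap.trace k B (R ^ j) = s.card * d := by
    rw [← nsmul_eq_mul, ← Finset.sum_const, Finset.sum_filter]
    refine Finset.sum_congr rfl fun j hj => ?_
    split_ifs with hh
    · exact hh
    · exact (htr j hj).resolve_right hh
  rw [hsum] at htP
  have hmain : r * Module.finrank k (LinearMap.range P) = s.card * d := by exact_mod_cast htP
  have hs0 : 0 < s.card := by
    apply Finset.card_pos.2
    exact ⟨0, Finset.mem_filter.2 ⟨Finset.mem_range.2 hr.pos, by simp [hd]⟩⟩
  have hsr : s.card ≤ r := by simpa using Finset.card_filter_le (Finset.range r) _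
  rcases hsr.lt_or_eq with hlt | heq
  · have hdvd : r ∣ s.card * d := ⟨_, hmain.symm⟩
    refine (hr.dvd_mul.1 hdvd).resolve_left fun hc => ?_
    exact absurd (Nat.le_of_dvd hs0 hc) (not_le.2 hlt)
  · exfalso
    rw [heq] at hmain
    have hrank := Nat.eq_of_mul_eq_mul_left hr.pos hmain
    have htop : LinearMap.range P = ⊤ := Submodule.eq_top_of_finrank_eq hrank
    have hR1 : ∀ x, ract α x = x := by
      intro x
      have hx : x ∈ LinearMap.range P := by rw [htop]; trivial
      obtain ⟨y, rfl⟩ := hx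
      exact LinearMap.congr_fun hRP y
    apply h1
    apply WithConv.ofConv_injective
    ext x
    rw [← counit_ract, hR1]
    rfl

end HopfClass

end

section

open TensorProduct

namespace HopfClass
open Coalgebra

section SubHopf
universe u
variable {k : Type*} [Field k] {H : Type u} [Ring H] [HopfAlgebra k H]

section
variable {V W : Type*} [AddCommGroup V] [Module k V] [AddCommGroup W] [Module k W]
  (D : V →ₗ[k] V ⊗[k] V) (D' : W →ₗ[k] W ⊗[k] W) (i : V →ₗ[k] W)

theorem map_assoc_rTensor (h : ∀ x, TensorProduct.map i i (D x) = D' (i x))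
    (t : V ⊗[k] V) : TensorProduct.map i (TensorProduct.map i i)
        (TensorProduct.assoc k V V V (LinearMap.rTensor V D t)) =
      TensorProduct.assoc k W W W (LinearMap.rTensor W D' (TensorProduct.map i i t)) := by
  induction t with
  | zero => simp
  | add a b ha hb => simp only [map_add, ha, hb]
  | tmul l r =>
    have := LinearMap.congr_fun (TensorProduct.map_map_comp_assoc_eq i i i) (D l ⊗ₜ r)
    simp only [LinearMap.comp_apply, LinearEquiv.coe_coe, TensorProduct.map_tmul, h] at this
    simpa using this

theorem map_lTensor (h : ∀ x, TensorProduct.map i i (D x) = D' (i x))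
    (t : V ⊗[k] V) : TensorProduct.map i (TensorProduct.map i i) (LinearMap.lTensor V D t) =
      LinearMap.lTensor W D' (TensorProduct.map i i t) := by
  induction t with
  | zero => simp
  | add a b ha hb => simp only [map_add, ha, hb]
  | tmul l r => simp [h]

end

theorem exists_comul_restrict (B : Subalgebra k H)
    (hΔ : ∀ x ∈ B, comul (R := k) x ∈
      (Algebra.TensorProduct.map B.val B.val).range) :
    ∃ D : B →ₐ[k] B ⊗[k] B, ∀ x : B, Algebra.TensorProduct.map B.val B.val (D x) =
      comul (R := k) (x : H) := by
  have hinj : Function.Injective (Algebra.TensorProduct.map B.val B.val) :=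
    TensorProduct.map_injective_of_flat_flat _ _ Subtype.val_injective Subtype.val_injective
  let e := AlgEquiv.ofInjective _ hinj
  let c : B →ₐ[k] (Algebra.TensorProduct.map B.val B.val).range :=
    ((Bialgebra.comulAlgHom k H).comp B.val).codRestrict _ fun x => hΔ x x.2
  refine ⟨(e.symm : _ →ₐ[k] _).comp c, fun x => ?_⟩
  have : (e (e.symm (c x)) : H ⊗[k] H) = c x := by rw [AlgEquiv.apply_symm_apply]
  exact this

/-- A subalgebra stable under the comultiplication and the antipode is a Hopf algebra. -/
theorem exists_hopfAlgebra_of_subalgebra (B : Subalgebra k H)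
    (hΔ : ∀ x ∈ B, comul (R := k) x ∈ (Algebra.TensorProduct.map B.val B.val).range)
    (hS : ∀ x ∈ B, HopfAlgebra.antipode k x ∈ B) :
    ∃ (K : Type u) (_ : Ring K) (_ : HopfAlgebra k K) (ι : K →ₐc[k] H),
      Function.Injective ι ∧ (ι : K →ₐ[k] H).range = B := by
  obtain ⟨D, hD⟩ := exists_comul_restrict B hΔ
  have hinj : Function.Injective B.val.toLinearMap := Subtype.val_injective
  have hinj2 : Function.Injective (TensorProduct.map B.val.toLinearMap B.val.toLinearMap) :=
    TensorProduct.map_injective_of_flat_flat _ _ hinj hinj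
  have hinj3 : Function.Injective (TensorProduct.map B.val.toLinearMap
      (TensorProduct.map B.val.toLinearMap B.val.toLinearMap)) :=
    TensorProduct.map_injective_of_flat_flat _ _ hinj hinj2
  have hD' : ∀ x : B, TensorProduct.map B.val.toLinearMap B.val.toLinearMap (D x) =
      comul (R := k) (x : H) := hD
  have h1 := map_assoc_rTensor D.toLinearMap comul B.val.toLinearMap hD'
  have h2 := map_lTensor D.toLinearMap comul B.val.toLinearMap hD'
  let _ : Bialgebra k B := Bialgebra.ofAlgHom D ((Bialgebra.counitAlgHom k H).comp B.val)
    (by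
      ext x
      apply hinj3
      change TensorProduct.map B.val.toLinearMap
        (TensorProduct.map B.val.toLinearMap B.val.toLinearMap)
          (TensorProduct.assoc k B B B (LinearMap.rTensor B D.toLinearMap (D x))) =
        TensorProduct.map B.val.toLinearMap
        (TensorProduct.map B.val.toLinearMap B.val.toLinearMap)
          (LinearMap.lTensor B D.toLinearMap (D x))
      rw [h1, h2, hD', coassoc_apply])
    (by
      ext x
      apply (TensorProduct.lid k B).injective
      apply hinj
      have : ∀ t : B ⊗[k] B, B.val.toLinearMap (TensorProduct.lid k B
          (Algebra.TensorProduct.map ((Bialgebra.counitAlgHom k H).comp B.val) (.id k B) t)) =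
          TensorProduct.lid k H (LinearMap.rTensor H (counit (R := k))
            (TensorProduct.map B.val.toLinearMap B.val.toLinearMap t)) := by
        intro t
        induction t with
        | zero => simp
        | add a b ha hb => simp only [map_add, ha, hb]
        | tmul l r => simp
      rw [AlgHom.comp_apply, this, hD', rTensor_counit_comul]
      simp)
    (by
      ext x
      apply (TensorProduct.rid k B).injective
      apply hinj
      have : ∀ t : B ⊗[k] B, B.val.toLinearMap (TensorProduct.rid k B
          (Algebra.TensorProduct.map (.id k B) ((Bialgebra.counitAlgHom k H).comp B.val) t)) =
          TensorProduct.rid k H (LinearMap.lTensor H (counit (R := k))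
            (TensorProduct.map B.val.toLinearMap B.val.toLinearMap t)) := by
        intro t
        induction t with
        | zero => simp
        | add a b ha hb => simp only [map_add, ha, hb]
        | tmul l r => simp
      rw [AlgHom.comp_apply, this, hD', lTensor_counit_comul]
      simp)
  let S : B →ₗ[k] B := ((HopfAlgebra.antipode k (A := H)).comp B.val.toLinearMap).codRestrict
    B.toSubmodule fun x => hS x x.2
  let _ : HopfAlgebra k B :=
    { antipode := S
      mul_antipode_rTensor_comul := by
        ext x
        have : ∀ t : B ⊗[k] B, B.val.toLinearMap (LinearMap.mul' k B (LinearMap.rTensor B S t)) =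
            LinearMap.mul' k H (LinearMap.rTensor H (HopfAlgebra.antipode k)
              (TensorProduct.map B.val.toLinearMap B.val.toLinearMap t)) := by
          intro t
          induction t with
          | zero => simp
          | add a b ha hb => simp only [map_add, ha, hb]
          | tmul l r => simp [S]; rfl
        refine (this (D x)).trans ?_
        rw [hD', HopfAlgebra.mul_antipode_rTensor_comul_apply]
        rfl
      mul_antipode_lTensor_comul := by
        ext x
        have : ∀ t : B ⊗[k] B, B.val.toLinearMap (LinearMap.mul' k B (LinearMap.lTensor B S t)) =
            LinearMap.mul' k H (LinearMap.lTensor H (HopfAlgebra.antipode k)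
              (TensorProduct.map B.val.toLinearMap B.val.toLinearMap t)) := by
          intro t
          induction t with
          | zero => simp
          | add a b ha hb => simp only [map_add, ha, hb]
          | tmul l r => simp [S]; rfl
        refine (this (D x)).trans ?_
        rw [hD', HopfAlgebra.mul_antipode_lTensor_comul_apply]
        rfl }
  refine ⟨B, inferInstance, inferInstance, BialgHom.ofAlgHom B.val rfl ?_, Subtype.val_injective,
    ?_⟩
  · ext x
    exact hD x
  · exact B.range_val

theorem exists_hopfAlgebra_of_adjoin (X : Set H)
    (hΔ : ∀ x ∈ X, comul (R := k) x ∈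
      (Algebra.TensorProduct.map (Algebra.adjoin k X).val (Algebra.adjoin k X).val).range)
    (hS : ∀ x ∈ X, HopfAlgebra.antipode k x ∈ Algebra.adjoin k X) :
    ∃ (K : Type u) (_ : Ring K) (_ : HopfAlgebra k K) (ι : K →ₐc[k] H),
      Function.Injective ι ∧ (ι : K →ₐ[k] H).range = Algebra.adjoin k X := by
  apply exists_hopfAlgebra_of_subalgebra
  · intro x hx
    have : Algebra.adjoin k X ≤ (Algebra.TensorProduct.map (Algebra.adjoin k X).val
        (Algebra.adjoin k X).val).range.comap (Bialgebra.comulAlgHom k H) :=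
      Algebra.adjoin_le hΔ
    exact this hx
  · intro x hx
    induction hx using Algebra.adjoin_induction with
    | mem x hx => exact hS x hx
    | algebraMap r =>
      rw [Algebra.algebraMap_eq_smul_one, map_smul, HopfAlgebra.antipode_one]
      exact Subalgebra.smul_mem _ (one_mem _) r
    | add x y _ _ hx hy => rw [map_add]; exact add_mem hx hy
    | mul x y _ _ hx hy =>
      rw [HopfAlgebra.antipode_mul_antidistrib]; exact mul_mem hy hx

theorem antipode_bijective_of_adjoin [FiniteDimensional k H] {X : Set H}
    (hX : Algebra.adjoin k X = ⊤)
    (h : ∀ x ∈ X, x ∈ LinearMap.range (HopfAlgebra.antipode k (A := H))) :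
    Function.Bijective (HopfAlgebra.antipode k (A := H)) := by
  have hs : Function.Surjective (HopfAlgebra.antipode k (A := H)) := by
    intro x
    have hx : x ∈ Algebra.adjoin k X := hX ▸ Algebra.mem_top
    induction hx using Algebra.adjoin_induction with
    | mem x hx => exact h x hx
    | algebraMap r =>
      exact ⟨algebraMap k H r, by
        rw [Algebra.algebraMap_eq_smul_one, map_smul, HopfAlgebra.antipode_one]⟩
    | add x y _ _ hx hy =>
      obtain ⟨u, rfl⟩ := hx
      obtain ⟨v, rfl⟩ := hy
      exact ⟨u + v, map_add _ _ _⟩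
    | mul x y _ _ hx hy =>
      obtain ⟨u, rfl⟩ := hx
      obtain ⟨v, rfl⟩ := hy
      exact ⟨v * u, HopfAlgebra.antipode_mul_antidistrib _ _⟩
  exact ⟨LinearMap.injective_iff_surjective.2 hs, hs⟩

end SubHopf

end HopfClass

end

section

open TensorProduct

namespace HopfClass

section Power
variable {k : Type*} [Field k]

theorem mul_add_pow_of_q_comm {R : Type*} [Ring R] [Algebra k R] {x u v : R} {κ : k}
    (hvu : v * u = κ • (u * v)) (hx : ∀ j, x * u ^ j * (v * v) = 0) (n : ℕ) :
    x * (u + v) ^ (n + 1) = x * u ^ (n + 1) +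
      (∑ l ∈ Finset.range (n + 1), κ ^ l) • (x * u ^ n * v) := by
  induction n with
  | zero => simp [mul_add]
  | succ n ih =>
    have h1 : x * u ^ n * v * v = 0 := by rw [mul_assoc, hx]
    have h2 : x * u ^ n * v * u = κ • (x * u ^ (n + 1) * v) := by
      rw [mul_assoc, hvu, mul_smul_comm, pow_succ]; simp only [mul_assoc]
    rw [pow_succ (u + v), ← mul_assoc, ih, add_mul, mul_add, smul_mul_assoc, mul_add, h1, h2,
      add_zero, pow_succ u (n + 1), ← mul_assoc, geom_sum_succ (n := n + 1)]
    rw [smul_smul, add_smul, one_smul, mul_comm κ]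
    abel

theorem q_comm_pow_right {R : Type*} [Ring R] [Algebra k R] {a b : R} {q : k}
    (h : a * b = q • (b * a)) (n : ℕ) : a * b ^ n = q ^ n • (b ^ n * a) := by
  induction n with
  | zero => simp
  | succ n ih =>
    rw [pow_succ, ← mul_assoc, ih, smul_mul_assoc, mul_assoc, h, mul_smul_comm, smul_smul,
      ← mul_assoc, ← pow_succ, pow_succ]

theorem q_comm_pow_left {R : Type*} [Ring R] [Algebra k R] {a b : R} {q : k}
    (h : a * b = q • (b * a)) (n : ℕ) : a ^ n * b = q ^ n • (b * a ^ n) := by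
  induction n with
  | zero => simp
  | succ n ih =>
    rw [pow_succ, mul_assoc, h, mul_smul_comm, ← mul_assoc, ih, smul_mul_assoc, smul_smul,
      mul_assoc, ← pow_succ, mul_comm q, ← pow_succ]

variable {A : Type*} [Ring A] [Algebra k A] {a b d : A} {q : k}

theorem pow_tmul_mul_pow (hab : a * b = q • (b * a)) (hdb : d * b = q⁻¹ • (b * d))
    (j : ℕ) (hb : b ^ (j + 2) = 0) :
    ((b ^ j) ⊗ₜ[k] (1 : A)) * (a ⊗ₜ[k] b + b ⊗ₜ[k] d) ^ (j + 2) =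
      ((∑ l ∈ Finset.range (j + 2), ((q ^ 2)⁻¹) ^ l) * q ^ (j + 1)) •
        ((b ^ (j + 1) * a ^ (j + 1)) ⊗ₜ[k] (b ^ (j + 1) * d)) := by
  rw [mul_add_pow_of_q_comm (κ := (q ^ 2)⁻¹)]
  · simp only [Algebra.TensorProduct.tmul_mul_tmul, Algebra.TensorProduct.tmul_pow, one_mul]
    rw [hb, TensorProduct.tmul_zero, zero_add, mul_assoc, q_comm_pow_left hab, mul_smul_comm,
      ← mul_assoc, ← pow_succ, ← TensorProduct.smul_tmul', smul_smul]
  · simp only [Algebra.TensorProduct.tmul_mul_tmul, hdb, hab, TensorProduct.tmul_smul,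
      TensorProduct.smul_tmul', smul_smul]
    congr 1
    field_simp
  · intro l
    simp only [Algebra.TensorProduct.tmul_mul_tmul, Algebra.TensorProduct.tmul_pow, one_mul]
    rw [mul_assoc, ← mul_assoc (a ^ l), q_comm_pow_left hab, smul_mul_assoc, mul_assoc,
      q_comm_pow_left hab, mul_smul_comm, mul_smul_comm, mul_smul_comm, ← mul_assoc b b,
      ← mul_assoc (b ^ j), ← pow_two, ← pow_add, hb]
    simp

theorem tmul_ne_zero {V W : Type*} [AddCommGroup V] [Module k V] [AddCommGroup W] [Module k W]
    {v : V} {w : W} (hv : v ≠ 0) (hw : w ≠ 0) : v ⊗ₜ[k] w ≠ 0 := by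
  obtain ⟨f, hf⟩ : ∃ f : V →ₗ[k] k, f v ≠ 0 := by
    by_contra! h
    exact hv ((Module.forall_dual_apply_eq_zero_iff k v).1 h)
  obtain ⟨g, hg⟩ : ∃ g : W →ₗ[k] k, g w ≠ 0 := by
    by_contra! h
    exact hw ((Module.forall_dual_apply_eq_zero_iff k w).1 h)
  intro h
  have := congrArg (LinearMap.mul' k k ∘ₗ TensorProduct.map f g) h
  simp [hf, hg] at this

theorem pow_ne_zero_of_q_comm (hq : q ≠ 0) (hab : a * b = q • (b * a))
    (hdb : d * b = q⁻¹ • (b * d)) (ha : IsUnit a) (hd : IsUnit d) (j : ℕ)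
    (hb : b ^ (j + 2) = 0) (hb' : b ^ (j + 1) ≠ 0)
    (hs : ∑ l ∈ Finset.range (j + 2), ((q ^ 2)⁻¹) ^ l ≠ 0) :
    (a ⊗ₜ[k] b + b ⊗ₜ[k] d) ^ (j + 2) ≠ 0 := by
  intro h
  have := pow_tmul_mul_pow hab hdb j hb
  rw [h, mul_zero] at this
  refine smul_ne_zero (mul_ne_zero hs (pow_ne_zero _ hq)) ?_ this.symm
  refine tmul_ne_zero ?_ ?_
  · rwa [Ne, (ha.pow _).mul_left_eq_zero]
  · rwa [Ne, hd.mul_left_eq_zero]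

theorem q_comm_add_pow_mem {R : Type*} [Ring R] [Algebra k R] {u v : R} {κ : k}
    (hvu : v * u = κ • (u * v)) (n : ℕ) :
    (u + v) ^ n ∈ Submodule.span k {x | ∃ i j, i + j = n ∧ x = u ^ i * v ^ j} := by
  induction n with
  | zero => exact Submodule.subset_span ⟨0, 0, rfl, by simp⟩
  | succ n ih =>
    rw [pow_succ]
    have : Submodule.span k {x | ∃ i j, i + j = n ∧ x = u ^ i * v ^ j} ≤
      (Submodule.span k {x | ∃ i j, i + j = n + 1 ∧ x = u ^ i * v ^ j}).comap
        (LinearMap.mulRight k (u + v)) := by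
      rw [Submodule.span_le]
      rintro _ ⟨i, j, hij, rfl⟩
      rw [SetLike.mem_coe, Submodule.mem_comap, LinearMap.mulRight_apply, mul_add, mul_assoc,
        q_comm_pow_left hvu, mul_smul_comm]
      refine add_mem (Submodule.smul_mem _ _ (Submodule.subset_span ⟨i + 1, j, by omega, ?_⟩))
        (Submodule.subset_span ⟨i, j + 1, by omega, ?_⟩)
      · rw [← mul_assoc, ← pow_succ]
      · rw [mul_assoc, ← pow_succ]
    exact this ih

theorem isNilpotent_add_of_q_comm {R : Type*} [Ring R] [Algebra k R] {u v : R} {κ : k}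
    (hvu : v * u = κ • (u * v)) (hu : IsNilpotent u) (hv : IsNilpotent v) :
    IsNilpotent (u + v) := by
  obtain ⟨m, hm⟩ := hu
  obtain ⟨n, hn⟩ := hv
  refine ⟨m + n, ?_⟩
  have := q_comm_add_pow_mem hvu (m + n)
  rwa [show Submodule.span k {x | ∃ i j, i + j = m + n ∧ x = u ^ i * v ^ j} = ⊥ from ?_] at this
  rw [Submodule.span_eq_bot]
  rintro _ ⟨i, j, hij, rfl⟩
  rcases le_or_gt m i with h | h
  · rw [pow_eq_zero_of_le h hm, zero_mul]
  · rw [pow_eq_zero_of_le (by omega : n ≤ j) hn, mul_zero]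

end Power

end HopfClass

end

section

open TensorProduct

namespace HopfClass

section QMat
variable {k : Type*} [Field k] {A : Type*} [Ring A] [Algebra k A]

/-- The defining relations of the quantized coordinate algebra of `SL₂`. -/
structure IsQMat (q : k) (a b c d : A) : Prop where
  q0 : q ≠ 0
  ab : a * b = q • (b * a)
  ac : a * c = q • (c * a)
  bd : b * d = q • (d * b)
  cd : c * d = q • (d * c)
  bc : b * c = c * b
  ad : a * d = 1 + q • (b * c)
  da : d * a = 1 + q⁻¹ • (b * c)

/-- `f` is the central idempotent cutting out the part where `b` and `c` are nilpotent. -/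
structure IsQIdem (b c f : A) : Prop where
  comm : ∀ x, x * f = f * x
  idem : f * f = f
  nilb : ∃ N, b ^ N * f = 0
  nilc : ∃ N, c ^ N * f = 0
  one_sub : ∀ n, ∃ u v, 1 - f = u * b ^ n + v * c ^ n

theorem IsQIdem.symm {b c f : A} (h : IsQIdem b c f) : IsQIdem c b f :=
  ⟨h.comm, h.idem, h.nilc, h.nilb, fun n => by
    obtain ⟨u, v, huv⟩ := h.one_sub n
    exact ⟨v, u, by rw [huv, add_comm]⟩⟩

namespace IsQMat
variable {q : k} {a b c d : A}

theorem symm (h : IsQMat q a b c d) : IsQMat q⁻¹ d c b a where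
  q0 := inv_ne_zero h.q0
  ab := by rw [h.cd, smul_smul, inv_mul_cancel₀ h.q0, one_smul]
  ac := by rw [h.bd, smul_smul, inv_mul_cancel₀ h.q0, one_smul]
  bd := by rw [h.ac, smul_smul, inv_mul_cancel₀ h.q0, one_smul]
  cd := by rw [h.ab, smul_smul, inv_mul_cancel₀ h.q0, one_smul]
  bc := h.bc.symm
  ad := by rw [h.da, h.bc]
  da := by rw [h.ad, h.bc, inv_inv]

theorem ba (h : IsQMat q a b c d) : b * a = q⁻¹ • (a * b) := h.symm.cd
theorem ca (h : IsQMat q a b c d) : c * a = q⁻¹ • (a * c) := h.symm.bd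
theorem db (h : IsQMat q a b c d) : d * b = q⁻¹ • (b * d) := h.symm.ac
theorem dc (h : IsQMat q a b c d) : d * c = q⁻¹ • (c * d) := h.symm.ab

theorem map {B : Type*} [Ring B] [Algebra k B] (φ : A →ₐ[k] B) (h : IsQMat q a b c d) :
    IsQMat q (φ a) (φ b) (φ c) (φ d) where
  q0 := h.q0
  ab := by rw [← map_mul, h.ab, map_smul, map_mul]
  ac := by rw [← map_mul, h.ac, map_smul, map_mul]
  bd := by rw [← map_mul, h.bd, map_smul, map_mul]
  cd := by rw [← map_mul, h.cd, map_smul, map_mul]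
  bc := by rw [← map_mul, h.bc, map_mul]
  ad := by rw [← map_mul, h.ad, map_add, map_smul, map_mul, map_one]
  da := by rw [← map_mul, h.da, map_add, map_smul, map_mul, map_one]

theorem commute_of_gen (hgen : Algebra.adjoin k {a, b, c, d} = ⊤) {f : A}
    (ha : a * f = f * a) (hb : b * f = f * b) (hc : c * f = f * c) (hd : d * f = f * d) (x : A) :
    x * f = f * x := by
  have : Algebra.adjoin k {a, b, c, d} ≤ Subalgebra.centralizer k {f} := by
    apply Algebra.adjoin_le
    rintro y (rfl | rfl | rfl | rfl) <;>
      (rw [SetLike.mem_coe, Subalgebra.mem_centralizer_iff]; rintro _ rfl; symm; assumption)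
  rw [hgen] at this
  exact ((Subalgebra.mem_centralizer_iff k).1 (this (Algebra.mem_top (x := x))) f rfl).symm

theorem exists_isQIdem [FiniteDimensional k A] (h : IsQMat q a b c d)
    (hgen : Algebra.adjoin k {a, b, c, d} = ⊤) :
    ∃ f, IsQIdem b c f := by
  obtain ⟨β, N, hβ, -⟩ := exists_isDrazin k b
  obtain ⟨γ, M, hγ, -⟩ := exists_isDrazin k c
  have hqi := inv_ne_zero h.q0
  have hg : ∀ x, x * (b * β) = b * β * x := by
    apply commute_of_gen hgen
    · exact hβ.commute_idem h.ab h.q0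
    · exact hβ.comm'
    · exact hβ.commute_idem (q := (1 : k)) (by rw [one_smul, h.bc]) one_ne_zero
    · exact hβ.commute_idem h.db hqi
  have hg' : ∀ x, x * (c * γ) = c * γ * x := by
    apply commute_of_gen hgen
    · exact hγ.commute_idem h.ac h.q0
    · exact hγ.commute_idem (q := (1 : k)) (by rw [one_smul, h.bc]) one_ne_zero
    · exact hγ.comm'
    · exact hγ.commute_idem h.dc hqi
  set g := b * β with hgdef
  set g' := c * γ with hgdef'
  have i1 : g * g = g := hβ.idem_mul
  have i2 : g' * g' = g' := hγ.idem_mul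
  refine ⟨(1 - g) * (1 - g'), ?_, ?_, ⟨N, ?_⟩, ⟨M, ?_⟩, ?_⟩
  · intro x
    have c1 : ∀ x, x * (1 - g) = (1 - g) * x := fun x => by rw [mul_sub, hg, sub_mul]; simp
    have c2 : ∀ x, x * (1 - g') = (1 - g') * x := fun x => by rw [mul_sub, hg', sub_mul]; simp
    rw [← mul_assoc, c1, mul_assoc, c2, mul_assoc]
  · have e1 : (1 - g) * (1 - g) = 1 - g := IsIdempotentElem.one_sub i1
    have e2 : (1 - g') * (1 - g') = 1 - g' := IsIdempotentElem.one_sub i2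
    have c2 : (1 - g') * (1 - g) = (1 - g) * (1 - g') := by
      simp only [mul_sub, sub_mul, one_mul, mul_one, hg g']; abel
    rw [mul_assoc, ← mul_assoc (1 - g'), c2, mul_assoc, e2, ← mul_assoc, e1]
  · rw [← mul_assoc, hβ.nil, zero_mul]
  · rw [mul_sub, mul_one, sub_mul, one_mul, hg' g, ← one_mul (1 - g)]
    rw [show (1 * (1 - g) - (g' - g' * g)) = (1 - g') * (1 - g) by noncomm_ring, ← mul_assoc,
      hγ.nil, zero_mul]
  · intro n
    have e1 : g = β ^ n * g * b ^ n := by rw [mul_assoc, ← hg, ← mul_assoc, hβ.pow_eq]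
    have e2 : g' = γ ^ n * g' * c ^ n := by rw [mul_assoc, ← hg', ← mul_assoc, hγ.pow_eq]
    refine ⟨β ^ n * g, (1 - g) * (γ ^ n * g'), ?_⟩
    rw [← e1, mul_assoc, ← e2]; noncomm_ring

end IsQMat
end QMat

end HopfClass

end

section

open TensorProduct

namespace HopfClass
open Coalgebra HopfAlgebra

section Ad
variable (k : Type*) [Field k] (B : Type*) [Ring B] [HopfAlgebra k B]

/-- The antipode as an algebra homomorphism to the opposite algebra. -/
noncomputable def antipodeOp : B →ₐ[k] Bᵐᵒᵖ :=
  AlgHom.ofLinearMap ((MulOpposite.opLinearEquiv k).toLinearMap ∘ₗ antipode k)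
    (by simp [antipode_one])
    (fun x y => by simp [antipode_mul_antidistrib])

theorem antipodeOp_apply (x : B) : antipodeOp k B x = MulOpposite.op (antipode k x) := rfl

/-- The adjoint action `ad h T = h₁ T S(h₂)`. -/
noncomputable def adHom : B →ₐ[k] Module.End k B :=
  (AlgHom.mulLeftRight k B).comp
    ((Algebra.TensorProduct.map (AlgHom.id k B) (antipodeOp k B)).comp (Bialgebra.comulAlgHom k B))

variable {k B}

theorem adHom_apply {x a b c d : B} (h : comul (R := k) x = a ⊗ₜ b + c ⊗ₜ d) (T : B) :
    adHom k B x T = a * T * antipode k b + c * T * antipode k d := by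
  simp [adHom, h, antipodeOp_apply]

end Ad

section
variable {k : Type*} [Field k] {B : Type*} [Ring B] [HopfAlgebra k B]

/-- `B` is generated by the entries `a, b, c, d` of a multiplicative matrix satisfying the
relations of the quantized coordinate algebra of `SL₂`. -/
structure IsQHopf (q : k) (a b c d : B) : Prop extends IsQMat q a b c d where
  gen : Algebra.adjoin k {a, b, c, d} = ⊤
  comul_a : comul (R := k) a = a ⊗ₜ a + b ⊗ₜ c
  comul_b : comul (R := k) b = a ⊗ₜ b + b ⊗ₜ d
  comul_c : comul (R := k) c = c ⊗ₜ a + d ⊗ₜ c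
  comul_d : comul (R := k) d = c ⊗ₜ b + d ⊗ₜ d
  S_a : antipode k a = d
  S_b : antipode k b = -(q⁻¹ • b)
  S_c : antipode k c = -(q • c)
  S_d : antipode k d = a
  counit_a : counit (R := k) a = 1
  counit_b : counit (R := k) b = 0
  counit_c : counit (R := k) c = 0
  counit_d : counit (R := k) d = 1

namespace IsQHopf
variable {q : k} {a b c d f : B}

theorem symm (h : IsQHopf q a b c d) : IsQHopf q⁻¹ d c b a where
  toIsQMat := h.toIsQMat.symm
  gen := by
    rw [← h.gen]; congr 1; ext x; simp only [Set.mem_insert_iff, Set.mem_singleton_iff]; tauto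
  comul_a := by rw [h.comul_d, add_comm]
  comul_b := by rw [h.comul_c, add_comm]
  comul_c := by rw [h.comul_b, add_comm]
  comul_d := by rw [h.comul_a, add_comm]
  S_a := h.S_d
  S_b := by rw [h.S_c, inv_inv]
  S_c := h.S_b
  S_d := h.S_a
  counit_a := h.counit_d
  counit_b := h.counit_c
  counit_c := h.counit_b
  counit_d := h.counit_a

theorem ad_b (h : IsQHopf q a b c d) (T : B) :
    adHom k B b T = b * (T * a) - q⁻¹ • (a * (T * b)) := by
  rw [adHom_apply h.comul_b, h.S_b, h.S_d, mul_neg, mul_smul_comm, mul_assoc, mul_assoc]; abel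

theorem ad_c (h : IsQHopf q a b c d) (T : B) :
    adHom k B c T = c * (T * d) - q • (d * (T * c)) := by
  rw [adHom_apply h.comul_c, h.S_c, h.S_a, mul_neg, mul_smul_comm, mul_assoc, mul_assoc]; abel

theorem ad_b_eq_zero (hf : IsQIdem b c f) (hbf : b * f = 0) {T : B}
    (h1 : adHom k B b (adHom k B b T) = 0) (h2 : adHom k B c (adHom k B c T) = 0) :
    adHom k B b T = 0 := by
  obtain ⟨u, v, huv⟩ := hf.one_sub 2
  have e : adHom k B (1 - f) T = 0 := by
    rw [huv, map_add, map_mul, map_mul, map_pow, map_pow]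
    simp [pow_two, h1, h2]
  have e2 : adHom k B f T = T := by
    rw [map_sub, map_one] at e
    exact (sub_eq_zero.1 e).symm
  have e3 : adHom k B (b * f) T = 0 := by rw [hbf, map_zero]; rfl
  rw [map_mul] at e3
  simpa [e2] using e3

theorem b_mul_ne_zero [FiniteDimensional k B] (h : IsQHopf q a b c d) (hq : q ^ 2 ≠ 1)
    (hf : IsQIdem b c f) (hb : b ≠ 0) : b * f ≠ 0 := by
  intro hbf
  have q0 := h.q0
  have qi0 := inv_ne_zero q0
  have hq1 : (1 - (q ^ 2)⁻¹ : k) ≠ 0 := by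
    rw [sub_ne_zero]; intro hh; exact hq (by rw [← inv_inv (q ^ 2), ← hh, inv_one])
  obtain ⟨β, N, hβ, -⟩ := exists_isDrazin k b
  obtain ⟨γ, M, hγ, -⟩ := exists_isDrazin k c
  have ab' : ∀ z, a * (b * z) = q • (b * (a * z)) := fun z => by
    rw [← mul_assoc, h.ab, smul_mul_assoc, mul_assoc]
  have ac' : ∀ z, a * (c * z) = q • (c * (a * z)) := fun z => by
    rw [← mul_assoc, h.ac, smul_mul_assoc, mul_assoc]
  have db' : ∀ z, d * (b * z) = q⁻¹ • (b * (d * z)) := fun z => by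
    rw [← mul_assoc, h.db, smul_mul_assoc, mul_assoc]
  have dc' : ∀ z, d * (c * z) = q⁻¹ • (c * (d * z)) := fun z => by
    rw [← mul_assoc, h.dc, smul_mul_assoc, mul_assoc]
  have bg : b * γ = γ * b := hγ.commute (k := k) h.bc
  have cb : c * β = β * c := hβ.commute (k := k) h.bc.symm
  have bg' : ∀ z, b * (γ * z) = γ * (b * z) := fun z => by rw [← mul_assoc, bg, mul_assoc]
  have cβ' : ∀ z, c * (β * z) = β * (c * z) := fun z => by rw [← mul_assoc, cb, mul_assoc]
  have bβ' : ∀ z, b * (β * z) = β * (b * z) := fun z => by rw [← mul_assoc, hβ.comm, mul_assoc]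
  have cγ' : ∀ z, c * (γ * z) = γ * (c * z) := fun z => by rw [← mul_assoc, hγ.comm, mul_assoc]
  have cb' : ∀ z, c * (b * z) = b * (c * z) := fun z => by rw [← mul_assoc, ← h.bc, mul_assoc]
  have aβ := hβ.q_comm h.ab q0
  have dβ := hβ.q_comm h.db qi0
  have aγ := hγ.q_comm h.ac q0
  have dγ := hγ.q_comm h.dc qi0
  have aβ' : ∀ z, a * (β * z) = q⁻¹ • (β * (a * z)) := fun z => by
    rw [← mul_assoc, aβ, smul_mul_assoc, mul_assoc]
  have dβ' : ∀ z, d * (β * z) = q • (β * (d * z)) := fun z => by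
    rw [← mul_assoc, dβ, inv_inv, smul_mul_assoc, mul_assoc]
  have aγ' : ∀ z, a * (γ * z) = q⁻¹ • (γ * (a * z)) := fun z => by
    rw [← mul_assoc, aγ, smul_mul_assoc, mul_assoc]
  have dγ' : ∀ z, d * (γ * z) = q • (γ * (d * z)) := fun z => by
    rw [← mul_assoc, dγ, inv_inv, smul_mul_assoc, mul_assoc]
  have ββb : ∀ z, β * (β * (b * z)) = β * z := fun z => by
    rw [← mul_assoc, ← mul_assoc, mul_assoc β, ← hβ.comm, ← mul_assoc, ← hβ.comm, hβ.idem]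
  have γγc : ∀ z, γ * (γ * (c * z)) = γ * z := fun z => by
    rw [← mul_assoc, ← mul_assoc, mul_assoc γ, ← hγ.comm, ← mul_assoc, ← hγ.comm, hγ.idem]
  have β1 : adHom k B b (β * β) = (1 - (q ^ 2)⁻¹) • (β * a) := by
    rw [h.ad_b]
    simp only [mul_assoc, bβ', aβ', h.ab, mul_smul_comm, smul_smul, ββb]
    match_scalars
    field_simp
  have β2 : adHom k B b (β * a) = 0 := by
    rw [h.ad_b]
    simp only [mul_assoc, bβ', aβ', h.ab, ab', mul_smul_comm, smul_smul]
    match_scalars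
    field_simp; ring
  have β3 : adHom k B c (β * β) = (1 - q ^ 2) • (β * (β * (c * d))) := by
    rw [h.ad_c]
    simp only [mul_assoc, cβ', dβ', h.dc, mul_smul_comm, smul_smul]
    match_scalars
    field_simp
  have β4 : adHom k B c (β * (β * (c * d))) = 0 := by
    rw [h.ad_c]
    simp only [mul_assoc, cβ', dβ', h.dc, dc', mul_smul_comm, smul_smul]
    match_scalars
    field_simp; ring
  have βa : β * a = 0 := by
    have := ad_b_eq_zero hf hbf (T := β * β) (by rw [β1, map_smul, β2, smul_zero])
      (by rw [β3, map_smul, β4, smul_zero])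
    rw [β1] at this
    exact (smul_eq_zero.1 this).resolve_left hq1
  have γ1 : adHom k B b (γ * γ) = (1 - (q ^ 2)⁻¹) • (γ * (γ * (b * a))) := by
    rw [h.ad_b]
    simp only [mul_assoc, bg', aγ', h.ab, mul_smul_comm, smul_smul]
    match_scalars
    field_simp
  have γ2 : adHom k B b (γ * (γ * (b * a))) = 0 := by
    rw [h.ad_b]
    simp only [mul_assoc, bg', aγ', h.ab, ab', mul_smul_comm, smul_smul]
    match_scalars
    field_simp; ring
  have γ3 : adHom k B c (γ * γ) = (1 - q ^ 2) • (γ * d) := by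
    rw [h.ad_c]
    simp only [mul_assoc, cγ', dγ', h.dc, mul_smul_comm, smul_smul, γγc]
    match_scalars
    field_simp
  have γ4 : adHom k B c (γ * d) = 0 := by
    rw [h.ad_c]
    simp only [mul_assoc, cγ', dγ', h.dc, dc', mul_smul_comm, smul_smul]
    match_scalars
    field_simp; ring
  have γba : γ * (γ * (b * a)) = 0 := by
    have := ad_b_eq_zero hf hbf (T := γ * γ) (by rw [γ1, map_smul, γ2, smul_zero])
      (by rw [γ3, map_smul, γ4, smul_zero])
    rw [γ1] at this
    exact (smul_eq_zero.1 this).resolve_left hq1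
  -- `b` is nilpotent
  have hg : b * β = 0 := by
    have e0 : b * β * a = 0 := by rw [mul_assoc, βa, mul_zero]
    have ga : a * (b * β) = b * β * a := hβ.commute_idem h.ab q0
    have gd : d * (b * β) = b * β * d := hβ.commute_idem h.db (inv_ne_zero q0)
    have e1 : b * β * (a * d) = 0 := by rw [← mul_assoc, e0, zero_mul]
    have e2 : b * β * (d * a) = 0 := by
      rw [← mul_assoc, ← gd, mul_assoc, e0, mul_zero]
    rw [h.ad, mul_add, mul_one, mul_smul_comm] at e1
    rw [h.da, mul_add, mul_one, mul_smul_comm] at e2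
    have e3 : (q - q⁻¹) • (b * β * (b * c)) = 0 := by
      rw [sub_smul, ← add_sub_add_left_eq_sub _ _ (b * β), e1, e2, sub_zero]
    have : q - q⁻¹ ≠ 0 := by
      rw [sub_ne_zero]; intro hh
      apply hq; rw [pow_two]; nth_rw 2 [hh]; exact mul_inv_cancel₀ q0
    rw [(smul_eq_zero.1 e3).resolve_left this, smul_zero, add_zero] at e1
    exact e1
  have hbN : b ^ N = 0 := by simpa [hg] using hβ.nil
  have hgcb : c * γ * b = 0 := by
    have e1 : c * γ * b * a = 0 := by
      rw [hγ.comm]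
      have := congrArg (fun z => c * z) γba
      simp only [cγ', mul_zero] at this
      have e := congrArg (fun z => c * z) this
      simp only [cγ', γγc, mul_zero] at e
      simpa only [mul_assoc] using e
    have e2 : c * γ * b * (1 + q • (b * c)) = 0 := by
      rw [← h.ad, ← mul_assoc, e1, zero_mul]
    have hn : IsNilpotent (q • (b * c)) := by
      refine ⟨N, ?_⟩
      rw [smul_pow, (show Commute b c from h.bc).mul_pow, hbN, zero_mul, smul_zero]
    exact (hn.isUnit_one_add.mul_left_eq_zero).1 e2
  have hcMb : c ^ M * b = 0 := by
    have e1 : c ^ M * b = c ^ M * (1 - c * γ) * b + c ^ M * (c * γ * b) := by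
      rw [mul_sub, sub_mul, mul_one, ← mul_assoc (c ^ M) _ b, sub_add_cancel]
    rw [e1, hγ.nil, hgcb, zero_mul, mul_zero, add_zero]
  apply hb
  obtain ⟨u, v, huv⟩ := hf.one_sub (N + M)
  have e : (1 - f) * b = 0 := by
    rw [huv, pow_add, pow_add, hbN, add_mul, (pow_mul_comm c N M)]
    have : c ^ M * c ^ N * b = 0 := by
      rw [mul_assoc, ← (show Commute b c from h.bc).pow_right N, ← mul_assoc, hcMb, zero_mul]
    simp [mul_assoc, this]
  rw [sub_mul, one_mul, ← hf.comm, hbf, sub_zero] at e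
  exact e

theorem c_mul_ne_zero [FiniteDimensional k B] (h : IsQHopf q a b c d) (hq : q ^ 2 ≠ 1)
    (hf : IsQIdem b c f) (hc : c ≠ 0) : c * f ≠ 0 :=
  h.symm.b_mul_ne_zero (by rwa [inv_pow, Ne, inv_eq_one]) hf.symm hc

end IsQHopf
end

end HopfClass

end

section

open TensorProduct

namespace HopfClass
open Coalgebra HopfAlgebra

section Gen
variable {k : Type*} [Field k] {A : Type*} [Ring A] [Algebra k A] {X : Set A}

theorem mul_mem_of_adjoin_eq_top (hX : Algebra.adjoin k X = ⊤) {W : Submodule k A}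
    (h : ∀ x ∈ X, ∀ w ∈ W, x * w ∈ W) (x : A) : ∀ w ∈ W, x * w ∈ W := by
  have hx : x ∈ Algebra.adjoin k X := hX ▸ Algebra.mem_top
  induction hx using Algebra.adjoin_induction with
  | mem x hx => exact h x hx
  | algebraMap r => intro w hw; rw [← Algebra.smul_def]; exact W.smul_mem r hw
  | add x y _ _ hx hy => intro w hw; rw [add_mul]; exact add_mem (hx w hw) (hy w hw)
  | mul x y _ _ hx hy => intro w hw; rw [mul_assoc]; exact hx _ (hy w hw)

theorem mem_mul_of_adjoin_eq_top (hX : Algebra.adjoin k X = ⊤) {W : Submodule k A}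
    (h : ∀ x ∈ X, ∀ w ∈ W, w * x ∈ W) (x : A) : ∀ w ∈ W, w * x ∈ W := by
  have hx : x ∈ Algebra.adjoin k X := hX ▸ Algebra.mem_top
  induction hx using Algebra.adjoin_induction with
  | mem x hx => exact h x hx
  | algebraMap r =>
    intro w hw; rw [← Algebra.commutes, ← Algebra.smul_def]; exact W.smul_mem r hw
  | add x y _ _ hx hy => intro w hw; rw [mul_add]; exact add_mem (hx w hw) (hy w hw)
  | mul x y _ _ hx hy => intro w hw; rw [← mul_assoc]; exact hy _ (hx w hw)

/-- An eigenvector modulo a stable complement-free subspace gives a character. -/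
theorem exists_algHom_of_stable {V : Type*} [AddCommGroup V] [Module k V]
    (ρ : A →ₐ[k] Module.End k V) (N : Submodule k V) (hN : ∀ x, ∀ w ∈ N, ρ x w ∈ N)
    {v : V} (hv : v ∉ N) (h : ∀ x, ∃ r : k, ρ x v - r • v ∈ N) :
    ∃ χ : A →ₐ[k] k, ∀ x, ∀ r : k, ρ x v - r • v ∈ N → χ x = r := by
  obtain ⟨l, hlv, hl⟩ := Submodule.exists_le_ker_of_notMem hv
  have hl' : ∀ w ∈ N, l w = 0 := fun w hw => hl hw
  set l' := (l v)⁻¹ • l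
  have e1 : ∀ x, ∀ r : k, ρ x v - r • v ∈ N → l' (ρ x v) = r := by
    intro x r hr
    have := hl' _ hr
    rw [map_sub, map_smul, sub_eq_zero] at this
    simp [l', this]
    field_simp
  let L : A →ₗ[k] k := l' ∘ₗ (LinearMap.applyₗ v) ∘ₗ ρ.toLinearMap
  refine ⟨AlgHom.ofLinearMap L ?_ ?_, e1⟩
  · exact e1 1 1 (by simp)
  · intro x y
    obtain ⟨r, hr⟩ := h x
    obtain ⟨s, hs⟩ := h y
    have e2 : ρ (x * y) v - (r * s) • v ∈ N := by
      have : ρ (x * y) v - (r * s) • v = ρ x (ρ y v - s • v) + s • (ρ x v - r • v) := by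
        rw [map_mul, Module.End.mul_apply, map_sub, map_smul, smul_sub, smul_smul, mul_comm s]
        abel
      rw [this]
      exact add_mem (hN _ _ hs) (N.smul_mem _ hr)
    change l' (ρ (x * y) v) = l' (ρ x v) * l' (ρ y v)
    rw [e1 _ _ hr, e1 _ _ hs, e1 _ _ e2]

end Gen

namespace IsQMat
variable {k : Type*} [Field k] {A : Type*} [Ring A] [Algebra k A] {q : k} {a b c d f : A}

theorem exists_char_of_eigenvector (h : IsQMat q a b c d)
    (hgen : Algebra.adjoin k {a, b, c, d} = ⊤) (hf : IsQIdem b c f) {v : A} {l : k}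
    (hv : v ≠ 0) (hfv : f * v = v) (hav : a * v = l • v) :
    ∃ χ : A →ₐ[k] k, χ a = l ∧ χ b = 0 ∧ χ c = 0 := by
  obtain ⟨n₁, hn₁⟩ := hf.nilb
  obtain ⟨n₂, hn₂⟩ := hf.nilc
  let N : Submodule k A := LinearMap.range (LinearMap.mulLeft k b ∘ₗ LinearMap.mulRight k v) ⊔
    LinearMap.range (LinearMap.mulLeft k c ∘ₗ LinearMap.mulRight k v)
  have hNmem : ∀ w, w ∈ N ↔ ∃ x y, b * (x * v) + c * (y * v) = w := by
    intro w
    simp only [N, Submodule.mem_sup, LinearMap.mem_range, LinearMap.comp_apply,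
      LinearMap.mulLeft_apply, LinearMap.mulRight_apply]
    constructor
    · rintro ⟨_, ⟨x, rfl⟩, _, ⟨y, rfl⟩, rfl⟩; exact ⟨x, y, rfl⟩
    · rintro ⟨x, y, rfl⟩; exact ⟨_, ⟨x, rfl⟩, _, ⟨y, rfl⟩, rfl⟩
  have hbN : ∀ x, b * (x * v) ∈ N := fun x => (hNmem _).2 ⟨x, 0, by simp⟩
  have hcN : ∀ x, c * (x * v) ∈ N := fun x => (hNmem _).2 ⟨0, x, by simp⟩
  have hN : ∀ x, ∀ w ∈ N, x * w ∈ N := by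
    apply mul_mem_of_adjoin_eq_top hgen
    intro z hz w hw
    obtain ⟨x, y, rfl⟩ := (hNmem w).1 hw
    rw [mul_add]
    rcases hz with rfl | rfl | rfl | rfl
    · rw [← mul_assoc, ← mul_assoc z c, h.ab, h.ac, smul_mul_assoc, smul_mul_assoc]
      have := add_mem (N.smul_mem q (hbN (z * x))) (N.smul_mem q (hcN (z * y)))
      simpa only [mul_assoc] using this
    · rw [← mul_assoc z x, ← mul_assoc c y, ]
      exact add_mem (hbN _) (hbN _)
    · rw [← mul_assoc b x, ← mul_assoc z y, ]
      exact add_mem (hcN _) (hcN _)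
    · rw [← mul_assoc, ← mul_assoc z c, h.db, h.dc, smul_mul_assoc, smul_mul_assoc]
      have := add_mem (N.smul_mem q⁻¹ (hbN (z * x))) (N.smul_mem q⁻¹ (hcN (z * y)))
      simpa only [mul_assoc] using this
  have hvN : v ∉ N := by
    intro hvN
    have hall : ∀ x, x * v ∈ N := fun x => hN x v hvN
    have s1 : ∀ n x, ∃ y z, x * v = b ^ n * (y * v) + c * (z * v) := by
      intro n
      induction n with
      | zero => exact fun x => ⟨x, 0, by simp⟩
      | succ n ih =>
        intro x
        obtain ⟨y, z, hyz⟩ := ih x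
        obtain ⟨y', z', hy'⟩ := (hNmem _).1 (hall y)
        refine ⟨y', b ^ n * z' + z, ?_⟩
        rw [hyz, ← hy', mul_add, pow_succ, add_mul, mul_add, ← mul_assoc (b ^ n) c,
          (show Commute b c from h.bc).pow_left n]
        simp only [mul_assoc, add_assoc]
    have s2 : ∀ x, ∃ z, x * v = c * (z * v) := by
      intro x
      obtain ⟨y, z, hyz⟩ := s1 n₁ x
      refine ⟨z, ?_⟩
      have : b ^ n₁ * (y * v) = 0 := by
        rw [← hfv, ← mul_assoc y, hf.comm, ← mul_assoc, ← mul_assoc, hn₁, zero_mul, zero_mul]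
      rw [hyz, this, zero_add]
    have s3 : ∀ n x, ∃ z, x * v = c ^ n * (z * v) := by
      intro n
      induction n with
      | zero => exact fun x => ⟨x, by simp⟩
      | succ n ih =>
        intro x
        obtain ⟨y, hy⟩ := ih x
        obtain ⟨z, hz⟩ := s2 y
        exact ⟨z, by rw [hy, hz, pow_succ, mul_assoc]⟩
    obtain ⟨z, hz⟩ := s3 n₂ 1
    apply hv
    rw [one_mul] at hz
    rw [hz, ← hfv, ← mul_assoc z, hf.comm, ← mul_assoc, ← mul_assoc, hn₂, zero_mul, zero_mul]
  have hl : l ≠ 0 := by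
    rintro rfl
    have : d * (a * v) = 0 := by rw [hav, zero_smul, mul_zero]
    rw [← mul_assoc, h.da, add_mul, one_mul, smul_mul_assoc, mul_assoc] at this
    exact hvN (by
      rw [add_eq_zero_iff_eq_neg.1 this]
      exact N.neg_mem (N.smul_mem _ (hbN _)))
  have hdv : d * v - l⁻¹ • v ∈ N := by
    have : d * (a * v) = v + q⁻¹ • (b * (c * v)) := by
      rw [← mul_assoc, h.da, add_mul, one_mul, smul_mul_assoc, mul_assoc]
    rw [hav, mul_smul_comm] at this
    have e : d * v - l⁻¹ • v = l⁻¹ • (q⁻¹ • (b * (c * v))) := by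
      rw [← add_sub_cancel_left v (q⁻¹ • (b * (c * v))), ← this, smul_sub, smul_smul,
        inv_mul_cancel₀ hl, one_smul]
    rw [e]
    exact N.smul_mem _ (N.smul_mem _ (hbN _))
  let P : Submodule k A := Submodule.span k {v} ⊔ N
  have hP : ∀ x, ∀ w ∈ P, x * w ∈ P := by
    apply mul_mem_of_adjoin_eq_top hgen
    intro z hz w hw
    obtain ⟨w₁, hw₁, w₂, hw₂, rfl⟩ := Submodule.mem_sup.1 hw
    obtain ⟨r, rfl⟩ := Submodule.mem_span_singleton.1 hw₁
    rw [mul_add, mul_smul_comm]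
    refine add_mem (P.smul_mem _ ?_) ((le_sup_right : N ≤ P) (hN _ _ hw₂))
    have hvP : v ∈ P := (le_sup_left : _ ≤ P) (Submodule.mem_span_singleton_self v)
    rcases hz with rfl | rfl | rfl | rfl
    · rw [hav]; exact P.smul_mem _ hvP
    · have := hbN 1; rw [one_mul] at this; exact (le_sup_right : N ≤ P) this
    · have := hcN 1; rw [one_mul] at this; exact (le_sup_right : N ≤ P) this
    · rw [← sub_add_cancel (z * v) (l⁻¹ • v)]
      exact add_mem ((le_sup_right : N ≤ P) hdv) (P.smul_mem _ hvP)
  obtain ⟨χ, hχ⟩ := exists_algHom_of_stable (Algebra.lmul k A) N (fun x w hw => hN x w hw) hvN (by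
    intro x
    have hvP : v ∈ P := (le_sup_left : _ ≤ P) (Submodule.mem_span_singleton_self v)
    obtain ⟨w₁, hw₁, w₂, hw₂, hw⟩ := Submodule.mem_sup.1 (hP x v hvP)
    obtain ⟨r, rfl⟩ := Submodule.mem_span_singleton.1 hw₁
    exact ⟨r, by
      change x * v - r • v ∈ N
      rw [← hw]; simpa using hw₂⟩)
  refine ⟨χ, hχ _ _ ?_, hχ _ _ ?_, hχ _ _ ?_⟩
  · change a * v - l • v ∈ N
    rw [hav, sub_self]; exact N.zero_mem
  · change b * v - (0 : k) • v ∈ N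
    have := hbN 1; rw [one_mul] at this; rwa [zero_smul, sub_zero]
  · change c * v - (0 : k) • v ∈ N
    have := hcN 1; rw [one_mul] at this; rwa [zero_smul, sub_zero]

theorem exists_char_of_generalized (h : IsQMat q a b c d)
    (hgen : Algebra.adjoin k {a, b, c, d} = ⊤) (hf : IsQIdem b c f) {l : k} (n : ℕ) {v : A}
    (hv : v ≠ 0) (hfv : f * v = v) (hav : (a - algebraMap k A l) ^ n * v = 0) :
    ∃ χ : A →ₐ[k] k, χ a = l ∧ χ b = 0 ∧ χ c = 0 := by
  induction n generalizing v with
  | zero => rw [pow_zero, one_mul] at hav; exact absurd hav hv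
  | succ n ih =>
    by_cases h0 : (a - algebraMap k A l) * v = 0
    · refine h.exists_char_of_eigenvector hgen hf hv hfv ?_
      rwa [sub_mul, sub_eq_zero, ← Algebra.smul_def] at h0
    · refine ih h0 ?_ (by rw [← mul_assoc, ← pow_succ, hav])
      rw [← mul_assoc, ← hf.comm, mul_assoc, hfv]

theorem exists_two_chars [IsAlgClosed k] [FiniteDimensional k A] (h : IsQMat q a b c d)
    (hgen : Algebra.adjoin k {a, b, c, d} = ⊤) (hf : IsQIdem b c f) (hbf : b * f ≠ 0) :
    ∃ (l : k) (χ χ' : A →ₐ[k] k), χ a = l ∧ χ b = 0 ∧ χ c = 0 ∧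
      χ' a = q * l ∧ χ' b = 0 ∧ χ' c = 0 := by
  have htop := Module.End.iSup_maxGenEigenspace_eq_top (LinearMap.mulLeft k a)
  obtain ⟨l, w, hw, hbw⟩ : ∃ l, ∃ w ∈ Module.End.maxGenEigenspace (LinearMap.mulLeft k a) l,
      b * (f * w) ≠ 0 := by
    by_contra! hcon
    have : (⊤ : Submodule k A) ≤ LinearMap.ker (LinearMap.mulLeft k (b * f)) := by
      rw [← htop, iSup_le_iff]
      intro l w hw
      rw [LinearMap.mem_ker, LinearMap.mulLeft_apply, mul_assoc]
      exact hcon l w hw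
    have h1 := this (Submodule.mem_top (x := 1))
    rw [LinearMap.mem_ker, LinearMap.mulLeft_apply, mul_one] at h1
    exact hbf h1
  obtain ⟨n, hn⟩ := (Module.End.mem_maxGenEigenspace _ _ _).1 hw
  have hn' : ∀ m (z : A), ((LinearMap.mulLeft k a - l • 1) ^ m) z =
      (a - algebraMap k A l) ^ m * z := by
    intro m
    induction m with
    | zero => simp
    | succ m ih =>
      intro z
      rw [pow_succ, Module.End.mul_apply, ih, pow_succ, mul_assoc]
      congr 1
      simp [sub_mul, Algebra.smul_def]
  rw [hn'] at hn
  have e1 : (a - algebraMap k A l) ^ n * (f * w) = 0 := by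
    rw [← mul_assoc, hf.comm, mul_assoc, hn, mul_zero]
  have hfw : f * w ≠ 0 := fun h0 => hbw (by rw [h0, mul_zero])
  have hff : f * (f * w) = f * w := by rw [← mul_assoc, hf.idem]
  obtain ⟨χ, h1, h2, h3⟩ := h.exists_char_of_generalized hgen hf n hfw hff e1
  have hshift : ∀ m, (a - algebraMap k A (q * l)) ^ m * b =
      q ^ m • (b * (a - algebraMap k A l) ^ m) := by
    intro m
    have e0 : (a - algebraMap k A (q * l)) * b = q • (b * (a - algebraMap k A l)) := by
      simp only [Algebra.algebraMap_eq_smul_one, sub_mul, mul_sub, h.ab, smul_sub,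
        smul_mul_assoc, mul_smul_comm, one_mul, mul_one, smul_smul]
    induction m with
    | zero => simp
    | succ m ih =>
      rw [pow_succ, mul_assoc, e0, mul_smul_comm, ← mul_assoc, ih, smul_mul_assoc, smul_smul,
        mul_assoc, ← pow_succ, ← pow_succ']
  obtain ⟨χ', h1', h2', h3'⟩ := h.exists_char_of_generalized hgen hf (l := q * l) n hbw
    (by rw [← mul_assoc, ← hf.comm, mul_assoc, hff])
    (by rw [← mul_assoc, hshift, smul_mul_assoc, mul_assoc, e1, mul_zero, smul_zero])
  exact ⟨l, χ, χ', h1, h2, h3, h1', h2', h3'⟩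

end IsQMat

end HopfClass

end

section

open TensorProduct

namespace HopfClass
open Coalgebra HopfAlgebra

section
variable {k : Type*} [Field k] {B : Type*} [Ring B] [HopfAlgebra k B] {q : k} {a b c d f : B}

theorem convOne_ofConv_apply (x : B) : (1 : WithConv (B →ₐ[k] k)).ofConv x =
    counit (R := k) x := rfl

/-- The composite of a character with the antipode. -/
noncomputable def charInv (χ : B →ₐ[k] k) : B →ₐ[k] k :=
  AlgHom.ofLinearMap (χ.toLinearMap ∘ₗ antipode k) (by simp [antipode_one])
    (fun x y => by simp [antipode_mul_antidistrib, mul_comm])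

theorem charInv_apply (χ : B →ₐ[k] k) (x : B) : charInv χ x = χ (antipode k x) := rfl

namespace IsQHopf

theorem exists_char [IsAlgClosed k] [FiniteDimensional k B] (h : IsQHopf q a b c d)
    (hf : IsQIdem b c f) (hbf : b * f ≠ 0) :
    ∃ α : WithConv (B →ₐ[k] k), α.ofConv a = q ∧ α.ofConv b = 0 ∧ α.ofConv c = 0 ∧
      α.ofConv d = q⁻¹ := by
  obtain ⟨l, χ, χ', h1, h2, h3, h1', h2', h3'⟩ := h.toIsQMat.exists_two_chars h.gen hf hbf
  have e : l * χ d = 1 := by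
    have := congrArg χ h.ad
    simpa [h1, h2, h3] using this
  have e' : q * l * χ' d = 1 := by
    have := congrArg χ' h.ad
    simpa [h1', h2', h3'] using this
  refine ⟨WithConv.toConv χ' * WithConv.toConv (charInv χ), ?_, ?_, ?_, ?_⟩
  · rw [convMul_ofConv_apply, h.comul_a]
    simp [charInv_apply, h1', h2', h.S_a, mul_assoc, e]
  · rw [convMul_ofConv_apply, h.comul_b]
    simp [charInv_apply, h2', h.S_b, h2]
  · rw [convMul_ofConv_apply, h.comul_c]
    simp [charInv_apply, h3', h.S_c, h3]
  · rw [convMul_ofConv_apply, h.comul_d]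
    simp only [map_add, TensorProduct.map_tmul, AlgHom.toLinearMap_apply, LinearMap.mul'_apply,
      charInv_apply, h3', h.S_d, h1]
    rw [zero_mul, zero_add]
    have := h.q0
    field_simp
    linear_combination e'

theorem char_pow (h : IsQHopf q a b c d) {α : WithConv (B →ₐ[k] k)} (ha : α.ofConv a = q)
    (hb : α.ofConv b = 0) (hc : α.ofConv c = 0) (hd : α.ofConv d = q⁻¹) (n : ℕ) :
    (α ^ n).ofConv a = q ^ n ∧ (α ^ n).ofConv b = 0 ∧ (α ^ n).ofConv c = 0 ∧
      (α ^ n).ofConv d = (q⁻¹) ^ n := by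
  induction n with
  | zero =>
    simp only [pow_zero, convOne_ofConv_apply, h.counit_a, h.counit_b, h.counit_c, h.counit_d,
      and_self]
  | succ n ih =>
    obtain ⟨i1, i2, i3, i4⟩ := ih
    simp [pow_succ, convMul_ofConv_apply, h.comul_a, h.comul_b, h.comul_c, h.comul_d, i1, i2, i3,
      i4, ha, hb, hc, hd]

theorem char_pow_eq_one_iff (h : IsQHopf q a b c d) {α : WithConv (B →ₐ[k] k)}
    (ha : α.ofConv a = q) (hb : α.ofConv b = 0) (hc : α.ofConv c = 0) (hd : α.ofConv d = q⁻¹)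
    (n : ℕ) : α ^ n = 1 ↔ q ^ n = 1 := by
  obtain ⟨i1, i2, i3, i4⟩ := h.char_pow ha hb hc hd n
  constructor
  · intro e
    rw [← i1, e, convOne_ofConv_apply, h.counit_a]
  · intro e
    have : (α ^ n).ofConv = (1 : WithConv (B →ₐ[k] k)).ofConv := by
      apply AlgHom.ext_of_adjoin_eq_top h.gen
      rintro x (rfl | rfl | rfl | rfl) <;> rw [convOne_ofConv_apply]
      · rw [i1, e, h.counit_a]
      · rw [i2, h.counit_b]
      · rw [i3, h.counit_c]
      · rw [i4, inv_pow, e, inv_one, h.counit_d]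
    exact congrArg WithConv.toConv this

theorem isOfFinOrder_of_char [FiniteDimensional k B] (h : IsQHopf q a b c d)
    {α : WithConv (B →ₐ[k] k)}
    (ha : α.ofConv a = q) (hb : α.ofConv b = 0) (hc : α.ofConv c = 0) (hd : α.ofConv d = q⁻¹) :
    IsOfFinOrder q := by
  obtain ⟨m, n, hmn, he⟩ := Finite.exists_ne_map_eq_of_infinite (fun n : ℕ => (α ^ n).ofConv)
  wlog hlt : m < n generalizing m n
  · exact this n m hmn.symm he.symm (by omega)
  have e : q ^ m = q ^ n := by
    rw [← (h.char_pow ha hb hc hd m).1, ← (h.char_pow ha hb hc hd n).1]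
    exact congrArg (fun φ : B →ₐ[k] k => φ a) he
  rw [isOfFinOrder_iff_pow_eq_one]
  refine ⟨n - m, by omega, ?_⟩
  apply mul_left_cancel₀ (pow_ne_zero m h.q0)
  rw [← pow_add, Nat.add_sub_cancel' hlt.le, mul_one, e]

theorem order_eq [IsAlgClosed k] [CharZero k] [FiniteDimensional k B] (h : IsQHopf q a b c d)
    (hf : IsQIdem b c f) (hbf : b * f ≠ 0) {p n : ℕ} (hp : p.Prime) (hodd : Odd p)
    (hdim : Module.finrank k B ∣ p ^ n) (hq1 : q ≠ 1) :
    0 < orderOf q ∧ Odd (orderOf q) ∧ p ≤ orderOf q := by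
  obtain ⟨α, ha, hb, hc, hd⟩ := h.exists_char hf hbf
  have hfin := (h.isOfFinOrder_of_char ha hb hc hd)
  have hpos := hfin.orderOf_pos
  have hprime : ∀ r : ℕ, r.Prime → r ∣ orderOf q → r = p := by
    intro r hr hrd
    obtain ⟨s, hs⟩ := hrd
    have hs0 : 0 < s := Nat.pos_of_ne_zero (by rintro rfl; omega)
    have h1 : (α ^ s) ^ r = 1 := by
      rw [← pow_mul, mul_comm, ← hs, h.char_pow_eq_one_iff ha hb hc hd, pow_orderOf_eq_one]
    have h2 : α ^ s ≠ 1 := by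
      rw [Ne, h.char_pow_eq_one_iff ha hb hc hd]
      intro e
      have := Nat.le_of_dvd hs0 (orderOf_dvd_of_pow_eq_one e)
      rw [hs] at this
      have := hr.two_le
      nlinarith
    have := (prime_dvd_finrank hr h1 h2).trans hdim
    exact (Nat.prime_dvd_prime_iff_eq hr hp).1 (hr.dvd_of_dvd_pow this)
  have h1 : orderOf q ≠ 1 := by rwa [Ne, orderOf_eq_one_iff]
  refine ⟨hpos, ?_, ?_⟩
  · rw [← Nat.not_even_iff_odd, even_iff_two_dvd]
    intro h2
    have := hprime 2 Nat.prime_two h2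
    rw [← this] at hodd
    exact absurd hodd (by decide)
  · obtain ⟨r, hr, hrd⟩ := Nat.exists_prime_and_dvd h1
    have := hprime r hr hrd
    exact this ▸ Nat.le_of_dvd hpos hrd

theorem mul_mem_span (h : IsQHopf q a b c d) {y : B} {l : k} (hy : y ≠ 0) (ha : y * a = l • y)
    (hb : y * b = 0) (hc : y * c = 0) (x : B) : y * x ∈ Submodule.span k {y} := by
  have had : y * (a * d) = y := by
    rw [h.ad, mul_add, mul_one, mul_smul_comm, ← mul_assoc, hb, zero_mul, smul_zero, add_zero]
  have hl : l ≠ 0 := by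
    rintro rfl
    rw [← mul_assoc, ha, zero_smul, zero_mul] at had
    exact hy had.symm
  have hd : y * d = l⁻¹ • y := by
    rw [← mul_assoc, ha, smul_mul_assoc] at had
    rw [← one_smul k (y * d), ← inv_mul_cancel₀ hl, ← smul_smul, had]
  refine mem_mul_of_adjoin_eq_top h.gen ?_ x y (Submodule.mem_span_singleton_self y)
  rintro x hx w hw
  obtain ⟨r, rfl⟩ := Submodule.mem_span_singleton.1 hw
  rw [smul_mul_assoc]
  apply Submodule.smul_mem
  rw [Submodule.mem_span_singleton]
  rcases hx with rfl | rfl | rfl | rfl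
  exacts [⟨l, ha.symm⟩, ⟨0, by rw [hb, zero_smul]⟩, ⟨0, by rw [hc, zero_smul]⟩, ⟨_, hd.symm⟩]

theorem exists_rank_one [IsAlgClosed k] [FiniteDimensional k B] (h : IsQHopf q a b c d)
    (hf : IsQIdem b c f) (hf0 : f ≠ 0) :
    ∃ y : B, y ≠ 0 ∧ ∀ x, y * x ∈ Submodule.span k {y} := by
  classical
  obtain ⟨n₁, hn₁⟩ := hf.nilb
  obtain ⟨n₂, hn₂⟩ := hf.nilc
  obtain ⟨y₁, hy₁, hb₁, hc₁⟩ : ∃ y : B, y ≠ 0 ∧ y * b = 0 ∧ y * c ^ n₂ = 0 := by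
    have ex : ∃ m, f * b ^ m = 0 := ⟨n₁, by rw [← hf.comm, hn₁]⟩
    obtain ⟨m, hm⟩ : ∃ m, Nat.find ex = m + 1 := Nat.exists_eq_succ_of_ne_zero (by
      intro h0
      have := Nat.find_spec ex
      rw [h0, pow_zero, mul_one] at this
      exact hf0 this)
    refine ⟨f * b ^ m, Nat.find_min ex (by omega), ?_, ?_⟩
    · rw [mul_assoc, ← pow_succ, ← hm]; exact Nat.find_spec ex
    · rw [mul_assoc, (show Commute b c from h.bc).pow_pow, ← mul_assoc, ← hf.comm, hn₂, zero_mul]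
  obtain ⟨y₂, hy₂, hb₂, hc₂⟩ : ∃ y : B, y ≠ 0 ∧ y * b = 0 ∧ y * c = 0 := by
    have ex : ∃ m, y₁ * c ^ m = 0 := ⟨n₂, hc₁⟩
    obtain ⟨m, hm⟩ : ∃ m, Nat.find ex = m + 1 := Nat.exists_eq_succ_of_ne_zero (by
      intro h0
      have := Nat.find_spec ex
      rw [h0, pow_zero, mul_one] at this
      exact hy₁ this)
    refine ⟨y₁ * c ^ m, Nat.find_min ex (by omega), ?_, ?_⟩
    · rw [mul_assoc, ← (show Commute b c from h.bc).pow_right, ← mul_assoc, hb₁, zero_mul]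
    · rw [mul_assoc, ← pow_succ, ← hm]; exact Nat.find_spec ex
  let W : Submodule k B := LinearMap.ker (LinearMap.mulRight k b) ⊓ LinearMap.ker (LinearMap.mulRight k c)
  have hW : ∀ w, w ∈ W ↔ w * b = 0 ∧ w * c = 0 := fun w => by
    simp [W]
  have hmap : ∀ w ∈ W, LinearMap.mulRight k a w ∈ W := by
    intro w hw
    rw [hW] at hw ⊢
    simp [mul_assoc, h.ab, h.ac]
    simp [← mul_assoc, hw.1, hw.2]
  have : Nontrivial W := ⟨⟨⟨y₂, (hW _).2 ⟨hb₂, hc₂⟩⟩, 0, fun e => hy₂ (congrArg Subtype.val e)⟩⟩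
  obtain ⟨l, hl⟩ := Module.End.exists_eigenvalue ((LinearMap.mulRight k a).restrict hmap)
  obtain ⟨w, hw⟩ := hl.exists_hasEigenvector
  have e := congrArg Subtype.val hw.apply_eq_smul
  have hw0 : (w : B) ≠ 0 := fun e => hw.2 (Subtype.ext e)
  exact ⟨w, hw0, h.mul_mem_span hw0 e ((hW w).1 w.2).1 ((hW w).1 w.2).2⟩

theorem antipode_bijective [FiniteDimensional k B] (h : IsQHopf q a b c d) :
    Function.Bijective (antipode k (A := B)) := by
  apply antipode_bijective_of_adjoin h.gen
  rintro x (rfl | rfl | rfl | rfl)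
  · exact ⟨d, h.S_d⟩
  · refine ⟨-(q • x), ?_⟩
    rw [map_neg, map_smul, h.S_b, smul_neg, neg_neg, smul_smul, mul_inv_cancel₀ h.q0, one_smul]
  · refine ⟨-(q⁻¹ • x), ?_⟩
    rw [map_neg, map_smul, h.S_c, smul_neg, neg_neg, smul_smul, inv_mul_cancel₀ h.q0, one_smul]
  · exact ⟨a, h.S_a⟩

theorem finrank_dvd [IsAlgClosed k] [FiniteDimensional k B] (h : IsQHopf q a b c d)
    (hf : IsQIdem b c f) (hf0 : f ≠ 0) {H : Type*} [Ring H] [HopfAlgebra k H]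
    [FiniteDimensional k H] (ι : B →ₐc[k] H) (hι : Function.Injective ι) :
    Module.finrank k B ∣ Module.finrank k H := by
  obtain ⟨y, hy, hyx⟩ := h.exists_rank_one hf hf0
  exact finrank_dvd_of_mul_mem_span h.antipode_bijective ι hι hy hyx

end IsQHopf
end

end HopfClass

end

section

open TensorProduct

namespace HopfClass
open Coalgebra HopfAlgebra

section
variable {k : Type*} [Field k] {A : Type*} [Ring A] [Algebra k A] {b c f f' : A}

theorem pow_mul_eq_zero_of_le {x f : A} {m n : ℕ} (h : x ^ m * f = 0) (hmn : m ≤ n) :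
    x ^ n * f = 0 := by
  rw [← Nat.sub_add_cancel hmn, pow_add, mul_assoc, h, mul_zero]

theorem IsQIdem.mul_one_sub (h : IsQIdem b c f) (h' : IsQIdem b c f') : (1 - f') * f = 0 := by
  obtain ⟨m, hm⟩ := h.nilb
  obtain ⟨n, hn⟩ := h.nilc
  obtain ⟨u, v, e⟩ := h'.one_sub (max m n)
  rw [e, add_mul, mul_assoc, mul_assoc, pow_mul_eq_zero_of_le hm (le_max_left _ _),
    pow_mul_eq_zero_of_le hn (le_max_right _ _), mul_zero, mul_zero, add_zero]

theorem IsQIdem.unique (h : IsQIdem b c f) (h' : IsQIdem b c f') : f = f' := by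
  have e1 := h.mul_one_sub h'
  have e2 := h'.mul_one_sub h
  rw [sub_mul, one_mul, sub_eq_zero] at e1 e2
  exact e1.trans ((h.comm f').trans e2.symm)

theorem isTwoSided_span_pair {X : Set A} (hX : Algebra.adjoin k X = ⊤) {y z : A}
    (hy : ∀ g ∈ X, ∃ r : k, y * g = r • (g * y)) (hz : ∀ g ∈ X, ∃ r : k, z * g = r • (g * z)) :
    (Ideal.span {y, z}).IsTwoSided := by
  refine ⟨fun {w} x hw => mem_mul_of_adjoin_eq_top hX
    (W := (Ideal.span {y, z}).restrictScalars k) ?_ x w hw⟩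
  intro g hg w hw
  obtain ⟨u, v, rfl⟩ := Ideal.mem_span_pair.1 hw
  obtain ⟨r, hr⟩ := hy g hg
  obtain ⟨s, hs⟩ := hz g hg
  refine Ideal.mem_span_pair.2 ⟨r • (u * g), s • (v * g), ?_⟩
  rw [add_mul, mul_assoc u, mul_assoc v, hr, hs]
  simp only [smul_mul_assoc, mul_smul_comm, mul_assoc]

theorem IsQMat.normal_c {q : k} {a d : A} (h : IsQMat q a b c d) :
    ∀ g ∈ ({a, b, c, d} : Set A), ∃ r : k, c * g = r • (g * c) := by
  rintro g (rfl | rfl | rfl | rfl)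
  exacts [⟨_, h.ca⟩, ⟨1, by rw [one_smul, h.bc]⟩, ⟨1, by rw [one_smul]⟩, ⟨_, h.cd⟩]

theorem IsQMat.normal_b {q : k} {a d : A} (h : IsQMat q a b c d) :
    ∀ g ∈ ({a, b, c, d} : Set A), ∃ r : k, b * g = r • (g * b) := by
  rintro g (rfl | rfl | rfl | rfl)
  exacts [⟨_, h.ba⟩, ⟨1, by rw [one_smul]⟩, ⟨1, by rw [one_smul, h.bc]⟩, ⟨_, h.bd⟩]

theorem IsQMat.exists_unit {q : k} {a d : A} (h : IsQMat q a b c d) (hf : IsQIdem b c f) :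
    ∃ U : Aˣ, (U : A) = a * f + (1 - f) := by
  have ff := hf.idem
  have hz : f * (1 - f) = 0 := by rw [mul_sub, mul_one, ff, sub_self]
  have hz' : (1 - f) * f = 0 := by rw [sub_mul, one_mul, ff, sub_self]
  have hzz : (1 - f) * (1 - f) = 1 - f := IsIdempotentElem.one_sub ff
  have key : ∀ x y : A, (x * f + (1 - f)) * (y * f + (1 - f)) = x * y * f + (1 - f) := by
    intro x y
    have e1 : x * f * (y * f) = x * y * f := by
      rw [hf.comm y, mul_assoc, ← mul_assoc f, ff, ← hf.comm y, mul_assoc]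
    have e2 : x * f * (1 - f) = 0 := by rw [mul_assoc, hz, mul_zero]
    have e3 : (1 - f) * (y * f) = 0 := by rw [hf.comm, ← mul_assoc, hz', zero_mul]
    rw [add_mul, mul_add, mul_add, e1, e2, e3, hzz, add_zero, zero_add]
  obtain ⟨m, hm⟩ := hf.nilb
  have hnil : ∀ r : k, IsUnit (1 + r • (b * c) * f) := by
    intro r
    apply IsNilpotent.isUnit_one_add
    refine ⟨m + 1, ?_⟩
    rw [(show Commute (r • (b * c)) f from hf.comm _).mul_pow, smul_pow,
      (show Commute b c from h.bc).mul_pow, (show Commute b c from h.bc).pow_pow, smul_mul_assoc,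
      IsIdempotentElem.pow_succ_eq _ ff,
      mul_assoc, pow_mul_eq_zero_of_le hm (Nat.le_succ m), mul_zero, smul_zero]
  have e1 : (a * f + (1 - f)) * (d * f + (1 - f)) = 1 + q • (b * c) * f := by
    rw [key, h.ad, add_mul, one_mul]; abel
  have e2 : (d * f + (1 - f)) * (a * f + (1 - f)) = 1 + q⁻¹ • (b * c) * f := by
    rw [key, h.da, add_mul, one_mul]; abel
  obtain ⟨u, hu⟩ := hnil q
  obtain ⟨v, hv⟩ := hnil q⁻¹
  have r1 : (a * f + (1 - f)) * ((d * f + (1 - f)) * ↑u⁻¹) = 1 := by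
    rw [← mul_assoc, e1, ← hu, Units.mul_inv]
  have r2 : (↑v⁻¹ * (d * f + (1 - f))) * (a * f + (1 - f)) = 1 := by
    rw [mul_assoc, e2, ← hv, Units.inv_mul]
  have := left_inv_eq_right_inv r2 r1
  exact ⟨⟨_, _, r1, by rw [← this, r2]⟩, rfl⟩

end

section
variable {k : Type*} [Field k] {B : Type*} [Ring B] [HopfAlgebra k B] {q : k} {a b c d f : B}

namespace IsQHopf

theorem map_idem (h : IsQHopf q a b c d) (hf : IsQIdem b c f) (Θ : B →ₐ[k] B) {r s t u : k}
    (hr : r ≠ 0) (hs : s ≠ 0) (ht : t ≠ 0) (hu : u ≠ 0) (ha : Θ a = r • a) (hb : Θ b = s • b)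
    (hc : Θ c = t • c) (hd : Θ d = u • d) : Θ f = f := by
  have aux : ∀ {x : B} {r : k}, r ≠ 0 → Θ x = r • x → x = r⁻¹ • Θ x := by
    intro x r hr hx
    rw [hx, smul_smul, inv_mul_cancel₀ hr, one_smul]
  have aux2 : ∀ {x : B} {r : k}, r ≠ 0 → Θ x = r • x → x * Θ f = Θ f * x := by
    intro x r hr hx
    rw [aux hr hx, smul_mul_assoc, mul_smul_comm, ← map_mul, hf.comm, map_mul]
  have aux3 : ∀ {x : B} {r : k} {n : ℕ}, r ≠ 0 → Θ x = r • x → x ^ n * f = 0 →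
      x ^ n * Θ f = 0 := by
    intro x r n hr hx hxn
    rw [aux hr hx, smul_pow, smul_mul_assoc, ← map_pow, ← map_mul, hxn, map_zero, smul_zero]
  refine IsQIdem.unique (b := b) (c := c) ⟨?_, ?_, ?_, ?_, ?_⟩ hf
  · exact IsQMat.commute_of_gen h.gen (aux2 hr ha) (aux2 hs hb) (aux2 ht hc) (aux2 hu hd)
  · rw [← map_mul, hf.idem]
  · exact hf.nilb.imp fun n hn => aux3 hs hb hn
  · exact hf.nilc.imp fun n hn => aux3 ht hc hn
  · intro n
    obtain ⟨x, y, e⟩ := hf.one_sub n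
    refine ⟨s ^ n • Θ x, t ^ n • Θ y, ?_⟩
    rw [← map_one Θ, ← map_sub, e, map_add, map_mul, map_mul, map_pow, map_pow, hb, hc]
    simp only [smul_pow, mul_smul_comm, smul_mul_assoc]

theorem exists_theta (h : IsQHopf q a b c d) {α : WithConv (B →ₐ[k] k)}
    (ha : α.ofConv a = q) (hb : α.ofConv b = 0) (hc : α.ofConv c = 0) (hd : α.ofConv d = q⁻¹) :
    (∃ Θ : B →ₐ[k] B, Θ a = q ^ 2 • a ∧ Θ b = b ∧ Θ c = c ∧ Θ d = (q ^ 2)⁻¹ • d) ∧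
    (∃ Θ : B →ₐ[k] B, Θ a = a ∧ Θ b = q ^ 2 • b ∧ Θ c = (q ^ 2)⁻¹ • c ∧ Θ d = d) := by
  have q0 := h.q0
  have l1 : lact α a = q • a ∧ lact α b = q • b ∧ lact α c = q⁻¹ • c ∧ lact α d = q⁻¹ • d := by
    simp [lact_apply, h.comul_a, h.comul_b, h.comul_c, h.comul_d, ha, hb, hc, hd]
  have r1 : ract α a = q • a ∧ ract α b = q⁻¹ • b ∧ ract α c = q • c ∧ ract α d = q⁻¹ • d := by
    simp [ract_apply, h.comul_a, h.comul_b, h.comul_c, h.comul_d, ha, hb, hc, hd]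
  have r2 : ract (WithConv.toConv (charInv α.ofConv)) a = q⁻¹ • a ∧
      ract (WithConv.toConv (charInv α.ofConv)) b = q • b ∧
      ract (WithConv.toConv (charInv α.ofConv)) c = q⁻¹ • c ∧
      ract (WithConv.toConv (charInv α.ofConv)) d = q • d := by
    simp [ract_apply, h.comul_a, h.comul_b, h.comul_c, h.comul_d, ha, hb, hc, hd, charInv_apply,
      h.S_a, h.S_b, h.S_c, h.S_d]
  obtain ⟨la, lb, lc, ld⟩ := l1
  obtain ⟨ra, rb, rc, rd⟩ := r1
  obtain ⟨ra', rb', rc', rd'⟩ := r2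
  constructor
  · refine ⟨(lact α).comp (ract α), ?_, ?_, ?_, ?_⟩ <;>
    simp [la, lb, lc, ld, ra, rb, rc, rd, smul_smul, q0, pow_two]
  · refine ⟨(lact α).comp (ract (WithConv.toConv (charInv α.ofConv))), ?_, ?_, ?_, ?_⟩ <;>
    simp [la, lb, lc, ld, ra', rb', rc', rd', smul_smul, q0, pow_two]

theorem b_mul_ne_mul_c [IsAlgClosed k] [FiniteDimensional k B] (h : IsQHopf q a b c d)
    (hf : IsQIdem b c f) (hbf : b * f ≠ 0) (hq : q ^ 4 ≠ 1) (y : B) : b * f ≠ y * (c * f) := by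
  intro hy
  have q0 := h.q0
  obtain ⟨α, ha, hb, hc, hd⟩ := h.exists_char hf hbf
  obtain ⟨-, Θ, ta, tb, tc, td⟩ := h.exists_theta ha hb hc hd
  have tf : Θ f = f := h.map_idem hf Θ one_ne_zero (pow_ne_zero 2 q0)
    (inv_ne_zero (pow_ne_zero 2 q0)) one_ne_zero (by rw [ta, one_smul]) tb tc (by rw [td, one_smul])
  obtain ⟨U, hU⟩ := h.exists_unit hf
  obtain ⟨n, hn⟩ := hf.nilc
  -- the ideal generated by `b` and `c`
  have two : (Ideal.span {b, c}).IsTwoSided := isTwoSided_span_pair h.gen h.normal_b h.normal_c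
  have hI : ∀ z ∈ Ideal.span {b, c}, ∃ w, z * f = w * (c * f) := by
    intro z hz
    obtain ⟨u, v, rfl⟩ := Ideal.mem_span_pair.1 hz
    refine ⟨u * y + v, ?_⟩
    rw [add_mul, mul_assoc u, hy, add_mul, mul_assoc, mul_assoc]
  let π := Ideal.Quotient.mkₐ k (Ideal.span {b, c})
  have hπ : ∀ z, π z = 0 ↔ z ∈ Ideal.span {b, c} := fun z => Ideal.Quotient.eq_zero_iff_mem
  have pb : π b = 0 := (hπ _).2 (Ideal.subset_span (by simp))
  have pc : π c = 0 := (hπ _).2 (Ideal.subset_span (by simp))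
  have comm_a : ∀ x, ∃ w, a * x * f = x * a * f + w * (c * f) := by
    intro x
    have e : π a * π x = π x * π a := by
      have hx : x ∈ Algebra.adjoin k {a, b, c, d} := h.gen ▸ Algebra.mem_top
      induction hx using Algebra.adjoin_induction with
      | mem x hx =>
        rcases hx with rfl | rfl | rfl | rfl
        · rfl
        · rw [pb, mul_zero, zero_mul]
        · rw [pc, mul_zero, zero_mul]
        · rw [← map_mul, ← map_mul, h.ad, h.da]; simp [pb, pc]
      | algebraMap r => rw [AlgHom.commutes, Algebra.commutes]
      | add x y _ _ hx hy => rw [map_add, mul_add, add_mul, hx, hy]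
      | mul x y _ _ hx hy => rw [map_mul, ← mul_assoc, hx, mul_assoc, hy, mul_assoc]
    obtain ⟨w, hw⟩ := hI (a * x - x * a) ((hπ _).1 (by rw [map_sub, map_mul, map_mul, e, sub_self]))
    exact ⟨w, by rw [← hw, sub_mul]; abel⟩
  have theta_mem : ∀ x, ∃ w, Θ x * f = x * f + w * (c * f) := by
    intro x
    have e : π.comp Θ = π := by
      apply AlgHom.ext_of_adjoin_eq_top h.gen
      rintro x (rfl | rfl | rfl | rfl) <;> simp [ta, tb, tc, td, pb, pc]
    obtain ⟨w, hw⟩ := hI (Θ x - x) ((hπ _).1 (by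
      rw [map_sub, sub_eq_zero]; exact DFunLike.congr_fun e x))
    exact ⟨w, by rw [← hw, sub_mul]; abel⟩
  -- maximal power of `c` dividing `b` on the block of `f`
  obtain ⟨t, ⟨y, hy⟩, hmax⟩ : ∃ t, (∃ y, b * f = y * (c ^ (t + 1) * f)) ∧
      ∀ y, b * f ≠ y * (c ^ (t + 1 + 1) * f) := by
    by_contra! hcon
    have : ∀ t, ∃ y, b * f = y * (c ^ (t + 1) * f) := by
      intro t
      induction t with
      | zero => exact ⟨y, by rw [zero_add, pow_one, hy]⟩
      | succ t ih => exact hcon t ih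
    obtain ⟨y, e⟩ := this n
    rw [pow_mul_eq_zero_of_le hn (Nat.le_succ n), mul_zero] at e
    exact hbf e
  have cf : ∀ w m, w * (c * f) * c ^ m = w * (c ^ (m + 1) * f) := by
    intro w m
    rw [mul_assoc, mul_assoc, ← hf.comm, ← mul_assoc c, pow_succ']
  have cancel : ∀ (r : k) (w : B), r • (b * f) = w * (c ^ (t + 1 + 1) * f) → r = 0 := by
    intro r w hw
    by_contra hr
    apply hmax (r⁻¹ • w)
    rw [smul_mul_assoc, ← hw, smul_smul, inv_mul_cancel₀ hr, one_smul]
  have e1 : q = q ^ (t + 1) := by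
    obtain ⟨w, hw⟩ := comm_a y
    have s1 : a * (b * f) = q • (b * f * a) := by
      rw [← mul_assoc, h.ab, smul_mul_assoc, mul_assoc, hf.comm, mul_assoc]
    have s2 : a * (b * f) = q ^ (t + 1) • (b * f * a) + w * (c ^ (t + 1 + 1) * f) := by
      calc a * (b * f) = a * y * f * c ^ (t + 1) := by
            rw [hy, hf.comm (c ^ (t + 1)), mul_assoc, mul_assoc]
        _ = y * (a * c ^ (t + 1)) * f + w * (c ^ (t + 1 + 1) * f) := by
            rw [hw, add_mul, cf, mul_assoc, ← hf.comm]; simp only [mul_assoc]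
        _ = _ := by
            rw [q_comm_pow_right h.ac, hy]
            simp only [mul_smul_comm, smul_mul_assoc, mul_assoc, hf.comm a]
    have s3 : U⁻¹ * (b * f * a) = q⁻¹ • (b * f) := by
      have : b * f * a = q⁻¹ • (U * (b * f)) := by
        have h1 : (U : B) * (b * f) = a * (b * f) := by
          rw [hU, add_mul, hf.comm b, ← mul_assoc, mul_assoc a, hf.idem, ← mul_assoc (1 - f),
            sub_mul, one_mul, hf.idem, sub_self, zero_mul, add_zero, mul_assoc]
        rw [h1, s1, smul_smul, inv_mul_cancel₀ q0, one_smul]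
      rw [this, mul_smul_comm, ← mul_assoc, Units.inv_mul, one_mul]
    have s4 : (q - q ^ (t + 1)) • (b * f * a) = w * (c ^ (t + 1 + 1) * f) := by
      rw [sub_smul, ← s1, s2]; abel
    have s5 := congrArg (fun z => (↑U⁻¹ : B) * z) s4
    simp only [mul_smul_comm, s3, smul_smul] at s5
    rw [← mul_assoc] at s5
    have := cancel _ _ s5
    rcases mul_eq_zero.1 this with h' | h'
    · exact sub_eq_zero.1 h'
    · exact absurd h' (inv_ne_zero q0)
  obtain ⟨w, hw⟩ := theta_mem y
  have s1 : q ^ 2 • (b * f) = ((q ^ 2)⁻¹) ^ (t + 1) • (b * f + w * (c ^ (t + 1 + 1) * f)) := by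
    calc q ^ 2 • (b * f) = Θ (b * f) := by rw [map_mul, tb, tf, smul_mul_assoc]
      _ = ((q ^ 2)⁻¹) ^ (t + 1) • (Θ y * f * c ^ (t + 1)) := by
          rw [hy, map_mul, map_mul, map_pow, tc, tf, smul_pow, smul_mul_assoc, mul_smul_comm,
            hf.comm (c ^ (t + 1)), mul_assoc]
      _ = _ := by
          rw [hw, add_mul, cf, mul_assoc, ← hf.comm, ← hy]
  have s2 : (q ^ 2 - ((q ^ 2)⁻¹) ^ (t + 1)) • (b * f) =
      (((q ^ 2)⁻¹) ^ (t + 1) • w) * (c ^ (t + 1 + 1) * f) := by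
    rw [sub_smul, s1, smul_add, smul_mul_assoc]; abel
  have s3 := cancel _ _ s2
  rw [inv_pow, ← pow_mul, mul_comm 2, pow_mul, ← e1, sub_eq_zero] at s3
  apply hq
  have : q ^ 2 * q ^ 2 = 1 := by
    nth_rw 1 [s3]
    exact inv_mul_cancel₀ (pow_ne_zero 2 q0)
  rw [← this]; ring

end IsQHopf
end

end HopfClass

end

section

open TensorProduct

namespace HopfClass
open Coalgebra HopfAlgebra

theorem eq_zero_of_joint_eigenvectors {k : Type*} [Field k] {V I S : Type*} [AddCommGroup V]
    [Module k V] {v : I → V} (hv : ∀ i, v i ≠ 0)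
    {T : S → Module.End k V} {μ : S → I → k} (hT : ∀ s i, T s (v i) = μ s i • v i)
    (hμ : ∀ i j, i ≠ j → ∃ s, μ s i ≠ μ s j) (n : ℕ) :
    ∀ (F : Finset I), F.card = n → ∀ (r : I → k), ∑ i ∈ F, r i • v i = 0 → ∀ i ∈ F, r i = 0 := by
  classical
  induction n with
  | zero =>
    intro F hF r _ i hi
    rw [Finset.card_eq_zero.1 hF] at hi
    simp at hi
  | succ n ih =>
    intro F hF r hr i hi
    by_cases hone : ∃ j ∈ F, j ≠ i
    · obtain ⟨j, hj, hji⟩ := hone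
      obtain ⟨s, hs⟩ := hμ i j hji.symm
      have e : ∑ l ∈ F.erase j, ((μ s l - μ s j) * r l) • v l = 0 := by
        have e1 := congrArg (T s - μ s j • (1 : Module.End k V)) hr
        rw [map_sum, map_zero, ← Finset.add_sum_erase _ _ hj] at e1
        simp only [map_smul, LinearMap.sub_apply, LinearMap.smul_apply, Module.End.one_apply, hT,
          sub_self, smul_zero, zero_add, ← sub_smul, smul_smul] at e1
        rw [← e1]
        exact Finset.sum_congr rfl fun l _ => by rw [mul_comm]
      have := ih (F.erase j) (by rw [Finset.card_erase_of_mem hj, hF]; rfl) _ e i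
        (Finset.mem_erase.2 ⟨hji.symm, hi⟩)
      exact (mul_eq_zero.1 this).resolve_left (sub_ne_zero.2 hs)
    · push Not at hone
      have : F = {i} := Finset.eq_singleton_iff_unique_mem.2 ⟨hi, hone⟩
      rw [this, Finset.sum_singleton] at hr
      exact (smul_eq_zero.1 hr).resolve_right (hv i)

theorem linearIndependent_of_joint_eigenvectors {k : Type*} [Field k] {V I S : Type*}
    [AddCommGroup V] [Module k V] {v : I → V} (hv : ∀ i, v i ≠ 0)
    {T : S → Module.End k V} {μ : S → I → k} (hT : ∀ s i, T s (v i) = μ s i • v i)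
    (hμ : ∀ i j, i ≠ j → ∃ s, μ s i ≠ μ s j) : LinearIndependent k v := by
  rw [linearIndependent_iff']
  intro F r hr
  exact eq_zero_of_joint_eigenvectors hv hT hμ _ F rfl r hr

section
universe u
variable {k : Type*} [Field k] {B : Type u} [Ring B] [HopfAlgebra k B] {q : k} {a b c d f : B}

namespace IsQHopf

theorem isUnit_map {A : Type*} [Ring A] [Algebra k A] (h : IsQHopf q a b c d) (φ : B →ₐ[k] A)
    (hbc : φ (b * c) = 0) : IsUnit (φ a) ∧ IsUnit (φ d) := by
  have e1 : φ a * φ d = 1 := by rw [← map_mul, h.ad, map_add, map_smul, hbc]; simp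
  have e2 : φ d * φ a = 1 := by rw [← map_mul, h.da, map_add, map_smul, hbc]; simp
  exact ⟨⟨⟨_, _, e1, e2⟩, rfl⟩, ⟨⟨_, _, e2, e1⟩, rfl⟩⟩

theorem exists_hom_ne_zero [IsAlgClosed k] [FiniteDimensional k B] (h : IsQHopf q a b c d)
    (hf : IsQIdem b c f) (hbf : b * f ≠ 0) (hq : q ^ 4 ≠ 1) :
    ∃ (A : Type u) (_ : Ring A) (_ : Algebra k A) (φ : B →ₐ[k] A),
      φ c = 0 ∧ IsNilpotent (φ b) ∧ φ b ≠ 0 := by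
  have two : (Ideal.span {c * f, 1 - f}).IsTwoSided := by
    refine isTwoSided_span_pair h.gen ?_ ?_
    · intro g hg
      obtain ⟨r, hr⟩ := h.normal_c g hg
      refine ⟨r, ?_⟩
      rw [mul_assoc, ← hf.comm, ← mul_assoc, hr, smul_mul_assoc, mul_assoc]
    · intro g hg
      exact ⟨1, by rw [one_smul, sub_mul, mul_sub, hf.comm, one_mul, mul_one]⟩
  let π := Ideal.Quotient.mkₐ k (Ideal.span {c * f, 1 - f})
  have hπ : ∀ z, π z = 0 ↔ z ∈ Ideal.span {c * f, 1 - f} :=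
    fun z => Ideal.Quotient.eq_zero_iff_mem
  have p1 : π (c * f) = 0 := (hπ _).2 (Ideal.subset_span (by simp))
  have p2 : π f = 1 := by
    have : π (1 - f) = 0 := (hπ _).2 (Ideal.subset_span (by simp))
    rw [map_sub, map_one, sub_eq_zero] at this
    exact this.symm
  refine ⟨_, _, _, π, ?_, ?_, ?_⟩
  · rw [map_mul, p2, mul_one] at p1; exact p1
  · obtain ⟨n, hn⟩ := hf.nilb
    exact ⟨n, by rw [← map_pow, ← mul_one (π _), ← p2, ← map_mul, hn, map_zero]⟩
  · intro e
    obtain ⟨u, v, e⟩ := Ideal.mem_span_pair.1 ((hπ _).1 e)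
    apply h.b_mul_ne_mul_c hf hbf hq u
    rw [← e, add_mul, mul_assoc v, sub_mul, one_mul, hf.idem, sub_self, mul_zero, add_zero,
      mul_assoc, mul_assoc, hf.idem]

theorem exists_hom_pow_ne_zero [IsAlgClosed k] [FiniteDimensional k B] (h : IsQHopf q a b c d)
    (hf : IsQIdem b c f) (hbf : b * f ≠ 0) (hq : q ^ 4 ≠ 1) {M : ℕ}
    (hM : ∀ n, 0 < n → n < M → (q ^ 2) ^ n ≠ 1) (i : ℕ) (hi : i < M) :
    ∃ (A : Type u) (_ : Ring A) (_ : Algebra k A) (φ : B →ₐ[k] A),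
      φ c = 0 ∧ IsNilpotent (φ b) ∧ φ b ^ i ≠ 0 := by
  induction i with
  | zero =>
    obtain ⟨A, _, _, φ, h1, h2, h3⟩ := h.exists_hom_ne_zero hf hbf hq
    have : Nontrivial A := ⟨_, _, h3⟩
    exact ⟨A, _, _, φ, h1, h2, by rw [pow_zero]; exact one_ne_zero⟩
  | succ j ih =>
    rcases Nat.eq_zero_or_pos j with rfl | hj
    · obtain ⟨A, _, _, φ, h1, h2, h3⟩ := h.exists_hom_ne_zero hf hbf hq
      exact ⟨A, _, _, φ, h1, h2, by simpa using h3⟩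
    obtain ⟨A, _, _, φ, h1, h2, h3⟩ := ih (by omega)
    by_cases h4 : φ b ^ (j + 1) = 0
    · obtain ⟨m, rfl⟩ : ∃ m, j = m + 1 := Nat.exists_eq_succ_of_ne_zero hj.ne'
      obtain ⟨ua, ud⟩ := h.isUnit_map φ (by rw [map_mul, h1, mul_zero])
      have hφ := h.toIsQMat.map φ
      have eb : ((Algebra.TensorProduct.map φ φ).comp (Bialgebra.comulAlgHom k B)) b =
          φ a ⊗ₜ φ b + φ b ⊗ₜ φ d := by
        simp [h.comul_b]
      refine ⟨A ⊗[k] A, _, _,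
        (Algebra.TensorProduct.map φ φ).comp (Bialgebra.comulAlgHom k B), ?_, ?_, ?_⟩
      · simp [h.comul_c, h1]
      · rw [eb]
        apply isNilpotent_add_of_q_comm (κ := (q ^ 2)⁻¹)
        · have q0 := h.q0
          simp only [Algebra.TensorProduct.tmul_mul_tmul, hφ.ba, hφ.db, TensorProduct.smul_tmul',
            TensorProduct.tmul_smul, smul_smul]
          congr 1
          field_simp
        · obtain ⟨n, hn⟩ := h2
          exact ⟨n, by rw [Algebra.TensorProduct.tmul_pow, hn, tmul_zero]⟩
        · obtain ⟨n, hn⟩ := h2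
          exact ⟨n, by rw [Algebra.TensorProduct.tmul_pow, hn, zero_tmul]⟩
      · rw [eb]
        apply pow_ne_zero_of_q_comm h.q0 hφ.ab hφ.db ua ud m h4 h3
        have h5 : (q ^ 2)⁻¹ ≠ 1 := by
          rw [Ne, inv_eq_one]
          intro e
          exact hM 1 one_pos (by omega) (by rw [e, one_pow])
        rw [geom_sum_eq h5]
        apply div_ne_zero _ (sub_ne_zero.2 h5)
        rw [sub_ne_zero, inv_pow, Ne, inv_eq_one]
        exact hM _ (by omega) (by omega)
    · exact ⟨A, _, _, φ, h1, h2, h4⟩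

theorem pow_mul_pow_ne_zero [IsAlgClosed k] [FiniteDimensional k B] (h : IsQHopf q a b c d)
    (hf : IsQIdem b c f) (hbf : b * f ≠ 0) (hcf : c * f ≠ 0) (hq : q ^ 4 ≠ 1) {M : ℕ}
    (hM : ∀ n, 0 < n → n < M → (q ^ 2) ^ n ≠ 1) {i j : ℕ} (hi : i < M) (hj : j < M) :
    b ^ i * c ^ j * f ≠ 0 := by
  obtain ⟨A, _, _, φ, h1, h2, h3⟩ := h.exists_hom_pow_ne_zero hf hbf hq hM i hi
  obtain ⟨A', _, _, ψ, h1', h2', h3'⟩ := h.symm.exists_hom_pow_ne_zero hf.symm hcf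
    (by rw [inv_pow, Ne, inv_eq_one]; exact hq) (M := M)
    (fun n hn hn' => by
      rw [inv_pow, inv_pow, Ne, inv_eq_one]
      exact hM n hn hn') j hj
  obtain ⟨ua, ud⟩ := h.isUnit_map φ (by rw [map_mul, h1, mul_zero])
  obtain ⟨ua', ud'⟩ := h.isUnit_map ψ (by rw [map_mul, h1', zero_mul])
  set Ψ := (Algebra.TensorProduct.map φ ψ).comp (Bialgebra.comulAlgHom k B)
  have eb : Ψ b = φ b ⊗ₜ ψ d := by simp [Ψ, h.comul_b, h1']
  have ec : Ψ c = φ d ⊗ₜ ψ c := by simp [Ψ, h.comul_c, h1]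
  obtain ⟨m, hm⟩ := h2
  obtain ⟨n, hn⟩ := h2'
  have ef : Ψ f = 1 := by
    obtain ⟨u, v, e⟩ := hf.one_sub (max m n)
    have := congrArg Ψ e
    rw [map_sub, map_one, map_add, map_mul, map_mul, map_pow, map_pow, eb, ec,
      Algebra.TensorProduct.tmul_pow, Algebra.TensorProduct.tmul_pow,
      pow_eq_zero_of_le (le_max_left _ _) hm, pow_eq_zero_of_le (le_max_right _ _) hn,
      zero_tmul, tmul_zero, mul_zero, mul_zero, add_zero, sub_eq_zero] at this
    exact this.symm
  intro e
  have e2 := congrArg Ψ e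
  rw [map_mul, map_mul, map_pow, map_pow, eb, ec, ef, mul_one, map_zero,
    Algebra.TensorProduct.tmul_pow, Algebra.TensorProduct.tmul_pow,
    Algebra.TensorProduct.tmul_mul_tmul] at e2
  refine tmul_ne_zero ?_ ?_ e2
  · exact fun e3 => h3 (by simpa using ((ud.pow j).mul_left_eq_zero).1 e3)
  · exact fun e3 => h3' (by simpa using ((ud'.pow i).mul_right_eq_zero).1 e3)

theorem eq_of_pow_two_mul_eq {M : ℕ} (hq : ∀ n, 0 < n → n < M → (q ^ 2) ^ n ≠ 1) (q0 : q ≠ 0)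
    {x y : ℕ} (hx : x < M) (hy : y < M) (e : (q ^ 2) ^ x = (q ^ 2) ^ y) : x = y := by
  by_contra hxy
  wlog hlt : x < y generalizing x y
  · exact this hy hx e.symm (Ne.symm hxy) (by omega)
  apply hq (y - x) (by omega) (by omega)
  apply mul_left_cancel₀ (pow_ne_zero x (pow_ne_zero 2 q0))
  rw [← pow_add, Nat.add_sub_cancel' hlt.le, mul_one, e]

theorem cube_le_finrank [IsAlgClosed k] [FiniteDimensional k B] (h : IsQHopf q a b c d)
    (hf : IsQIdem b c f) (hbf : b * f ≠ 0) (hcf : c * f ≠ 0) {M : ℕ} (hq : q ^ 4 ≠ 1)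
    (hM : ∀ n, 0 < n → n < M → (q ^ 2) ^ n ≠ 1) (hM' : ∀ n, 0 < n → n < M → (q ^ 4) ^ n ≠ 1) :
    M ^ 3 ≤ Module.finrank k B ∧ (Module.finrank k B ≤ M ^ 3 → f = 1) := by
  have q0 := h.q0
  obtain ⟨α, ha, hb, hc, hd⟩ := h.exists_char hf hbf
  obtain ⟨⟨Θ₁, ta, tb, tc, td⟩, Θ₂, ta', tb', tc', td'⟩ := h.exists_theta ha hb hc hd
  have q20 := pow_ne_zero 2 q0
  have tf : Θ₁ f = f := h.map_idem hf Θ₁ q20 one_ne_zero one_ne_zero (inv_ne_zero q20)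
    ta (by rw [tb, one_smul]) (by rw [tc, one_smul]) td
  have tf' : Θ₂ f = f := h.map_idem hf Θ₂ one_ne_zero q20
    (inv_ne_zero q20) one_ne_zero (by rw [ta', one_smul]) tb' tc' (by rw [td', one_smul])
  obtain ⟨U, hU⟩ := h.exists_unit hf
  have hUf : ∀ x, (U : B) * (x * f) = a * x * f := by
    intro x
    rw [hU, add_mul, hf.comm x, ← mul_assoc, mul_assoc a, hf.idem, ← mul_assoc (1 - f),
      sub_mul, one_mul, hf.idem, sub_self, zero_mul, add_zero, mul_assoc, ← hf.comm, mul_assoc]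
  have hUf' : ∀ x, x * f * (U : B) = x * a * f := by
    intro x
    rw [hU, mul_add, mul_sub, mul_one, mul_assoc x f f, hf.idem, sub_self, add_zero, mul_assoc x f,
      ← mul_assoc f, ← hf.comm a, mul_assoc a, hf.idem, mul_assoc]
  let v : Fin M × Fin M × Fin M → B := fun x =>
    a ^ (x.1 : ℕ) * (b ^ (x.2.1 : ℕ) * c ^ (x.2.2 : ℕ)) * f
  have hv : ∀ x, v x ≠ 0 := by
    intro x
    have : v x = (U : B) ^ (x.1 : ℕ) * (b ^ (x.2.1 : ℕ) * c ^ (x.2.2 : ℕ) * f) := by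
      generalize hn : (x.1 : ℕ) = n
      simp only [v, hn]
      clear hn
      induction n with
      | zero => simp
      | succ n ih => 
        rw [pow_succ', pow_succ' (U : B), mul_assoc (U : B), ← ih, hUf]
        simp only [mul_assoc]
    rw [this]
    intro e
    exact h.pow_mul_pow_ne_zero hf hbf hcf hq hM x.2.1.2 x.2.2.2
      (((U.isUnit.pow _).mul_right_eq_zero).1 e)
  let T : Fin 3 → Module.End k B := ![Θ₁.toLinearMap, Θ₂.toLinearMap,
    LinearMap.mulLeft k (U : B) ∘ₗ LinearMap.mulRight k (↑U⁻¹ : B)]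
  let μ : Fin 3 → Fin M × Fin M × Fin M → k := ![fun x => (q ^ 2) ^ (x.1 : ℕ),
    fun x => (q ^ 2) ^ (x.2.1 : ℕ) * ((q ^ 2)⁻¹) ^ (x.2.2 : ℕ),
    fun x => q ^ (x.2.1 : ℕ) * q ^ (x.2.2 : ℕ)]
  have hT : ∀ s x, T s (v x) = μ s x • v x := by
    intro s x
    fin_cases s
    · simp [T, μ, v, ta, tb, tc, tf, smul_pow]
    · simp [T, μ, v, ta', tb', tc', tf', smul_pow, smul_smul, mul_comm]
    · have e : (U : B) * v x = (q ^ (x.2.1 : ℕ) * q ^ (x.2.2 : ℕ)) • (v x * U) := by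
        simp only [v]
        rw [hUf, hUf', ← mul_assoc, ← pow_succ', pow_succ, mul_assoc (a ^ _) a, ← mul_assoc a,
          q_comm_pow_right h.ab, smul_mul_assoc, mul_assoc (b ^ _) a, q_comm_pow_right h.ac]
        simp only [smul_mul_assoc, mul_smul_comm, smul_smul, mul_assoc]
      change (U : B) * (v x * ↑U⁻¹) = (q ^ (x.2.1 : ℕ) * q ^ (x.2.2 : ℕ)) • v x
      rw [← mul_assoc, e, smul_mul_assoc, mul_assoc, Units.mul_inv, mul_one]
  have hμ : ∀ x y, x ≠ y → ∃ s, μ s x ≠ μ s y := by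
    intro x y hxy
    by_contra! hcon
    have e0 : (q ^ 2) ^ (x.1 : ℕ) = (q ^ 2) ^ (y.1 : ℕ) := hcon 0
    have e1 : (q ^ 2) ^ (x.2.1 : ℕ) * ((q ^ 2)⁻¹) ^ (x.2.2 : ℕ) =
      (q ^ 2) ^ (y.2.1 : ℕ) * ((q ^ 2)⁻¹) ^ (y.2.2 : ℕ) := hcon 1
    have e2 : q ^ (x.2.1 : ℕ) * q ^ (x.2.2 : ℕ) = q ^ (y.2.1 : ℕ) * q ^ (y.2.2 : ℕ) := hcon 2
    apply hxy
    obtain ⟨x1, x2, x3⟩ := x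
    obtain ⟨y1, y2, y3⟩ := y
    simp only at e0 e1 e2
    have q40 := pow_ne_zero 4 q0
    have f0 := eq_of_pow_two_mul_eq hM q0 x1.2 y1.2 e0
    have e3 : (q ^ 4) ^ (x2 : ℕ) = (q ^ 4) ^ (y2 : ℕ) := by
      have hz : ∀ i j : ℕ, (q ^ 4) ^ i =
          (q ^ 2) ^ i * ((q ^ 2)⁻¹) ^ j * (q ^ i * q ^ j) ^ 2 := by
        intro i j
        rw [inv_pow]
        field_simp
        ring
      rw [hz _ x3, hz _ y3, e1, e2]
    have e4 : (q ^ 4) ^ (x3 : ℕ) = (q ^ 4) ^ (y3 : ℕ) := by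
      have hz : ∀ i j : ℕ, (q ^ 4) ^ j =
          ((q ^ 2) ^ i * ((q ^ 2)⁻¹) ^ j)⁻¹ * (q ^ i * q ^ j) ^ 2 := by
        intro i j
        rw [inv_pow]
        field_simp
        ring
      rw [hz x2, hz y2, e1, e2]
    have hM'' : ∀ n, 0 < n → n < M → ((q ^ 2) ^ 2) ^ n ≠ 1 := by
      intro n hn hn'
      have := hM' n hn hn'
      rwa [← pow_mul q 2 2]
    rw [show q ^ 4 = (q ^ 2) ^ 2 by ring] at e3 e4
    have f1 := eq_of_pow_two_mul_eq hM'' q20 x2.2 y2.2 e3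
    have f2 := eq_of_pow_two_mul_eq hM'' q20 x3.2 y3.2 e4
    rw [Fin.ext f0, Fin.ext f1, Fin.ext f2]
  have hli := linearIndependent_of_joint_eigenvectors hv hT hμ
  have hcard : Fintype.card (Fin M × Fin M × Fin M) = M ^ 3 := by
    simp only [Fintype.card_prod, Fintype.card_fin]; ring
  have hle := hli.fintype_card_le_finrank
  rw [hcard] at hle
  refine ⟨hle, fun hle' => ?_⟩
  have hspan := hli.span_eq_top_of_card_eq_finrank' (by rw [hcard]; exact le_antisymm hle hle')
  have : ∀ x ∈ Submodule.span k (Set.range v), x * f = x := by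
    intro x hx
    induction hx using Submodule.span_induction with
    | mem x hx => obtain ⟨y, rfl⟩ := hx; simp only [v]; rw [mul_assoc, hf.idem]
    | zero => rw [zero_mul]
    | add x y _ _ hx hy => rw [add_mul, hx, hy]
    | smul r x _ hx => rw [smul_mul_assoc, hx]
  simpa using this 1 (hspan ▸ Submodule.mem_top)

theorem bijective_of_injective [IsAlgClosed k] [CharZero k] [FiniteDimensional k B]
    (h : IsQHopf q a b c d) (hb : b ≠ 0) (hc : c ≠ 0) (hq : q ^ 2 ≠ 1) {H : Type*} [Ring H]
    [HopfAlgebra k H] [FiniteDimensional k H] (ι : B →ₐc[k] H) (hι : Function.Injective ι) {p : ℕ}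
    (hp : p.Prime) (hodd : Odd p) (hdim : Module.finrank k H = p ^ 3) :
    Function.Surjective ι ∧ IsNilpotent b ∧ IsNilpotent c := by
  have q0 := h.q0
  obtain ⟨f, hf⟩ := h.toIsQMat.exists_isQIdem h.gen
  have hbf := h.b_mul_ne_zero hq hf hb
  have hcf := h.c_mul_ne_zero hq hf hc
  have hdvd := h.finrank_dvd hf (right_ne_zero_of_mul hbf) ι hι
  rw [hdim] at hdvd
  obtain ⟨M0, Modd, hpM⟩ := h.order_eq hf hbf hp hodd hdvd (by rintro rfl; exact hq (one_pow 2))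
  have cop2 : Nat.Coprime (orderOf q) 2 := Nat.Coprime.symm (Nat.coprime_two_left.2 Modd)
  have hM : ∀ n, 0 < n → n < orderOf q → (q ^ 2) ^ n ≠ 1 := by
    intro n hn hn' e
    rw [← pow_mul] at e
    have := Nat.le_of_dvd hn (cop2.dvd_of_dvd_mul_left (orderOf_dvd_of_pow_eq_one e))
    omega
  have hM' : ∀ n, 0 < n → n < orderOf q → (q ^ 4) ^ n ≠ 1 := by
    intro n hn hn' e
    rw [← pow_mul, show 4 * n = 2 * (2 * n) by ring] at e
    have := Nat.le_of_dvd hn (cop2.dvd_of_dvd_mul_left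
      (cop2.dvd_of_dvd_mul_left (orderOf_dvd_of_pow_eq_one e)))
    omega
  have := hp.two_le
  have hq4 : q ^ 4 ≠ 1 := by simpa using hM' 1 one_pos (by omega)
  obtain ⟨h1, h2⟩ := h.cube_le_finrank hf hbf hcf hq4 hM hM'
  have hle : Module.finrank k B ≤ p ^ 3 := by
    rw [← hdim]
    exact LinearMap.finrank_le_finrank_of_injective (f := (ι : B →ₗ[k] H)) hι
  have hpM3 : p ^ 3 ≤ (orderOf q) ^ 3 := Nat.pow_le_pow_left hpM 3
  have hf1 := h2 (hle.trans hpM3)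
  refine ⟨?_, ?_, ?_⟩
  · exact (LinearMap.injective_iff_surjective_of_finrank_eq_finrank (f := (ι : B →ₗ[k] H))
      (by rw [hdim]; omega)).1 hι
  · obtain ⟨n, hn⟩ := hf.nilb
    exact ⟨n, by rw [← hn, hf1, mul_one]⟩
  · obtain ⟨n, hn⟩ := hf.nilc
    exact ⟨n, by rw [← hn, hf1, mul_one]⟩

end IsQHopf
end

end HopfClass

end

section

open TensorProduct

namespace HopfClass
open Coalgebra HopfAlgebra

section
variable {k : Type*} [Field k] {A : Type*} [Ring A] [Algebra k A] [FiniteDimensional k A]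

theorem exists_pow_apply_ne_zero {V : Type*} [AddCommGroup V] [Module k V] {T : Module.End k V}
    {v : V} (hv : v ≠ 0) {n : ℕ} (hn : (T ^ n) v = 0) :
    ∃ m, (T ^ m) v ≠ 0 ∧ T ((T ^ m) v) = 0 := by
  induction n with
  | zero => exact absurd hn hv
  | succ n ih =>
    by_cases h : (T ^ n) v = 0
    · exact ih h
    · exact ⟨n, h, by rw [pow_succ'] at hn; exact hn⟩

theorem dualDistrib_dualComul (f : Module.Dual k A) (x y : A) :
    TensorProduct.dualDistrib k A A (dualComul k A f) (x ⊗ₜ y) = f (x * y) := by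
  have : TensorProduct.dualDistrib k A A (dualComul k A f) = (LinearMap.mul' k A).dualMap f :=
    (TensorProduct.dualDistribEquiv k A A).apply_symm_apply _
  rw [this]
  rfl

theorem dualComul_eq_iff (f : Module.Dual k A) (t : Module.Dual k A ⊗[k] Module.Dual k A)
    (h : ∀ x y, TensorProduct.dualDistrib k A A t (x ⊗ₜ y) = f (x * y)) : dualComul k A f = t := by
  apply (TensorProduct.dualDistribEquiv k A A).injective
  change TensorProduct.dualDistrib k A A _ = TensorProduct.dualDistrib k A A _
  ext x y
  simp [h, dualDistrib_dualComul]

theorem dualMap_mulRight_mem {C : Submodule k (Module.Dual k A)}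
    (hC : IsSubcoalgWrt k (dualComul k A) C) {f : Module.Dual k A} (hf : f ∈ C) (x : A) :
    (LinearMap.mulRight k x).dualMap f ∈ C := by
  obtain ⟨t, ht⟩ := hC f hf
  have key : ∀ t : C ⊗[k] C, ∃ g ∈ C, ∀ y, TensorProduct.dualDistrib k A A
      (TensorProduct.map C.subtype C.subtype t) (y ⊗ₜ x) = g y := by
    intro t
    induction t with
    | zero => exact ⟨0, C.zero_mem, fun y => by simp⟩
    | tmul g h => exact ⟨(h : Module.Dual k A) x • g, C.smul_mem _ g.2, fun y => by
        simp [TensorProduct.dualDistrib_apply, mul_comm]⟩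
    | add s t hs ht =>
      obtain ⟨g, hg, hg'⟩ := hs
      obtain ⟨g', hgg, hgg'⟩ := ht
      exact ⟨g + g', C.add_mem hg hgg, fun y => by simp [hg', hgg']⟩
  obtain ⟨g, hg, hg'⟩ := key t
  convert hg
  ext y
  rw [← hg', ht, dualDistrib_dualComul]
  rfl

theorem finrank_eq_one_of_mul {C : Submodule k (Module.Dual k A)}
    (hC : IsSimpleSubcoalgWrt k (dualComul k A) C) {f : Module.Dual k A} (hf : f ∈ C) (hf0 : f ≠ 0)
    (h : ∀ y, ∃ r : k, ∀ x, f (x * y) = r * f x) : Module.finrank k C = 1 := by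
  have h1 : f 1 ≠ 0 := by
    intro h1
    apply hf0
    ext y
    obtain ⟨r, hr⟩ := h y
    have := hr 1
    rw [one_mul, h1, mul_zero] at this
    exact this
  have hD : IsSubcoalgWrt k (dualComul k A) (Submodule.span k {f}) := by
    intro g hg
    obtain ⟨s, rfl⟩ := Submodule.mem_span_singleton.1 hg
    refine ⟨(s * (f 1)⁻¹) • ((⟨f, Submodule.mem_span_singleton_self f⟩ : Submodule.span k {f}) ⊗ₜ
      (⟨f, Submodule.mem_span_singleton_self f⟩ : Submodule.span k {f})), ?_⟩
    symm
    apply dualComul_eq_iff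
    intro x y
    obtain ⟨r, hr⟩ := h y
    have e := hr 1
    rw [one_mul] at e
    simp only [map_smul, TensorProduct.map_tmul, Submodule.subtype_apply, LinearMap.smul_apply,
      TensorProduct.dualDistrib_apply, smul_eq_mul, hr, e]
    field_simp
  have hle : Submodule.span k {f} ≤ C := by
    rw [Submodule.span_singleton_le_iff_mem]; exact hf
  rcases hle.lt_or_eq with hlt | heq
  · have := hC.2.2 _ hD hlt
    rw [Submodule.span_singleton_eq_bot] at this
    exact absurd this hf0
  · rw [← heq, finrank_span_singleton hf0]

theorem IsQMat.isCopointed [IsAlgClosed k] {q : k} {a b c d : A} (h : IsQMat q a b c d)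
    (hgen : Algebra.adjoin k {a, b, c, d} = ⊤) (hb : IsNilpotent b) (hc : IsNilpotent c) :
    IsCopointed k A := by
  intro C hC
  have q0 := h.q0
  have hstab := fun (f : Module.Dual k A) (hf : f ∈ C) (x : A) =>
    dualMap_mulRight_mem hC.1 hf x
  let R : A → Module.End k (Module.Dual k A) := fun x => (LinearMap.mulRight k x).dualMap
  have hR : ∀ x f y, R x f y = f (y * x) := fun _ _ _ => rfl
  have hRpow : ∀ x n f y, (R x ^ n) f y = f (y * x ^ n) := by
    intro x n
    induction n with
    | zero => intro f y; simp
    | succ n ih =>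
      intro f y
      rw [pow_succ, Module.End.mul_apply, ih, hR, mul_assoc, ← pow_succ]
  have hRC : ∀ x n, ∀ f ∈ C, (R x ^ n) f ∈ C := by
    intro x n
    induction n with
    | zero => intro f hf; exact hf
    | succ n ih => intro f hf; rw [pow_succ]; exact ih _ (hstab f hf x)
  obtain ⟨f₀, hf₀, hf₀'⟩ := C.exists_mem_ne_zero_of_ne_bot hC.2.1
  obtain ⟨n, hn⟩ := hb
  obtain ⟨m, hm⟩ := hc
  obtain ⟨i, hi, hi'⟩ := exists_pow_apply_ne_zero (T := R b) (n := n) hf₀' (by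
    ext y; rw [hRpow, hn, mul_zero, map_zero]; rfl)
  set f₁ := (R b ^ i) f₀
  obtain ⟨j, hj, hj'⟩ := exists_pow_apply_ne_zero (T := R c) (n := m) hi (by
    ext y; rw [hRpow, hm, mul_zero, map_zero]; rfl)
  set f₂ := (R c ^ j) f₁ with hf₂
  let W : Submodule k (Module.Dual k A) := C ⊓ (LinearMap.ker (R b) ⊓ LinearMap.ker (R c))
  have hW : f₂ ∈ W := by
    refine ⟨hRC c j _ (hRC b i _ hf₀), ?_, hj'⟩
    rw [SetLike.mem_coe, LinearMap.mem_ker]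
    ext y
    rw [hR, hf₂, hRpow, mul_assoc, (show Commute b c from h.bc).pow_right, ← mul_assoc, ← hR b, hi']
    rfl
  have hmap : ∀ f ∈ W, R a f ∈ W := by
    rintro f ⟨hf, hfb, hfc⟩
    refine ⟨hstab f hf a, ?_, ?_⟩ <;> rw [SetLike.mem_coe, LinearMap.mem_ker] <;> ext y <;>
      rw [hR, hR, mul_assoc]
    · rw [h.ba, mul_smul_comm, map_smul, ← mul_assoc, ← hR b, LinearMap.mem_ker.1 hfb]; simp
    · rw [h.ca, mul_smul_comm, map_smul, ← mul_assoc, ← hR c, LinearMap.mem_ker.1 hfc]; simp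
  have : Nontrivial W := ⟨⟨⟨f₂, hW⟩, 0, fun e => hj (congrArg Subtype.val e)⟩⟩
  obtain ⟨l, hl⟩ := Module.End.exists_eigenvalue (K := k) (V := W) ((R a).restrict hmap)
  obtain ⟨w, hw⟩ := hl.exists_hasEigenvector
  have hw0 : (w : Module.Dual k A) ≠ 0 := fun e => hw.2 (Subtype.ext e)
  have e := congrArg Subtype.val hw.apply_eq_smul
  obtain ⟨⟨f, hf, hfb, hfc⟩, hw1⟩ := w, hw
  replace e : R a f = l • f := e
  have ea : ∀ y, f (y * a) = l * f y := fun y => LinearMap.congr_fun e y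
  have eb : ∀ y, f (y * b) = 0 := fun y => LinearMap.congr_fun (LinearMap.mem_ker.1 hfb) y
  have ec : ∀ y, f (y * c) = 0 := fun y => LinearMap.congr_fun (LinearMap.mem_ker.1 hfc) y
  have ed : ∀ y, l * f (y * d) = f y := by
    intro y
    rw [← ea, mul_assoc, h.da, mul_add, mul_one, mul_smul_comm, ← mul_assoc, map_add, map_smul, ec,
      smul_zero, add_zero]
  have hl0 : l ≠ 0 := by
    rintro rfl
    exact hw0 (by ext y; rw [← ed, zero_mul]; rfl)
  refine finrank_eq_one_of_mul hC hf hw0 fun y => ?_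
  have hy : y ∈ Algebra.adjoin k {a, b, c, d} := hgen ▸ Algebra.mem_top
  induction hy using Algebra.adjoin_induction with
  | mem x hx =>
    rcases hx with rfl | rfl | rfl | rfl
    · exact ⟨l, ea⟩
    · exact ⟨0, fun x => by rw [eb, zero_mul]⟩
    · exact ⟨0, fun x => by rw [ec, zero_mul]⟩
    · exact ⟨l⁻¹, fun x => by rw [← ed x, inv_mul_cancel_left₀ hl0]⟩
  | algebraMap r =>
    exact ⟨r, fun x => by rw [← Algebra.commutes, ← Algebra.smul_def, map_smul, smul_eq_mul]⟩
  | add x y _ _ hx hy =>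
    obtain ⟨r, hr⟩ := hx
    obtain ⟨s, hs⟩ := hy
    exact ⟨r + s, fun x => by rw [mul_add, map_add, hr, hs, add_mul]⟩
  | mul x y _ _ hx hy =>
    obtain ⟨r, hr⟩ := hx
    obtain ⟨s, hs⟩ := hy
    exact ⟨s * r, fun x => by rw [← mul_assoc, hs, hr, mul_assoc]⟩

end

end HopfClass

end

section

open TensorProduct

namespace HopfClass
open Coalgebra HopfAlgebra

section
variable {k : Type*} [Field k] [CharZero k] {A : Type*} [Ring A] [Algebra k A]

theorem eq_zero_of_idem_of_eq_commutator [FiniteDimensional k A] {g x y : A} {t : k} (ht : t ≠ 0)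
    (hg : g * g = g) (h : x * y - y * x = t • g) : g = 0 := by
  have h1 : LinearMap.trace k A (LinearMap.mulLeft k (x * y - y * x)) = 0 := by
    have : LinearMap.mulLeft k (x * y - y * x) = LinearMap.mulLeft k x * LinearMap.mulLeft k y -
        LinearMap.mulLeft k y * LinearMap.mulLeft k x := by
      ext z; simp [sub_mul, mul_assoc]
    rw [this, map_sub, LinearMap.trace_mul_comm, sub_self]
  have h2 : LinearMap.mulLeft k (t • g) = t • LinearMap.mulLeft k g := by
    ext z; simp
  rw [h, h2, map_smul, smul_eq_zero, or_iff_right ht] at h1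
  have hproj : IsIdempotentElem (LinearMap.mulLeft k g) := by
    ext z; simp [← mul_assoc, hg]
  have h3 := (LinearMap.IsIdempotentElem.isProj_range _ hproj).trace
  rw [h1] at h3
  have h4 : Module.finrank k (LinearMap.range (LinearMap.mulLeft k g)) = 0 := by
    exact_mod_cast h3.symm
  rw [Submodule.finrank_eq_zero, LinearMap.range_eq_bot] at h4
  simpa using LinearMap.congr_fun h4 1

theorem isNilpotent_of_jordan [FiniteDimensional k A] {a c : A} {t : k} (ht : t ≠ 0)
    (h : a * c = c * a - t • (c * c)) : IsNilpotent c := by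
  obtain ⟨β, N, hβ, -⟩ := exists_isDrazin k c
  have hg : c * β = 0 := by
    apply eq_zero_of_idem_of_eq_commutator (x := a * (β * β))
      (y := c) (neg_ne_zero.2 ht) hβ.idem_mul
    have e : c * c * (β * β) = c * β := by
      rw [show c * c * (β * β) = c * (c * β * β) by simp only [mul_assoc], hβ.idem]
    have e1 : β * β * c = c * (β * β) := by
      rw [mul_assoc, ← hβ.comm, ← mul_assoc, ← hβ.comm, mul_assoc]
    rw [mul_assoc, e1, ← mul_assoc, h, sub_mul, smul_mul_assoc, e, ← mul_assoc c]
    simp only [mul_assoc]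
    module
  exact ⟨N, by simpa [hg] using hβ.nil⟩

theorem eq_zero_of_jordan {B : Type*} [Ring B] [HopfAlgebra k B] [FiniteDimensional k B]
    {a b c d : B} {t : k} (ht : t ≠ 0) (hΔ : comul (R := k) c = c ⊗ₜ a + d ⊗ₜ c)
    (h1 : a * c = c * a - t • (c * c)) (h2 : d * c = c * d - t • (c * c))
    (h3 : a * d = 1 + c * b - t • (c * d)) (h4 : d * a = 1 + c * b - t • (c * a)) : c = 0 := by
  by_contra hc
  have : Nontrivial B := ⟨_, _, hc⟩
  obtain ⟨n, hn, hn0⟩ : ∃ n, c ^ (n + 2) = 0 ∧ c ^ (n + 1) ≠ 0 := by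
    have hnil := isNilpotent_of_jordan ht h1
    obtain ⟨m, hm⟩ : ∃ m, nilpotencyClass c = m + 2 := by
      refine ⟨nilpotencyClass c - 2, ?_⟩
      have : nilpotencyClass c ≠ 0 := by
        rw [← Nat.pos_iff_ne_zero, pos_nilpotencyClass_iff]; exact hnil
      have : nilpotencyClass c ≠ 1 := by
        intro e; apply hc; have := pow_nilpotencyClass hnil; rwa [e, pow_one] at this
      omega
    refine ⟨m, hm ▸ pow_nilpotencyClass hnil, ?_⟩
    have := pow_pred_nilpotencyClass hnil
    rwa [hm] at this
  have hca : ∀ i : ℕ, c ^ i * a = a * c ^ i + ((i : k) * t) • c ^ (i + 1) := by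
    intro i
    induction i with
    | zero => simp
    | succ i ih =>
      have e : c * a = a * c + t • (c * c) := by rw [h1]; abel
      rw [pow_succ, mul_assoc, e, mul_add, ← mul_assoc, ih, mul_smul_comm, add_mul,
        smul_mul_assoc, ← mul_assoc, ← pow_succ, ← pow_succ, ← pow_succ, mul_assoc, ← pow_succ]
      push_cast
      module
  have hdc : ∀ i : ℕ, ∃ w, d ^ i * c = c * d ^ i + c * c * w := by
    intro i
    induction i with
    | zero => exact ⟨0, by simp⟩
    | succ i ih =>
      obtain ⟨w, hw⟩ := ih
      refine ⟨-(t • d ^ i) + (d * w - t • (c * w) - t • (c * w)), ?_⟩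
      rw [pow_succ', mul_assoc, hw, mul_add, ← mul_assoc d c, h2]
      have : d * (c * c * w) = c * c * (d * w - t • (c * w) - t • (c * w)) := by
        have e (z : B) : d * (c * z) = c * (d * z) - t • (c * (c * z)) := by
          rw [← mul_assoc, h2, sub_mul, smul_mul_assoc, mul_assoc, mul_assoc]
        simp only [e, mul_sub, mul_smul_comm, mul_assoc]
      rw [this]
      simp only [mul_sub, sub_mul, mul_add, mul_neg, mul_smul_comm, smul_mul_assoc, mul_assoc]
      abel
  have hnd : c ^ (n + 1) * d = d * c ^ (n + 1) := by
    have : ∀ i : ℕ, d * c ^ i = c ^ i * d - ((i : k) * t) • c ^ (i + 1) := by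
      intro i
      induction i with
      | zero => simp
      | succ i ih =>
        rw [pow_succ, ← mul_assoc, ih, sub_mul, mul_assoc, h2, mul_sub, mul_smul_comm,
          smul_mul_assoc, ← mul_assoc, ← mul_assoc, ← pow_succ, ← pow_succ]
        push_cast
        module
    rw [this, hn, smul_zero, sub_zero]
  have key : ∀ i : ℕ, ∃ κ : k, ((c ^ n) ⊗ₜ[k] (1 : B)) * (c ⊗ₜ[k] a + d ⊗ₜ[k] c) ^ (i + 1) =
      (c ^ n * d ^ (i + 1)) ⊗ₜ[k] (c ^ (i + 1)) +
        (c ^ (n + 1) * d ^ i) ⊗ₜ[k] (((i + 1 : ℕ) : k) • (a * c ^ i) + κ • c ^ (i + 1)) := by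
    intro i
    induction i with
    | zero =>
      refine ⟨0, ?_⟩
      simp only [zero_add, pow_one, mul_add, Algebra.TensorProduct.tmul_mul_tmul, one_mul,
        pow_zero, mul_one, Nat.cast_one, one_smul, zero_smul, add_zero, ← pow_succ]
      rw [add_comm]
    | succ i ih =>
      obtain ⟨κ, e⟩ := ih
      refine ⟨κ + ((i + 1 : ℕ) : k) * t, ?_⟩
      have e1 : c ^ n * d ^ (i + 1) * c = c ^ (n + 1) * d ^ (i + 1) := by
        obtain ⟨w, hw⟩ := hdc (i + 1)
        rw [mul_assoc, hw, mul_add, ← mul_assoc, ← pow_succ, ← mul_assoc, ← mul_assoc, ← pow_succ,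
          ← pow_succ, hn, zero_mul, add_zero]
      have e2 : c ^ (n + 1) * d ^ i * c = 0 := by
        obtain ⟨w, hw⟩ := hdc i
        rw [mul_assoc, hw, mul_add, ← mul_assoc, ← pow_succ, ← mul_assoc, ← mul_assoc, ← pow_succ,
          ← pow_succ, hn, pow_succ, hn]
        simp
      rw [pow_succ, ← mul_assoc, e, add_mul, mul_add, mul_add]
      simp only [Algebra.TensorProduct.tmul_mul_tmul, e1, e2, zero_tmul, mul_assoc _ (d ^ _) d,
        ← pow_succ, hca, add_mul, smul_mul_assoc, mul_assoc a]
      simp only [tmul_add, tmul_smul]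
      push_cast
      module
  obtain ⟨κ, e⟩ := key (n + 1)
  have e0 : (c ⊗ₜ[k] a + d ⊗ₜ[k] c) ^ (n + 1 + 1) = 0 := by
    rw [← hΔ, ← Bialgebra.comul_pow, hn, map_zero]
  rw [e0, mul_zero, hn, tmul_zero, smul_zero, add_zero, zero_add, tmul_smul] at e
  have e1 := (smul_eq_zero.1 e.symm).resolve_left (Nat.cast_ne_zero.2 (Nat.succ_ne_zero _))
  refine tmul_ne_zero ?_ ?_ e1
  · have e3 : c ^ (n + 1) * (d * a) = c ^ (n + 1) := by
      rw [h4, mul_sub, mul_add, mul_one, mul_smul_comm, ← mul_assoc, ← mul_assoc, ← pow_succ, hn]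
      simp
    have : ∀ i, c ^ (n + 1) * d ^ i ≠ 0 := by
      intro i
      induction i with
      | zero => simpa using hn0
      | succ i ih =>
        intro e
        apply ih
        have hcm : c ^ (n + 1) * d ^ i = d ^ i * c ^ (n + 1) :=
          (show Commute (c ^ (n + 1)) d from hnd).pow_right i
        have : c ^ (n + 1) * d ^ i * (d * a) = c ^ (n + 1) * d ^ (i + 1) * a := by
          rw [pow_succ d]; simp only [mul_assoc]
        rwa [e, zero_mul, hcm, mul_assoc, e3, ← hcm] at this
    exact this _
  · intro e
    have e3 : c ^ (n + 1) * a = 0 := by rw [hca, e, hn, smul_zero, add_zero]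
    apply hn0
    have : c ^ (n + 1) * (a * d) = c ^ (n + 1) := by
      rw [h3, mul_sub, mul_add, mul_one, mul_smul_comm, ← mul_assoc, ← mul_assoc, ← pow_succ, hn]
      simp
    rw [← this, ← mul_assoc, e3, zero_mul]

end

end HopfClass

end

section

open TensorProduct

namespace HopfClass
open Coalgebra HopfAlgebra

section CommCase
variable {k : Type*} [Field k]

theorem exists_common_eigenvector [IsAlgClosed k] {G : Type*} [Group G] [Finite G] {p : ℕ}
    [Fact p.Prime] (hodd : Odd p) (hG : IsPGroup p G) (ρ : G →* Matrix (Fin 2) (Fin 2) k)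
    (hρ : Function.Injective ρ) (hsc : ∀ g (l : k),
      ρ g = l • (1 : Matrix (Fin 2) (Fin 2) k) → l * l = 1) :
    ∃ v : Fin 2 → k, v ≠ 0 ∧ ∀ g, ∃ μ : k, (ρ g).mulVec v = μ • v := by
  rcases subsingleton_or_nontrivial G with hs | hn
  · refine ⟨fun _ => 1, fun e => one_ne_zero (congrFun e 0), fun g => ⟨1, ?_⟩⟩
    rw [Subsingleton.elim g 1, map_one, Matrix.one_mulVec, one_smul]
  have := hG.center_nontrivial
  obtain ⟨⟨g, hgc⟩, hg⟩ := exists_ne (1 : Subgroup.center G)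
  have hg1 : g ≠ 1 := fun e => hg (Subtype.ext e)
  obtain ⟨l, hl⟩ := Module.End.exists_eigenvalue (K := k) (V := Fin 2 → k) (Matrix.toLin' (ρ g))
  set W := Module.End.eigenspace (Matrix.toLin' (ρ g)) l with hW
  have hmem : ∀ w, w ∈ W ↔ (ρ g).mulVec w = l • w := fun w => by
    rw [hW, Module.End.mem_eigenspace_iff, Matrix.toLin'_apply]
  have hne : W ≠ ⊤ := by
    intro htop
    have e : ρ g = l • (1 : Matrix (Fin 2) (Fin 2) k) := by
      apply Matrix.toLin'.injective
      apply LinearMap.ext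
      intro w
      have : w ∈ W := by rw [htop]; trivial
      rw [Matrix.toLin'_apply, (hmem w).1 this, Matrix.toLin'_apply, Matrix.smul_mulVec,
        Matrix.one_mulVec]
    have e2 : g ^ 2 = 1 := by
      apply hρ
      rw [map_pow, e, pow_two, smul_mul_smul_comm, hsc g l e, one_smul, mul_one, map_one]
    obtain ⟨m, hm⟩ := IsPGroup.iff_orderOf.1 hG g
    have h2 := orderOf_dvd_of_pow_eq_one e2
    have h3 : Nat.Coprime (orderOf g) 2 := by
      rw [hm, Nat.coprime_two_right]; exact hodd.pow
    have := Nat.eq_one_of_dvd_coprimes h3 dvd_rfl h2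
    exact hg1 (orderOf_eq_one_iff.1 this)
  have h1 : Module.finrank k W = 1 := by
    have hlt := Submodule.finrank_lt hne
    have : Module.finrank k W ≠ 0 := by
      rw [Ne, Submodule.finrank_eq_zero]; exact hl
    rw [Module.finrank_fin_fun] at hlt
    omega
  obtain ⟨⟨v, hvW⟩, hv, hspan⟩ := finrank_eq_one_iff'.1 h1
  refine ⟨v, fun e => hv (Subtype.ext e), fun x => ?_⟩
  have hx : (ρ x).mulVec v ∈ W := by
    rw [hmem, Matrix.mulVec_mulVec, ← map_mul, ← Subgroup.mem_center_iff.1 hgc x, map_mul,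
      ← Matrix.mulVec_mulVec, (hmem v).1 hvW, Matrix.mulVec_smul]
  obtain ⟨μ, hμ⟩ := hspan ⟨_, hx⟩
  exact ⟨μ, (congrArg Subtype.val hμ).symm⟩

theorem isNilpotent_of_forall_char [IsAlgClosed k] {B : Type*} [CommRing B] [Algebra k B]
    [FiniteDimensional k B] {x : B} (h : ∀ α : B →ₐ[k] k, α x = 0) : IsNilpotent x := by
  rw [← mem_nilradical, nilradical_eq_sInf, Ideal.mem_sInf]
  intro J hJ
  have : J.IsPrime := hJ
  have : IsDomain (B ⧸ J) := Ideal.Quotient.isDomain J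
  have hbij := IsAlgClosed.algebraMap_bijective_of_isIntegral (k := k) (K := B ⧸ J)
  let φ : (B ⧸ J) ≃ₐ[k] k := (AlgEquiv.ofBijective (Algebra.ofId k (B ⧸ J)) hbij).symm
  have := h (φ.toAlgHom.comp (Ideal.Quotient.mkₐ k J))
  rw [← Ideal.Quotient.eq_zero_iff_mem]
  exact φ.injective (by simpa using this)

theorem exists_rank_one_of_comm [IsAlgClosed k] {B : Type*} [CommRing B] [Nontrivial B]
    [Algebra k B]
    [FiniteDimensional k B] : ∃ y : B, y ≠ 0 ∧ ∀ x, y * x ∈ Submodule.span k {y} := by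
  have : IsArtinianRing B := IsArtinianRing.of_finite k B
  obtain ⟨I, hI⟩ := IsAtomic.exists_atom (Ideal B)
  have hs : IsSimpleModule B I := isSimpleModule_iff_isAtom.2 hI
  have := IsSimpleModule.nontrivial B I
  obtain ⟨⟨y, hy⟩, hy0⟩ := exists_ne (0 : I)
  refine ⟨y, fun e => hy0 (Subtype.ext e), fun x => ?_⟩
  have := (IsSimpleModule.algebraMap_end_bijective_of_isAlgClosed (A := B) (V := I) k).2
    (LinearMap.lsmul B I x)
  obtain ⟨l, hl⟩ := this
  have := congrArg Subtype.val (LinearMap.congr_fun hl ⟨y, hy⟩)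
  rw [Submodule.mem_span_singleton]
  refine ⟨l, ?_⟩
  rw [mul_comm]
  exact this

theorem ne_zero_of_linearIndependent {M : Type*} [AddCommGroup M] [Module k M] {a b c d : M}
    (hli : LinearIndependent k ![a, b, c, d]) {r s t u : k}
    (h : r • a + s • b + t • c + u • d = 0) : r = 0 ∧ s = 0 ∧ t = 0 ∧ u = 0 := by
  have := Fintype.linearIndependent_iff.1 hli ![r, s, t, u] (by
    simpa [Fin.sum_univ_four] using h)
  exact ⟨this 0, this 1, this 2, this 3⟩

theorem IsQHopf.isUnit_det {B : Type*} [CommRing B] [HopfAlgebra k B] {q : k} {a b c d : B}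
    (h : IsQHopf q a b c d) : IsUnit (a * d - b * c) := by
  have h1 := HopfAlgebra.mul_antipode_rTensor_comul_apply (R := k) a
  have h2 := HopfAlgebra.mul_antipode_rTensor_comul_apply (R := k) b
  have h3 := HopfAlgebra.mul_antipode_rTensor_comul_apply (R := k) c
  have h4 := HopfAlgebra.mul_antipode_rTensor_comul_apply (R := k) d
  simp only [h.comul_a, h.comul_b, h.comul_c, h.comul_d, map_add, LinearMap.rTensor_tmul,
    LinearMap.mul'_apply, h.S_a, h.S_b, h.S_c, h.S_d, h.counit_a, h.counit_b, h.counit_c,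
    h.counit_d, map_one, map_zero] at h1 h2 h3 h4
  have hq : algebraMap k B q⁻¹ * algebraMap k B q = 1 := by
    rw [← map_mul, inv_mul_cancel₀ h.q0, map_one]
  simp only [Algebra.smul_def] at h1 h2 h3 h4
  refine IsUnit.of_mul_eq_one (d * a - b * c) ?_
  linear_combination (-(algebraMap k B q * c) * b + a * d) * h1 + h4 -
    (-(algebraMap k B q * c) * a + a * c) * h2 + (a * d - b * c) * (b * c) * hq

theorem IsQHopf.false_of_comm [IsAlgClosed k] [CharZero k] {B : Type*} [CommRing B]
    [HopfAlgebra k B]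
    [FiniteDimensional k B] {q : k} {a b c d : B}
    (h : IsQHopf q a b c d) (hli : LinearIndependent k ![a, b, c, d]) {p n : ℕ} (hp : p.Prime)
    (hodd : Odd p) (hdim : Module.finrank k B ∣ p ^ n) : False := by
  classical
  have hfact : Fact p.Prime := ⟨hp⟩
  let ρ : WithConv (B →ₐ[k] k) →* Matrix (Fin 2) (Fin 2) k :=
    { toFun := fun α => !![α.ofConv a, α.ofConv b; α.ofConv c, α.ofConv d]
      map_one' := by
        simp only [convOne_ofConv_apply, h.counit_a, h.counit_b, h.counit_c, h.counit_d]
        exact Matrix.one_fin_two.symm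
      map_mul' := fun α β => by
        simp [convMul_ofConv_apply, h.comul_a, h.comul_b, h.comul_c, h.comul_d] }
  have hρ0 (α) : ρ α = !![α.ofConv a, α.ofConv b; α.ofConv c, α.ofConv d] := rfl
  have hρ : Function.Injective ρ := by
    intro α β e
    rw [hρ0, hρ0] at e
    have : α.ofConv = β.ofConv := by
      apply AlgHom.ext_of_adjoin_eq_top h.gen
      rintro x (rfl | rfl | rfl | rfl)
      exacts [congrFun₂ e 0 0, congrFun₂ e 0 1, congrFun₂ e 1 0, congrFun₂ e 1 1]
    exact congrArg WithConv.toConv this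
  have : Finite (WithConv (B →ₐ[k] k)) := Finite.of_injective _ WithConv.ofConv_injective
  have hG : IsPGroup p (WithConv (B →ₐ[k] k)) := by
    rw [IsPGroup.iff_card]
    refine ⟨_, Nat.eq_prime_pow_of_unique_prime_dvd Nat.card_pos.ne' ?_⟩
    intro r hr hrd
    have : Fact r.Prime := ⟨hr⟩
    obtain ⟨α, hα⟩ := exists_prime_orderOf_dvd_card' r hrd
    have h1 : α ^ r = 1 := by rw [← hα, pow_orderOf_eq_one]
    have h2 : α ≠ 1 := by
      rintro rfl
      rw [orderOf_one] at hα
      exact hr.one_lt.ne hα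
    have := (prime_dvd_finrank hr h1 h2).trans hdim
    exact (Nat.prime_dvd_prime_iff_eq hr hp).1 (hr.dvd_of_dvd_pow this)
  obtain ⟨v, hv, hvρ⟩ := exists_common_eigenvector hodd hG ρ hρ (by
    intro α l e
    rw [hρ0] at e
    have ea : α.ofConv a = l := by simpa using congrFun₂ e 0 0
    have eb : α.ofConv b = 0 := by simpa using congrFun₂ e 0 1
    have ed : α.ofConv d = l := by simpa using congrFun₂ e 1 1
    have := congrArg α.ofConv h.ad
    simpa [ea, eb, ed] using this)
  obtain ⟨x, y, hxy⟩ : ∃ x y : k, v 0 * y - v 1 * x = 1 := by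
    by_cases h0 : v 0 = 0
    · have h1 : v 1 ≠ 0 := fun h1 => hv (by ext i; fin_cases i <;> simp [h0, h1])
      exact ⟨-(v 1)⁻¹, 0, by simp [h1]⟩
    · exact ⟨0, (v 0)⁻¹, by simp [h0]⟩
  set v0 := v 0
  set v1 := v 1
  set a' := y • (v0 • a + v1 • b) - x • (v0 • c + v1 • d) with ha'
  set b' := y • (x • a + y • b) - x • (x • c + y • d) with hb'
  set c' := v0 • (v0 • c + v1 • d) - v1 • (v0 • a + v1 • b) with hc'
  set d' := v0 • (x • c + y • d) - v1 • (x • a + y • b) with hd'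
  have hnil : IsNilpotent c' := by
    apply isNilpotent_of_forall_char (k := k)
    intro α
    obtain ⟨μ, hμ⟩ := hvρ (WithConv.toConv α)
    rw [hρ0] at hμ
    have e0 : α a * v0 + α b * v1 = μ * v0 := by
      simpa [Matrix.mulVec, dotProduct, Fin.sum_univ_two] using congrFun hμ 0
    have e1 : α c * v0 + α d * v1 = μ * v1 := by
      simpa [Matrix.mulVec, dotProduct, Fin.sum_univ_two] using congrFun hμ 1
    simp only [hc', map_sub, map_add, map_smul, smul_eq_mul]
    linear_combination v0 * e1 - v1 * e0
  have hdet : a' * d' - b' * c' = a * d - b * c := by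
    have hxy' := congrArg (algebraMap k B) hxy
    simp only [map_sub, map_mul, map_one] at hxy'
    simp only [ha', hb', hc', hd', Algebra.smul_def]
    set V0 := algebraMap k B v0
    set V1 := algebraMap k B v1
    set X := algebraMap k B x
    set Y := algebraMap k B y
    linear_combination (a * d - b * c) * (V0 * Y - V1 * X + 1) * hxy'
  have hunit : IsUnit (a' * d') := by
    have : a' * d' = (a * d - b * c) + b' * c' := by rw [← hdet]; ring
    rw [this]
    exact IsNilpotent.isUnit_add_left_of_commute ((Commute.all _ _).isNilpotent_mul_left hnil) h.isUnit_det (Commute.all _ _)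
  have hua := isUnit_of_mul_isUnit_left hunit
  have hud := isUnit_of_mul_isUnit_right hunit
  have hΔ : comul (R := k) c' = d' ⊗ₜ c' + c' ⊗ₜ a' := by
    simp only [hc', hd', ha', map_sub, map_add, map_smul, h.comul_a, h.comul_b, h.comul_c,
      h.comul_d, TensorProduct.tmul_add, TensorProduct.add_tmul, TensorProduct.tmul_smul,
      ← TensorProduct.smul_tmul', TensorProduct.sub_tmul, TensorProduct.tmul_sub]
    linear_combination (norm := module) (-hxy) • (v0 • (v0 • (c ⊗ₜ[k] a + d ⊗ₜ[k] c) +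
      v1 • (c ⊗ₜ[k] b + d ⊗ₜ[k] d)) - v1 • (v0 • (a ⊗ₜ[k] a + b ⊗ₜ[k] c) +
      v1 • (a ⊗ₜ[k] b + b ⊗ₜ[k] d)))
  have hc0 : c' = 0 := by
    by_contra hc
    have : Nontrivial B := ⟨_, _, hc⟩
    obtain ⟨m, hm⟩ : ∃ m, nilpotencyClass c' = m + 2 := by
      refine ⟨nilpotencyClass c' - 2, ?_⟩
      have : nilpotencyClass c' ≠ 0 := by
        rw [← Nat.pos_iff_ne_zero, pos_nilpotencyClass_iff]; exact hnil
      have : nilpotencyClass c' ≠ 1 := by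
        intro e; apply hc; have := pow_nilpotencyClass hnil; rwa [e, pow_one] at this
      omega
    have hm0 := pow_nilpotencyClass hnil
    have hm1 := pow_pred_nilpotencyClass hnil
    rw [hm] at hm0 hm1
    refine pow_ne_zero_of_q_comm (k := k) one_ne_zero (by rw [one_smul, mul_comm])
      (by rw [inv_one, one_smul, mul_comm]) hud hua m hm0 hm1 ?_ ?_
    · simpa only [one_pow, inv_one, Finset.sum_const, Finset.card_range, nsmul_eq_mul,
        mul_one] using
        (Nat.cast_ne_zero (R := k)).2 (Nat.succ_ne_zero (m + 1))
    · rw [← hΔ, ← Bialgebra.comul_pow, hm0, map_zero]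
  obtain ⟨e1, e2, e3, e4⟩ := ne_zero_of_linearIndependent hli (r := -(v1 * v0)) (s := -(v1 * v1))
    (t := v0 * v0) (u := v0 * v1) (by rw [← hc0, hc']; module)
  apply hv
  ext i
  fin_cases i
  · simpa using e3
  · simpa using e2

end CommCase
end HopfClass

end

section

open TensorProduct

namespace HopfClass
open Coalgebra HopfAlgebra

section NegOne
variable {k : Type*} [Field k]

theorem map_antipode {K L : Type*} [Ring K] [HopfAlgebra k K] [Ring L] [HopfAlgebra k L]
    (ι : K →ₐc[k] L) (x : K) : ι (antipode k x) = antipode k (ι x) := by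
  let F : WithConv (K →ₗ[k] L) := WithConv.toConv ((ι : K →ₗ[k] L) ∘ₗ antipode k)
  let G : WithConv (K →ₗ[k] L) := WithConv.toConv (ι : K →ₗ[k] L)
  let J : WithConv (K →ₗ[k] L) := WithConv.toConv (antipode k ∘ₗ (ι : K →ₗ[k] L))
  have hFG : F * G = 1 := by
    apply WithConv.ofConv_injective
    apply LinearMap.ext
    intro y
    have h1 : ∀ t : K ⊗[k] K, LinearMap.mul' k L (TensorProduct.map ((ι : K →ₗ[k] L) ∘ₗ antipode k)
        (ι : K →ₗ[k] L) t) = ι (LinearMap.mul' k K ((antipode k).rTensor K t)) := by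
      intro t
      induction t with
      | zero => simp
      | add a b ha hb => simp only [map_add, ha, hb]
      | tmul a b => simp
    refine (h1 _).trans ?_
    rw [HopfAlgebra.mul_antipode_rTensor_comul_apply]
    exact (ι : K →ₐ[k] L).commutes _
  have hGJ : G * J = 1 := by
    apply WithConv.ofConv_injective
    apply LinearMap.ext
    intro y
    have h1 : ∀ t : K ⊗[k] K, LinearMap.mul' k L (TensorProduct.map (ι : K →ₗ[k] L)
        (antipode k ∘ₗ (ι : K →ₗ[k] L)) t) = LinearMap.mul' k L ((antipode k).lTensor L
          (TensorProduct.map (ι : K →ₗ[k] L) (ι : K →ₗ[k] L) t)) := by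
      intro t
      induction t with
      | zero => simp
      | add a b ha hb => simp only [map_add, ha, hb]
      | tmul a b => simp
    refine (h1 _).trans ?_
    rw [show TensorProduct.map (ι : K →ₗ[k] L) (ι : K →ₗ[k] L) (comul y) = comul (ι y) from
      CoalgHomClass.map_comp_comul_apply ι y, HopfAlgebra.mul_antipode_lTensor_comul_apply]
    exact congrArg (algebraMap k L) (CoalgHomClass.counit_comp_apply ι y)
  have := left_inv_eq_right_inv hFG hGJ
  exact LinearMap.congr_fun (congrArg WithConv.ofConv this) x

universe u

variable {B : Type u} [Ring B] [HopfAlgebra k B] {a b c d : B}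

namespace IsQHopf

theorem commute_of_neg_one [IsAlgClosed k] [CharZero k] [FiniteDimensional k B]
    (h : IsQHopf (-1 : k) a b c d)
    (hodd : Odd (Module.finrank k B)) (x y : B) : x * y = y * x := by
  have hi : ((-1 : k))⁻¹ = -1 := by norm_num
  have had : d * a = a * d := by rw [h.ad, h.da, hi]
  have hab := h.ab
  have hac := h.ac
  have hbd := h.bd
  have hcd := h.cd
  have hbc := h.bc
  simp only [neg_smul, one_smul] at hab hac hbd hcd
  let g : Fin 2 → Fin 2 → B := ![![a, b], ![c, d]]
  let σ : Fin 2 → Fin 2 → k := fun i j => if i = j then 1 else -1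
  have hσ2 : ∀ i j, σ i j * σ i j = 1 := by
    intro i j; fin_cases i <;> fin_cases j <;> simp [σ]
  have hg : ∀ i j i' j', g i j * g i' j' = (σ i j * σ i' j') • (g i' j' * g i j) := by
    intro i j i' j'
    fin_cases i <;> fin_cases j <;> fin_cases i' <;> fin_cases j' <;>
      simp [g, σ, hab, hac, hbd, hcd, hbc, had]
  have hΔ : ∀ i j, comul (R := k) (g i j) = ∑ l, g i l ⊗ₜ g l j := by
    intro i j
    fin_cases i <;> fin_cases j <;>
      simp [g, h.comul_a, h.comul_b, h.comul_c, h.comul_d]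
  have hS : ∀ i j, ∃ r : k, ∃ i' j', antipode k (g i j) = r • g i' j' := by
    intro i j
    fin_cases i <;> fin_cases j
    · exact ⟨1, 1, 1, by simp [g, h.S_a]⟩
    · exact ⟨1, 0, 1, by simp [g, h.S_b, hi]⟩
    · exact ⟨1, 1, 0, by simp [g, h.S_c]⟩
    · exact ⟨1, 0, 0, by simp [g, h.S_d]⟩
  let X : Set B := {x | ∃ i j i' j', x = g i j * g i' j'}
  have hX : ∀ i j i' j', g i j * g i' j' ∈ Algebra.adjoin k X := fun i j i' j' =>
    Algebra.subset_adjoin ⟨i, j, i', j', rfl⟩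
  have hXc : ∀ x ∈ X, ∀ y ∈ X, x * y = y * x := by
    rintro _ ⟨i, j, i', j', rfl⟩ _ ⟨l, m, l', m', rfl⟩
    calc g i j * g i' j' * (g l m * g l' m') = g i j * (g i' j' * g l m) * g l' m' := by
          simp only [mul_assoc]
      _ = (σ i' j' * σ l m) • ((g i j * g l m) * (g i' j' * g l' m')) := by
          rw [hg i' j' l m]; simp only [mul_smul_comm, smul_mul_assoc, mul_assoc]
      _ = (σ i' j' * σ l m * (σ i j * σ l m) * (σ i' j' * σ l' m')) •
          (g l m * (g i j * g l' m') * g i' j') := by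
          rw [hg i j l m, hg i' j' l' m']
          simp only [mul_smul_comm, smul_mul_assoc, mul_assoc, smul_smul]
          congr 1; ring
      _ = (σ i' j' * σ l m * (σ i j * σ l m) * (σ i' j' * σ l' m') * (σ i j * σ l' m')) •
          (g l m * g l' m' * (g i j * g i' j')) := by
          rw [hg i j l' m']
          simp only [mul_smul_comm, smul_mul_assoc, mul_assoc, smul_smul]
      _ = _ := by
          rw [show σ i' j' * σ l m * (σ i j * σ l m) * (σ i' j' * σ l' m') * (σ i j * σ l' m') =
            (σ i j * σ i j) * (σ i' j' * σ i' j') * (σ l m * σ l m) * (σ l' m' * σ l' m') by ring]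
          simp only [hσ2, mul_one, one_smul]
  obtain ⟨K, _, _, ι, hι, hιr⟩ := exists_hopfAlgebra_of_adjoin (k := k) X (by
    rintro _ ⟨i, j, i', j', rfl⟩
    rw [Bialgebra.comul_mul, hΔ, hΔ, Finset.sum_mul_sum]
    refine sum_mem fun l _ => sum_mem fun m _ => ?_
    rw [Algebra.TensorProduct.tmul_mul_tmul]
    exact ⟨⟨_, hX i l i' m⟩ ⊗ₜ ⟨_, hX l j m j'⟩, by simp⟩) (by
    rintro _ ⟨i, j, i', j', rfl⟩
    obtain ⟨r, l, m, e⟩ := hS i j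
    obtain ⟨r', l', m', e'⟩ := hS i' j'
    rw [antipode_mul_antidistrib, e, e', smul_mul_smul_comm]
    exact Subalgebra.smul_mem _ (hX _ _ _ _) _)
  have hKc : ∀ x y : K, x * y = y * x := by
    intro x y
    have hx : ι x ∈ Algebra.adjoin k X := hιr ▸ ⟨x, rfl⟩
    have hy : ι y ∈ Algebra.adjoin k X := hιr ▸ ⟨y, rfl⟩
    have := (Algebra.isMulCommutative_adjoin k hXc).is_comm.comm ⟨ι x, hx⟩ ⟨ι y, hy⟩
    apply hι
    rw [map_mul, map_mul]
    exact congrArg Subtype.val this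
  have : FiniteDimensional k K := FiniteDimensional.of_injective (ι : K →ₗ[k] B) hι
  have hιmem : ∀ x ∈ Algebra.adjoin k X, ∃ z, ι z = x := by
    intro x hx; rw [← hιr] at hx; exact hx
  have hSK : Function.Bijective (antipode k (A := K)) := by
    have hinj : Function.Injective (antipode k (A := K)) := by
      intro x y e
      apply hι
      apply h.antipode_bijective.1
      rw [← map_antipode, ← map_antipode, e]
    exact ⟨hinj, LinearMap.injective_iff_surjective.1 hinj⟩
  have hdvd : Module.finrank k K ∣ Module.finrank k B := by
    let _ : CommRing K := { ‹Ring K› with mul_comm := hKc }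
    have : Nontrivial K := Bialgebra.nontrivial (R := k) (A := K)
    obtain ⟨s, hs, hs'⟩ := exists_rank_one_of_comm (k := k) (B := K)
    exact finrank_dvd_of_mul_mem_span hSK ι hι hs hs'
  obtain ⟨z, hz⟩ := hιmem _ (hX 0 0 0 0)
  replace hz : ι z = a * a := hz
  obtain ⟨β, N, hβ, -⟩ := exists_isDrazin k z
  have hβ' : IsDrazin (ι z) (ι β) N := 
    ⟨by rw [← map_mul, hβ.comm, map_mul], by rw [← map_mul, ← map_mul, hβ.idem],
      by rw [← map_mul, ← map_one ι, ← map_sub, ← map_pow, ← map_mul, hβ.nil, map_zero]⟩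
  have hac2 : ∀ x, x * (a * a) = a * a * x := by
    apply IsQMat.commute_of_gen h.gen
    · rw [mul_assoc]
    · rw [mul_assoc a a b, hab, mul_neg, ← mul_assoc a b a, hab, neg_mul, neg_neg, mul_assoc]
    · rw [mul_assoc a a c, hac, mul_neg, ← mul_assoc a c a, hac, neg_mul, neg_neg, mul_assoc]
    · rw [← mul_assoc, had, mul_assoc, had, mul_assoc]
  have hβc : ∀ x, x * ι β = ι β * x := fun x =>
    hβ'.commute (k := k) (by rw [hz]; exact hac2 x)
  obtain ⟨e, he⟩ : ∃ e, e = z * β := ⟨_, rfl⟩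
  have hec : ∀ x, x * ι e = ι e * x := fun x => by
    rw [he, map_mul, hz, ← mul_assoc, hac2, mul_assoc, hβc]; simp only [mul_assoc]
  have hee : e * e = e := by rw [he]; exact hβ.idem_mul
  have he0 : e ≠ 0 := by
    intro e0
    have h1 := hβ'.nil
    rw [← map_mul, ← he, e0, map_zero, sub_zero, mul_one, hz] at h1
    have := congrArg (counit (R := k)) h1
    rw [Bialgebra.counit_pow, Bialgebra.counit_mul, h.counit_a, map_zero, one_mul, one_pow] at this
    exact one_ne_zero this
  let R := LinearMap.range (LinearMap.mulLeft k e)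
  let F : R × R →ₗ[k] B := LinearMap.coprod ((ι : K →ₗ[k] B) ∘ₗ R.subtype)
    (LinearMap.mulLeft k a ∘ₗ (ι : K →ₗ[k] B) ∘ₗ R.subtype)
  have hF : ∀ z₁ z₂ : K, ι (e * z₁) + a * ι (e * z₂) ∈ LinearMap.range F := fun z₁ z₂ =>
    ⟨(⟨e * z₁, z₁, rfl⟩, ⟨e * z₂, z₂, rfl⟩), rfl⟩
  have hgX : ∀ w ∈ ({a, b, c, d} : Set B), ∃ i j, w = g i j := by
    rintro w (rfl | rfl | rfl | rfl)
    exacts [⟨0, 0, rfl⟩, ⟨0, 1, rfl⟩, ⟨1, 0, rfl⟩, ⟨1, 1, rfl⟩]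
  have hstab : ∀ w ∈ ({a, b, c, d} : Set B), ∀ v ∈ LinearMap.range F,
    w * v ∈ LinearMap.range F := by
    rintro w hw _ ⟨⟨⟨_, z₁, rfl⟩, ⟨_, z₂, rfl⟩⟩, rfl⟩
    obtain ⟨i, j, rfl⟩ := hgX w hw
    obtain ⟨y₁, hy₁⟩ := hιmem _ (hX 0 0 i j)
    obtain ⟨y₂, hy₂⟩ := hιmem _ (hX i j 0 0)
    replace hy₁ : ι y₁ = a * g i j := hy₁
    replace hy₂ : ι y₂ = g i j * a := hy₂
    have e₁ : a * ι (e * (β * y₁ * z₁)) = g i j * ι (e * z₁) := by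
      rw [map_mul, map_mul, map_mul, hy₁, ← hβc, map_mul, ← mul_assoc, hec a]
      calc ι e * a * (a * g i j * ι β * ι z₁) = ι e * ((a * a) * g i j * ι β) * ι z₁ := by
            simp only [mul_assoc]
        _ = ι e * (ι e * g i j) * ι z₁ := by
            rw [mul_assoc (a * a), hβc, ← mul_assoc (a * a), ← hz, ← map_mul, ← he]
        _ = _ := by rw [← mul_assoc (ι e), ← map_mul, hee, ← hec, mul_assoc]
    have e₂ : ι (e * (y₂ * z₂)) = g i j * (a * ι (e * z₂)) := by
      rw [map_mul, map_mul, map_mul, hy₂, ← mul_assoc, ← hec]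
      simp only [mul_assoc]
    convert hF (y₂ * z₂) (β * y₁ * z₁) using 1
    rw [e₁, e₂, add_comm]
    exact mul_add _ _ _
  have hle : LinearMap.range (LinearMap.mulLeft k (ι e)) ≤ LinearMap.range F := by
    rintro _ ⟨v, rfl⟩
    rw [LinearMap.mulLeft_apply, ← hec]
    refine mul_mem_of_adjoin_eq_top h.gen hstab v _ ?_
    simpa using hF 1 0
  have hrank : Module.finrank k (LinearMap.range (LinearMap.mulLeft k (ι e))) ≤
      Module.finrank k R + Module.finrank k R := by
    rw [← Module.finrank_prod]
    exact (Submodule.finrank_mono hle).trans (LinearMap.finrank_range_le F)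
  have hR : 0 < Module.finrank k R := by
    rw [Module.finrank_pos_iff]
    exact ⟨⟨⟨e, 1, mul_one e⟩, 0, fun e' => he0 (congrArg Subtype.val e')⟩⟩
  have hNZ := finrank_range_mulLeft_mul hSK ι hι e
  obtain ⟨m, hm⟩ := hdvd
  have hK : 0 < Module.finrank k K := by
    rw [Nat.pos_iff_ne_zero]
    intro h0
    rw [h0, zero_mul] at hm
    rw [hm] at hodd
    exact absurd hodd (by decide)
  have hm2 : m ≤ 2 := by
    have h1 : Module.finrank k R * (Module.finrank k K * m) ≤
        Module.finrank k K * (Module.finrank k R + Module.finrank k R) := by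
      rw [← hm]; exact hNZ.trans_le (Nat.mul_le_mul_left _ hrank)
    by_contra hm2
    have : Module.finrank k R * Module.finrank k K * m ≤
      Module.finrank k R * Module.finrank k K * 2 := by nlinarith
    exact hm2 (Nat.le_of_mul_le_mul_left this (Nat.mul_pos hR hK))
  have hm1 : m = 1 := by
    rw [hm, Nat.odd_mul] at hodd
    have := hodd.2
    interval_cases m
    · exact absurd this (by decide)
    · rfl
    · exact absurd this (by decide)
  rw [hm1, mul_one] at hm
  have hsurj : Function.Surjective ι :=
    (LinearMap.injective_iff_surjective_of_finrank_eq_finrank (f := (ι : K →ₗ[k] B)) hm.symm).1 hι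
  obtain ⟨x, rfl⟩ := hsurj x
  obtain ⟨y, rfl⟩ := hsurj y
  rw [← map_mul, hKc, map_mul]

end IsQHopf
end NegOne
end HopfClass

end

section

open TensorProduct

namespace HopfClass
open Coalgebra HopfAlgebra

section QCase
universe u
variable {k : Type*} [Field k] {H : Type u} [Ring H] [HopfAlgebra k H]

theorem IsQHopf.finrank_dvd_of_injective [IsAlgClosed k] {B : Type*} [Ring B] [HopfAlgebra k B]
    [FiniteDimensional k B] {q : k} {a b c d : B} (h : IsQHopf q a b c d) [FiniteDimensional k H]
    (ι : B →ₐc[k] H) (hι : Function.Injective ι) : Module.finrank k B ∣ Module.finrank k H := by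
  obtain ⟨f, hf⟩ := h.toIsQMat.exists_isQIdem h.gen
  refine h.finrank_dvd hf ?_ ι hι
  rintro rfl
  obtain ⟨u, v, e⟩ := hf.one_sub 1
  have := congrArg (counit (R := k)) e
  rw [sub_zero, pow_one, pow_one, map_add, Bialgebra.counit_mul, Bialgebra.counit_mul, h.counit_b,
    h.counit_c, mul_zero, mul_zero, add_zero, Bialgebra.counit_one] at this
  exact one_ne_zero this

theorem IsQMat.isCopointed_of_finrank [IsAlgClosed k] [CharZero k] [FiniteDimensional k H]
    {q : k} {a b c d : H} (h : IsQMat q a b c d)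
    (comul_a : comul (R := k) a = a ⊗ₜ a + b ⊗ₜ c)
    (comul_b : comul (R := k) b = a ⊗ₜ b + b ⊗ₜ d)
    (comul_c : comul (R := k) c = c ⊗ₜ a + d ⊗ₜ c)
    (comul_d : comul (R := k) d = c ⊗ₜ b + d ⊗ₜ d)
    (S_a : antipode k a = d) (S_b : antipode k b = -(q⁻¹ • b))
    (S_c : antipode k c = -(q • c)) (S_d : antipode k d = a)
    (counit_a : counit (R := k) a = 1) (counit_b : counit (R := k) b = 0)
    (counit_c : counit (R := k) c = 0) (counit_d : counit (R := k) d = 1)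
    (hli : LinearIndependent k ![a, b, c, d]) {p : ℕ} (hp : p.Prime) (hodd : Odd p)
    (hdim : Module.finrank k H = p ^ 3) : IsCopointed k H := by
  let X : Set H := {a, b, c, d}
  have ma : a ∈ Algebra.adjoin k X := Algebra.subset_adjoin (by simp [X])
  have mb : b ∈ Algebra.adjoin k X := Algebra.subset_adjoin (by simp [X])
  have mc : c ∈ Algebra.adjoin k X := Algebra.subset_adjoin (by simp [X])
  have md : d ∈ Algebra.adjoin k X := Algebra.subset_adjoin (by simp [X])
  have hmem : ∀ {x y : H}, x ∈ Algebra.adjoin k X → y ∈ Algebra.adjoin k X → x ⊗ₜ[k] y ∈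
      (Algebra.TensorProduct.map (Algebra.adjoin k X).val (Algebra.adjoin k X).val).range :=
    fun {x y} hx hy => ⟨⟨x, hx⟩ ⊗ₜ ⟨y, hy⟩, by simp⟩
  obtain ⟨B, _, _, ι, hι, hιr⟩ := exists_hopfAlgebra_of_adjoin (k := k) X (by
    rintro _ (rfl | rfl | rfl | rfl)
    · rw [comul_a]; exact add_mem (hmem ma ma) (hmem mb mc)
    · rw [comul_b]; exact add_mem (hmem ma mb) (hmem mb md)
    · rw [comul_c]; exact add_mem (hmem mc ma) (hmem md mc)
    · rw [comul_d]; exact add_mem (hmem mc mb) (hmem md md)) (by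
    rintro _ (rfl | rfl | rfl | rfl)
    · rwa [S_a]
    · rw [S_b]; exact neg_mem (Subalgebra.smul_mem _ mb _)
    · rw [S_c]; exact neg_mem (Subalgebra.smul_mem _ mc _)
    · rwa [S_d])
  have : FiniteDimensional k B := FiniteDimensional.of_injective (ι : B →ₗ[k] H) hι
  have hιmem : ∀ x ∈ Algebra.adjoin k X, ∃ z, ι z = x := by
    intro x hx; rw [← hιr] at hx; exact hx
  obtain ⟨a, rfl⟩ := hιmem a ma
  obtain ⟨b, rfl⟩ := hιmem b mb
  obtain ⟨c, rfl⟩ := hιmem c mc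
  obtain ⟨d, rfl⟩ := hιmem d md
  have hι2 : Function.Injective (TensorProduct.map (ι : B →ₗ[k] H) (ι : B →ₗ[k] H)) := by
    exact TensorProduct.map_injective_of_flat_flat _ _ hι hι
  have hΔ : ∀ x y, comul (R := k) (ι x) = TensorProduct.map (ι : B →ₗ[k] H) (ι : B →ₗ[k] H) y →
      comul (R := k) x = y := fun x y e => hι2 ((CoalgHomClass.map_comp_comul_apply ι x).trans e)
  have hε : ∀ x, counit (R := k) x = counit (R := k) (ι x) := fun x =>
    (CoalgHomClass.counit_comp_apply ι x).symm
  have hB : IsQHopf q a b c d :=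
    { q0 := h.q0
      ab := hι (by simpa using h.ab)
      ac := hι (by simpa using h.ac)
      bd := hι (by simpa using h.bd)
      cd := hι (by simpa using h.cd)
      bc := hι (by simpa using h.bc)
      ad := hι (by simpa using h.ad)
      da := hι (by simpa using h.da)
      gen := by
        apply Subalgebra.map_injective (f := (ι : B →ₐ[k] H)) hι
        rw [Algebra.map_top, hιr, AlgHom.map_adjoin]
        simp [Set.image_insert_eq, X]
      comul_a := hΔ _ _ (by simpa using comul_a)
      comul_b := hΔ _ _ (by simpa using comul_b)
      comul_c := hΔ _ _ (by simpa using comul_c)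
      comul_d := hΔ _ _ (by simpa using comul_d)
      S_a := hι (by rw [map_antipode]; simpa using S_a)
      S_b := hι (by rw [map_antipode]; simpa using S_b)
      S_c := hι (by rw [map_antipode]; simpa using S_c)
      S_d := hι (by rw [map_antipode]; simpa using S_d)
      counit_a := by rw [hε, counit_a]
      counit_b := by rw [hε, counit_b]
      counit_c := by rw [hε, counit_c]
      counit_d := by rw [hε, counit_d] }
  have hliB : LinearIndependent k ![a, b, c, d] := by
    apply LinearIndependent.of_comp (ι : B →ₗ[k] H)
    rwa [show (ι : B →ₗ[k] H) ∘ ![a, b, c, d] = ![ι a, ι b, ι c, ι d] from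
      funext fun i => by fin_cases i <;> rfl]
  have hdvd := hB.finrank_dvd_of_injective ι hι
  rw [hdim] at hdvd
  have hcomm : ¬ ∀ x y : B, x * y = y * x := by
    intro hc
    let _ : CommRing B := { ‹Ring B› with mul_comm := hc }
    exact IsQHopf.false_of_comm hB hliB hp hodd hdvd
  have hq : q ^ 2 ≠ 1 := by
    intro hq
    rcases mul_self_eq_one_iff.1 (by rwa [pow_two] at hq) with rfl | rfl
    · apply hcomm
      intro x y
      have hda : a * d = d * a := by rw [hB.ad, hB.da, inv_one]
      have hab := hB.ab
      have hac := hB.ac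
      have hbd := hB.bd
      have hcd := hB.cd
      rw [one_smul] at hab hac hbd hcd
      have hbc := hB.bc
      have := fun x : B => IsQMat.commute_of_gen (f := x) hB.gen
      refine this y ?_ ?_ ?_ ?_ x
      · exact (this a rfl hab.symm hac.symm hda.symm y).symm
      · exact (this b hab rfl hbc.symm hbd.symm y).symm
      · exact (this c hac hbc rfl hcd.symm y).symm
      · exact (this d hda hbd hcd rfl y).symm
    · apply hcomm
      exact hB.commute_of_neg_one ((hodd.pow (n := 3)).of_dvd_nat hdvd)
  have hb0 : b ≠ 0 := hliB.ne_zero 1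
  have hc0 : c ≠ 0 := hliB.ne_zero 2
  obtain ⟨hs, hbn, hcn⟩ := hB.bijective_of_injective hb0 hc0 hq ι hι hp hodd hdim
  refine h.isCopointed ?_ (hbn.map ι) (hcn.map ι)
  change Algebra.adjoin k X = ⊤
  rw [← hιr]
  exact (AlgHom.range_eq_top _).2 hs

end QCase
end HopfClass

end

section

open TensorProduct

namespace HopfClass
open Coalgebra HopfAlgebra Matrix

section FormMat
universe u
variable {k : Type*} [Field k] {H : Type u} [Ring H] [HopfAlgebra k H]

theorem mul_map_algebraMap_comm {A n : Type*} [Ring A] [Algebra k A] [Fintype n]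
    (X : Matrix n n A) (P : Matrix n n k) :
    (X * P.map (algebraMap k A)).trace = (P.map (algebraMap k A) * X).trace := by
  simp only [Matrix.trace, Matrix.diag_apply, Matrix.mul_apply, Matrix.map_apply]
  rw [Finset.sum_comm]
  exact Finset.sum_congr rfl fun i _ => Finset.sum_congr rfl fun j _ =>
    (Algebra.commutes _ _).symm

theorem transpose_mul_map_algebraMap {A n : Type*} [Ring A] [Algebra k A] [Fintype n]
    (X : Matrix n n A) (P : Matrix n n k) :
    (X * P.map (algebraMap k A))ᵀ = Pᵀ.map (algebraMap k A) * Xᵀ := by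
  ext i j
  simp only [Matrix.transpose_apply, Matrix.mul_apply, Matrix.map_apply]
  exact Finset.sum_congr rfl fun j _ => (Algebra.commutes _ _).symm

theorem transpose_map_algebraMap_mul {A n : Type*} [Ring A] [Algebra k A] [Fintype n]
    (X : Matrix n n A) (P : Matrix n n k) :
    (P.map (algebraMap k A) * X)ᵀ = Xᵀ * Pᵀ.map (algebraMap k A) := by
  ext i j
  simp only [Matrix.transpose_apply, Matrix.mul_apply, Matrix.map_apply]
  exact Finset.sum_congr rfl fun j _ => Algebra.commutes _ _

theorem map_algebraMap_map {A B n : Type*} [Ring A] [Algebra k A] [Ring B] [Algebra k B]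
    (f : A →ₐ[k] B) (P : Matrix n n k) :
    (P.map (algebraMap k A)).map f = P.map (algebraMap k B) := by
  ext i j; simp

theorem map_algebraMap_mul_cancel {A n : Type*} [Ring A] [Algebra k A] [Fintype n] [DecidableEq n]
    {P Q : Matrix n n k} (hPQ : P * Q = 1) (X : Matrix n n A) :
    P.map (algebraMap k A) * (Q.map (algebraMap k A) * X) = X := by
  rw [← mul_assoc, ← Matrix.map_mul, hPQ, Matrix.map_one _ (map_zero _) (map_one _), one_mul]

theorem map_map_algebraMap_mul {A B n : Type*} [Ring A] [Algebra k A] [Ring B] [Algebra k B]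
    [Fintype n] (f : A →ₐ[k] B) (Q P : Matrix n n k) (e : Matrix n n A) :
    (Q.map (algebraMap k A) * e * P.map (algebraMap k A)).map f =
      Q.map (algebraMap k B) * e.map f * P.map (algebraMap k B) := by
  rw [Matrix.map_mul, Matrix.map_mul, map_algebraMap_map, map_algebraMap_map]

/-- `e` is a matrix of coefficients of a comodule whose comultiplication is that of a matrix
coalgebra, and `E` is a nondegenerate invariant bilinear form on this comodule. -/
structure IsFormMat (e : Matrix (Fin 2) (Fin 2) H) (E : Matrix (Fin 2) (Fin 2) k) : Prop where
  comul : e.map (Bialgebra.comulAlgHom k H) =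
    e.map (Algebra.TensorProduct.includeLeft : H →ₐ[k] H ⊗[k] H) *
      e.map (Algebra.TensorProduct.includeRight : H →ₐ[k] H ⊗[k] H)
  counit : e.map (Bialgebra.counitAlgHom k H) = 1
  indep : ∀ w : Matrix (Fin 2) (Fin 2) k, (w.map (algebraMap k H) * e).trace = 0 → w = 0
  form : eᵀ * E.map (algebraMap k H) * e = E.map (algebraMap k H)
  det : IsUnit E

namespace IsFormMat
variable {e : Matrix (Fin 2) (Fin 2) H} {E : Matrix (Fin 2) (Fin 2) k}

theorem basisChange (h : IsFormMat e E) {P Q : Matrix (Fin 2) (Fin 2) k} (hPQ : P * Q = 1) :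
    IsFormMat (Q.map (algebraMap k H) * e * P.map (algebraMap k H)) (Pᵀ * E * P) := by
  have hQP : Q * P = 1 := _root_.mul_eq_one_comm.1 hPQ
  constructor
  · rw [map_map_algebraMap_mul, map_map_algebraMap_mul, map_map_algebraMap_mul, h.comul]
    simp only [mul_assoc, map_algebraMap_mul_cancel hPQ]
  · rw [map_map_algebraMap_mul, h.counit]
    simpa using hQP
  · intro w hw
    rw [← mul_assoc, mul_map_algebraMap_comm, ← mul_assoc, ← mul_assoc, ← Matrix.map_mul,
      ← Matrix.map_mul] at hw
    have := h.indep _ hw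
    calc w = Q * (P * w * Q) * P := by
          rw [mul_assoc, mul_assoc, hQP, mul_one, ← mul_assoc, hQP, one_mul]
      _ = 0 := by rw [this]; simp
  · have hPQ' : Qᵀ * Pᵀ = 1 := by rw [← Matrix.transpose_mul, hPQ, Matrix.transpose_one]
    have := congrArg (fun X => Pᵀ.map (algebraMap k H) * X * P.map (algebraMap k H)) h.form
    rw [transpose_mul_map_algebraMap, transpose_map_algebraMap_mul, Matrix.map_mul, Matrix.map_mul]
    simp only [mul_assoc, map_algebraMap_mul_cancel hPQ, map_algebraMap_mul_cancel hPQ'] at this ⊢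
    exact this
  · have hP : IsUnit P := IsUnit.of_mul_eq_one Q hPQ
    exact (((Matrix.isUnit_transpose P).2 hP).mul h.det).mul hP

theorem smul (h : IsFormMat e E) {r : k} (hr : r ≠ 0) : IsFormMat e (r • E) where
  comul := h.comul
  counit := h.counit
  indep := h.indep
  form := by
    have : (r • E).map (algebraMap k H) = r • E.map (algebraMap k H) := by
      ext i j
      rw [Matrix.map_apply, Matrix.smul_apply, Matrix.smul_apply, Matrix.map_apply, smul_eq_mul,
        map_mul, Algebra.smul_def]
    rw [this, mul_smul_comm, smul_mul_assoc, h.form]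
  det := h.det.smul (Units.mk0 r hr)

theorem antipode_eq [FiniteDimensional k H] (h : IsFormMat e E) {E' : Matrix (Fin 2) (Fin 2) k}
    (hE : E' * E = 1) :
    e.map (antipode k) = E'.map (algebraMap k H) * eᵀ * E.map (algebraMap k H) ∧
      e * E'.map (algebraMap k H) * eᵀ = E'.map (algebraMap k H) := by
  have hEE : E * E' = 1 := _root_.mul_eq_one_comm.1 hE
  have c1 : E'.map (algebraMap k H) * E.map (algebraMap k H) = 1 := by
    rw [← Matrix.map_mul, hE, Matrix.map_one _ (map_zero _) (map_one _)]
  have c2 : E.map (algebraMap k H) * E'.map (algebraMap k H) = 1 := by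
    rw [← Matrix.map_mul, hEE, Matrix.map_one _ (map_zero _) (map_one _)]
  have h1 : (E'.map (algebraMap k H) * eᵀ * E.map (algebraMap k H)) * e = 1 := by
    rw [mul_assoc, mul_assoc, ← mul_assoc eᵀ, h.form, c1]
  have h2 : e * e.map (antipode k) = 1 := by
    ext i j
    have hΔ : Coalgebra.comul (R := k) (e i j) = ∑ l, e i l ⊗ₜ[k] e l j := by
      have := congrFun (congrFun h.comul i) j
      simpa [Matrix.mul_apply] using this
    have hε : Coalgebra.counit (R := k) (e i j) = (1 : Matrix (Fin 2) (Fin 2) k) i j :=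
      congrFun (congrFun h.counit i) j
    have := HopfAlgebra.mul_antipode_lTensor_comul_apply (R := k) (e i j)
    rw [hΔ, hε] at this
    simp only [map_sum, LinearMap.lTensor_tmul, LinearMap.mul'_apply] at this
    rw [Matrix.mul_apply]
    refine this.trans ?_
    rw [Matrix.one_apply, Matrix.one_apply]; split_ifs <;> simp
  have h3 := left_inv_eq_right_inv h1 h2
  refine ⟨h3.symm, ?_⟩
  rw [← h3] at h2
  calc e * E'.map (algebraMap k H) * eᵀ =
      e * (E'.map (algebraMap k H) * eᵀ * E.map (algebraMap k H)) * E'.map (algebraMap k H) := by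
        simp only [mul_assoc, c2, mul_one]
    _ = _ := by rw [h2, one_mul]

end IsFormMat
end FormMat
end HopfClass

end

section

open TensorProduct

namespace HopfClass
open Coalgebra HopfAlgebra Matrix

section Key
universe u
variable {k : Type*} [Field k] {H : Type u} [Ring H] [HopfAlgebra k H]

theorem exists_basisChange_apply_zero [IsAlgClosed k] (E : Matrix (Fin 2) (Fin 2) k) :
    ∃ P Q : Matrix (Fin 2) (Fin 2) k, P * Q = 1 ∧ (Pᵀ * E * P) 0 0 = 0 := by
  by_cases h : E 1 1 = 0
  · refine ⟨!![0, 1; 1, 0], !![0, 1; 1, 0], by simp [Matrix.one_fin_two], ?_⟩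
    simp [Matrix.mul_apply, Fin.sum_univ_two, h]
  · obtain ⟨y, hy⟩ : ∃ y, E 0 0 + (E 0 1 + E 1 0) * y + E 1 1 * y ^ 2 = 0 := by
      let f : Polynomial k := Polynomial.C (E 1 1) * Polynomial.X ^ 2 +
        Polynomial.C (E 0 1 + E 1 0) * Polynomial.X + Polynomial.C (E 0 0)
      obtain ⟨y, hy⟩ := IsAlgClosed.exists_root f (by
        rw [Polynomial.degree_quadratic h]; decide)
      refine ⟨y, ?_⟩
      simp only [Polynomial.IsRoot, f, Polynomial.eval_add, Polynomial.eval_mul, Polynomial.eval_C,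
        Polynomial.eval_pow, Polynomial.eval_X] at hy
      rw [← hy]; ring
    refine ⟨!![1, 0; y, 1], !![1, 0; -y, 1], by simp [Matrix.one_fin_two], ?_⟩
    simp [Matrix.mul_apply, Fin.sum_univ_two]
    rw [← hy]; ring

namespace IsFormMat
variable {e : Matrix (Fin 2) (Fin 2) H} {E : Matrix (Fin 2) (Fin 2) k}

theorem comul_apply (h : IsFormMat e E) (i j : Fin 2) :
    Coalgebra.comul (R := k) (e i j) = e i 0 ⊗ₜ[k] e 0 j + e i 1 ⊗ₜ[k] e 1 j := by
  simpa [Matrix.mul_apply] using congrFun (congrFun h.comul i) j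

theorem counit_apply (h : IsFormMat e E) (i j : Fin 2) :
    Coalgebra.counit (R := k) (e i j) = (1 : Matrix (Fin 2) (Fin 2) k) i j :=
  congrFun (congrFun h.counit i) j

theorem linearIndependent (h : IsFormMat e E) :
    LinearIndependent k ![e 0 0, e 0 1, e 1 0, e 1 1] := by
  rw [Fintype.linearIndependent_iff]
  intro g hg
  have := h.indep !![g 0, g 2; g 1, g 3] (by
    simp only [Fin.sum_univ_four, Algebra.smul_def] at hg
    simp [Matrix.trace_fin_two, Matrix.mul_apply, Fin.sum_univ_two]
    rw [← hg]
    simp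
    abel)
  intro i
  fin_cases i
  · exact congrFun (congrFun this 0) 0
  · exact congrFun (congrFun this 1) 0
  · exact congrFun (congrFun this 0) 1
  · exact congrFun (congrFun this 1) 1

theorem isCopointed_of_antidiag [IsAlgClosed k] [CharZero k] [FiniteDimensional k H] {r s : k}
    (hr : r ≠ 0) (hs : s ≠ 0) (h : IsFormMat e !![0, r; s, 0]) {p : ℕ} (hp : p.Prime)
    (hodd : Odd p) (hdim : Module.finrank k H = p ^ 3) : IsCopointed k H := by
  obtain ⟨h1, h2⟩ := h.antipode_eq (E' := !![0, s⁻¹; r⁻¹, 0])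
    (by simp [Matrix.one_fin_two, hr, hs])
  have h3 := h.form
  rw [← Matrix.ext_iff] at h1 h2 h3
  simp only [Fin.forall_fin_two, Matrix.map_apply, Matrix.mul_apply, Fin.sum_univ_two,
    Matrix.transpose_apply, Matrix.of_apply, Matrix.cons_val_zero, Matrix.cons_val_one,
    Matrix.cons_val', Matrix.cons_val_fin_one, zero_add, add_zero, Algebra.algebraMap_eq_smul_one,
      mul_smul_comm, smul_mul_assoc,
    mul_one, one_mul, zero_smul] at h1 h2 h3
  have hq : -s / r ≠ 0 := div_ne_zero (neg_ne_zero.2 hs) hr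
  refine IsQMat.isCopointed_of_finrank (q := -s / r) (a := e 0 0) (b := e 0 1) (c := e 1 0)
    (d := e 1 1) ⟨hq, ?_, ?_, ?_, ?_, ?_, ?_, ?_⟩ (h.comul_apply 0 0) (h.comul_apply 0 1)
    (h.comul_apply 1 0) (h.comul_apply 1 1) ?_ ?_ ?_ ?_ (h.counit_apply 0 0) (h.counit_apply 0 1)
    (h.counit_apply 1 0) (h.counit_apply 1 1) h.linearIndependent hp hodd hdim
  · linear_combination (norm := (match_scalars <;> field_simp <;> ring)) s • h2.1.1
  · linear_combination (norm := (match_scalars <;> field_simp <;> ring)) r⁻¹ • h3.1.1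
  · linear_combination (norm := (match_scalars <;> field_simp <;> ring)) r⁻¹ • h3.2.2
  · linear_combination (norm := (match_scalars <;> field_simp <;> ring)) s • h2.2.2
  · linear_combination (norm := (match_scalars <;> field_simp <;> ring))
      r • h2.1.2 - s⁻¹ • h3.1.2
  · linear_combination (norm := (match_scalars <;> field_simp <;> ring)) s • h2.1.2
  · linear_combination (norm := (match_scalars <;> field_simp <;> ring)) s⁻¹ • h3.2.1
  · rw [h1.1.1, smul_inv_smul₀ hs]
  · rw [h1.1.2]; match_scalars; field_simp
  · rw [h1.2.1]; match_scalars; field_simp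
  · rw [h1.2.2, smul_inv_smul₀ hr]

theorem false_of_jordan [CharZero k] [FiniteDimensional k H] {t : k} (ht : t ≠ 0)
    (h : IsFormMat e !![0, 1; -1, t]) : False := by
  obtain ⟨-, h2⟩ := h.antipode_eq (E' := !![t, -1; 1, 0]) (by simp [Matrix.one_fin_two])
  have h3 := h.form
  rw [← Matrix.ext_iff] at h2 h3
  simp only [Fin.forall_fin_two, Matrix.map_apply, Matrix.mul_apply, Fin.sum_univ_two,
    Matrix.transpose_apply, Matrix.of_apply, Matrix.cons_val_zero, Matrix.cons_val_one,
    Matrix.cons_val', Matrix.cons_val_fin_one, add_zero, Algebra.algebraMap_eq_smul_one,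
    mul_smul_comm, smul_mul_assoc, mul_one, zero_smul, one_smul, neg_smul,
    add_mul, zero_add] at h2 h3
  refine h.linearIndependent.ne_zero 2 (eq_zero_of_jordan (a := e 0 0) (b := e 0 1) (c := e 1 0)
    (d := e 1 1) ht (h.comul_apply 1 0) ?_ ?_ ?_ ?_)
  · linear_combination (norm := module) h3.1.1
  · linear_combination (norm := module) h2.2.2
  · linear_combination (norm := module) h3.1.2
  · linear_combination (norm := module) h2.2.1

theorem isCopointed [IsAlgClosed k] [CharZero k] [FiniteDimensional k H]
    (h : IsFormMat e E) {p : ℕ} (hp : p.Prime)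
    (hodd : Odd p) (hdim : Module.finrank k H = p ^ 3) : IsCopointed k H := by
  obtain ⟨P, Q, hPQ, hE⟩ := exists_basisChange_apply_zero E
  replace h := h.basisChange hPQ
  generalize Q.map (algebraMap k H) * e * P.map (algebraMap k H) = e' at h
  generalize Pᵀ * E * P = E' at h hE
  have hdet := (Matrix.isUnit_iff_isUnit_det _).1 h.det
  rw [Matrix.det_fin_two, hE, zero_mul, zero_sub, isUnit_iff_ne_zero, neg_ne_zero, mul_ne_zero_iff]
    at hdet
  obtain ⟨hr, hs⟩ := hdet
  have hE' : E' = !![0, E' 0 1; E' 1 0, E' 1 1] := by rw [← hE]; exact Matrix.eta_fin_two E'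
  generalize E' 0 1 = r at *
  generalize E' 1 0 = s at *
  generalize E' 1 1 = t at *
  subst hE'
  by_cases hrs : r + s = 0
  · by_cases ht : t = 0
    · subst ht; exact h.isCopointed_of_antidiag hr hs hp hodd hdim
    · refine (false_of_jordan (t := r⁻¹ * t) (e := e') (mul_ne_zero (inv_ne_zero hr) ht) ?_).elim
      convert h.smul (inv_ne_zero hr) using 1
      have : s = -r := by linear_combination hrs
      simp [hr, this]
  · have := h.basisChange (P := !![1, -t / (r + s); 0, 1]) (Q := !![1, t / (r + s); 0, 1])
      (by simp [Matrix.one_fin_two]; ring)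
    rw [show !![1, -t / (r + s); 0, 1]ᵀ * !![0, r; s, t] * !![1, -t / (r + s); 0, 1] =
      !![0, r; s, 0] by
        ext i j; fin_cases i <;> fin_cases j <;>
          simp [Matrix.mul_apply, Fin.sum_univ_two]; field_simp; ring] at this
    exact this.isCopointed_of_antidiag hr hs hp hodd hdim

end IsFormMat
end Key
end HopfClass

end

section

open TensorProduct Coalgebra HopfAlgebra Matrix WithConv

namespace HopfClass

universe u

variable {k : Type*} [Field k]

section Coalgebra

variable {C : Type u} [AddCommGroup C] [Module k C] [Coalgebra k C]

/-- The convolution algebra of linear functionals on a coalgebra. -/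
abbrev ConvDual (k : Type*) [Field k] (C : Type u) [AddCommGroup C] [Module k C] [Coalgebra k C] :=
  WithConv (C →ₗ[k] k)

/-- A square matrix of coalgebra elements which comultiplies like matrix coefficients. -/
structure IsComatrix (k : Type*) [Field k] {C : Type u} [AddCommGroup C] [Module k C]
    [Coalgebra k C] {n : Type*} [Fintype n] [DecidableEq n] (e : Matrix n n C) : Prop where
  comul_apply : ∀ i j, comul (R := k) (e i j) = ∑ l, e i l ⊗ₜ[k] e l j
  counit_apply : ∀ i j, counit (R := k) (e i j) = if i = j then (1 : k) else 0

/-- An element of `M ⊗ N` is determined by the values of products of functionals on it. -/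
theorem tensor_ext_of_forall_dual {M N : Type*} [AddCommGroup M] [Module k M]
    [FiniteDimensional k M]
    [AddCommGroup N] [Module k N] [FiniteDimensional k N] {s t : M ⊗[k] N}
    (h : ∀ (f : M →ₗ[k] k) (g : N →ₗ[k] k),
      LinearMap.mul' k k (TensorProduct.map f g s) = LinearMap.mul' k k (TensorProduct.map f g t)) :
    s = t := by
  rw [← sub_eq_zero, ← Module.forall_dual_apply_eq_zero_iff k]
  intro φ
  obtain ⟨w, rfl⟩ := (TensorProduct.dualDistribEquiv k M N).surjective φ
  induction w with
  | zero => simp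
  | add a b ha hb => rw [map_add, LinearMap.add_apply, ha, hb, add_zero]
  | tmul f g =>
    have key : ∀ t : M ⊗[k] N, TensorProduct.dualDistribEquiv k M N (f ⊗ₜ g) t =
        LinearMap.mul' k k (TensorProduct.map f g t) := by
      intro t
      induction t with
      | zero => simp
      | add a b ha hb => simp only [map_add, ha, hb]
      | tmul x y => rfl
    rw [map_sub, key, key, h, sub_self]

namespace IsComatrix

variable {n : Type*} [Fintype n] [DecidableEq n] {e : Matrix n n C}

/-- The representation of the convolution algebra on matrices given by a comatrix. -/
noncomputable def rep (he : IsComatrix k e) : ConvDual k C →ₐ[k] Matrix n n k :=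
  AlgHom.ofLinearMap
    { toFun := fun f => Matrix.of fun i j => f.ofConv (e i j)
      map_add' := fun _ _ => rfl
      map_smul' := fun _ _ => rfl }
    (by
      ext i j
      change counit (R := k) (e i j) = _
      rw [he.counit_apply, Matrix.one_apply])
    (by
      intro f g
      ext i j
      change LinearMap.mul' k k (TensorProduct.map f.ofConv g.ofConv (comul (e i j))) =
        ∑ l, f.ofConv (e i l) * g.ofConv (e l j)
      simp [he.comul_apply])

theorem rep_apply (he : IsComatrix k e) (f : ConvDual k C) (i j : n) :
    he.rep f i j = f.ofConv (e i j) := rfl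

end IsComatrix

theorem exists_comatrix [FiniteDimensional k C] {n : Type*} [Fintype n] [DecidableEq n]
    (ρ : ConvDual k C →ₐ[k] Matrix n n k) :
    ∃ (e : Matrix n n C) (he : IsComatrix k e), he.rep = ρ := by
  let φ : n → n → Module.Dual k (Module.Dual k C) := fun i j =>
    { toFun := fun f => ρ (toConv f) i j
      map_add' := fun f g => by rw [toConv_add, map_add]; rfl
      map_smul' := fun r f => by rw [toConv_smul, map_smul]; rfl }
  let e : Matrix n n C := Matrix.of fun i j => (Module.evalEquiv k C).symm (φ i j)
  have hv : ∀ (f : C →ₗ[k] k) i j, f (e i j) = ρ (toConv f) i j := fun f i j =>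
    Module.apply_evalEquiv_symm_apply k C f (φ i j)
  have he : IsComatrix k e := by
    refine ⟨fun i j => tensor_ext_of_forall_dual fun f g => ?_, fun i j => ?_⟩
    · have h := hv (toConv f * toConv g : ConvDual k C).ofConv i j
      rw [toConv_ofConv, map_mul, Matrix.mul_apply] at h
      simp only [← hv] at h
      simpa [LinearMap.convMul_def] using h
    · have h := hv (1 : ConvDual k C).ofConv i j
      rw [toConv_ofConv, map_one, Matrix.one_apply] at h
      simpa [LinearMap.convOne_def] using h
  refine ⟨e, he, ?_⟩
  ext f i j
  exact hv f.ofConv i j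

/-- Functionals vanishing on a subcoalgebra form a right ideal. -/
theorem mul_apply_eq_zero_left {D : Submodule k C} (hD : IsSubcoalgWrt k (comulL k C) D)
    {f : ConvDual k C} (hf : ∀ x ∈ D, f.ofConv x = 0) (g : ConvDual k C) :
    ∀ x ∈ D, (f * g).ofConv x = 0 := by
  intro x hx
  obtain ⟨t, ht⟩ := hD x hx
  change LinearMap.mul' k k (TensorProduct.map f.ofConv g.ofConv (comulL k C x)) = 0
  rw [← ht]
  clear ht
  induction t with
  | zero => simp
  | add a b ha hb =>
    simp only [map_add, ha, hb, add_zero]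
  | tmul a b => simp [hf a a.2]

/-- Functionals vanishing on a subcoalgebra form a left ideal. -/
theorem mul_apply_eq_zero_right {D : Submodule k C} (hD : IsSubcoalgWrt k (comulL k C) D)
    {f : ConvDual k C} (hf : ∀ x ∈ D, f.ofConv x = 0) (g : ConvDual k C) :
    ∀ x ∈ D, (g * f).ofConv x = 0 := by
  intro x hx
  obtain ⟨t, ht⟩ := hD x hx
  change LinearMap.mul' k k (TensorProduct.map g.ofConv f.ofConv (comulL k C x)) = 0
  rw [← ht]
  clear ht
  induction t with
  | zero => simp
  | add a b ha hb =>
    simp only [map_add, ha, hb, add_zero]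
  | tmul a b => simp [hf b b.2]

end Coalgebra

end HopfClass

end

section

open TensorProduct Coalgebra HopfAlgebra Matrix WithConv

namespace HopfClass

universe u

variable {k : Type*} [Field k]

section Algebra

variable {R : Type*} [Ring R] [Algebra k R] {n : Type*} [Fintype n] [DecidableEq n]

/-- A two-sided ideal not contained in the kernel of a surjection onto a matrix algebra
contains a preimage of `1`. -/
theorem exists_mem_map_eq_one {ρ : R →ₐ[k] Matrix n n k} (hρ : Function.Surjective ρ) {J : Ideal R}
    (hJ : ∀ f ∈ J, ∀ g, f * g ∈ J) {f : R} (hf : f ∈ J) (hf0 : ρ f ≠ 0) : ∃ g ∈ J, ρ g = 1 := by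
  obtain ⟨a, b, hab⟩ : ∃ a b, ρ f a b ≠ 0 := by
    by_contra! h
    exact hf0 (by ext i j; exact h i j)
  choose l hl using fun i => hρ (Matrix.single i a (ρ f a b)⁻¹)
  choose r hr using fun i => hρ (Matrix.single b i (1 : k))
  refine ⟨∑ i, l i * f * r i, Ideal.sum_mem _ fun i _ => hJ _ (Ideal.mul_mem_left _ _ hf) _, ?_⟩
  rw [map_sum]
  simp only [map_mul, hl, hr]
  simp only [Matrix.single_mul_mul_single, mul_one, inv_mul_cancel₀ hab]
  ext i j
  rw [Matrix.sum_apply]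
  simp only [Matrix.single_apply, Matrix.one_apply]
  by_cases hij : i = j
  · subst hij; simp
  · simp only [hij, if_false]
    exact Finset.sum_eq_zero fun c _ => if_neg fun h => hij (h.1.symm.trans h.2)

/-- Primeness of the kernel of a surjection onto a matrix algebra. -/
theorem exists_ker_le_ker {ι : Type*} {B : ι → Type*} [∀ i, Ring (B i)] [∀ i, Algebra k (B i)]
    [Nonempty n] {ρ : R →ₐ[k] Matrix n n k} (hρ : Function.Surjective ρ)
    (φ : ∀ i, R →ₐ[k] B i) (s : Finset ι) (h : ∀ f, (∀ i ∈ s, φ i f = 0) → ρ f = 0) :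
    ∃ i ∈ s, ∀ f, φ i f = 0 → ρ f = 0 := by
  by_contra! hc
  suffices ∃ f, ρ f = 1 ∧ ∀ i ∈ s, φ i f = 0 by
    obtain ⟨f, hf, hf'⟩ := this
    exact one_ne_zero (hf.symm.trans (h f hf'))
  clear h
  classical
  induction s using Finset.induction with
  | empty => exact ⟨1, map_one ρ, by simp⟩
  | insert i s hi ih =>
    obtain ⟨f, hf, hfs⟩ := ih fun j hj => hc j (Finset.mem_insert_of_mem hj)
    obtain ⟨g, hg, hg0⟩ := hc i (Finset.mem_insert_self _ _)
    obtain ⟨g', hg', hg1⟩ := exists_mem_map_eq_one hρ (J := RingHom.ker (φ i).toRingHom)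
      (fun f hf g => by
        rw [RingHom.mem_ker] at hf ⊢
        rw [map_mul, hf, zero_mul]) (f := g) hg hg0
    refine ⟨f * g', by rw [map_mul, hf, hg1, one_mul], fun j hj => ?_⟩
    rcases Finset.mem_insert.1 hj with rfl | hj
    · have : φ j g' = 0 := hg'
      rw [map_mul, this, mul_zero]
    · rw [map_mul, hfs j hj, zero_mul]

/-- Skolem–Noether for representations of the same dimension with comparable kernels. -/
theorem exists_intertwiner {ρ ρ' : R →ₐ[k] Matrix n n k} (hρ : Function.Surjective ρ)
    (h : ∀ f, ρ f = 0 → ρ' f = 0) [Nonempty n] :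
    ∃ P : Matrix n n k, IsUnit P ∧ ∀ f, ρ' f * P = P * ρ f := by
  obtain ⟨o⟩ := ‹Nonempty n›
  choose c hc using fun i => hρ (Matrix.single i o (1 : k))
  choose r hr using fun i => hρ (Matrix.single o i (1 : k))
  have hker : ∀ f g, ρ f = ρ g → ρ' f = ρ' g := fun f g hfg => by
    rw [← sub_eq_zero, ← map_sub]
    exact h _ (by rw [map_sub, hfg, sub_self])
  have hsum : ∑ i, ρ (c i * c o * r i) = 1 := by
    simp only [map_mul, hc, hr]
    simp only [Matrix.single_mul_single_same, mul_one]
    ext i j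
    rw [Matrix.sum_apply]
    simp only [Matrix.single_apply, Matrix.one_apply]
    by_cases hij : i = j
    · subst hij; simp
    · simp only [hij, if_false]
      exact Finset.sum_eq_zero fun c _ => if_neg fun h => hij (h.1.symm.trans h.2)
  have hsum' : ∑ i, ρ' (c i * c o * r i) = 1 := by
    rw [← map_sum, ← map_one ρ']
    exact hker _ _ (by rw [map_sum, hsum, map_one])
  have hco : ρ' (c o) ≠ 0 := by
    intro h0
    simp only [map_mul, h0, mul_zero, zero_mul, Finset.sum_const_zero] at hsum'
    exact one_ne_zero hsum'.symm
  obtain ⟨v, hv⟩ : ∃ v, ρ' (c o) *ᵥ v ≠ 0 := by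
    by_contra! hv
    exact hco (Matrix.ext_of_mulVec_single fun i => by rw [hv, Matrix.zero_mulVec])
  let P : Matrix n n k := Matrix.of fun i j => (ρ' (c j) *ᵥ v) i
  have hP : ∀ w, P *ᵥ w = ρ' (∑ j, w j • c j) *ᵥ v := by
    intro w
    ext i
    rw [map_sum, Matrix.sum_mulVec, Finset.sum_apply]
    simp [P, Matrix.mulVec, dotProduct, map_smul, Finset.mul_sum, mul_comm, mul_left_comm]
  have hcomm : ∀ f, ρ' f * P = P * ρ f := by
    intro f
    refine Matrix.ext_of_mulVec_single fun j => ?_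
    rw [← Matrix.mulVec_mulVec, ← Matrix.mulVec_mulVec, hP, hP, Matrix.mulVec_mulVec, ← map_mul,
      Matrix.mulVec_single_one]
    congr 1
    refine hker _ _ ?_
    rw [map_mul, map_sum, map_sum]
    simp only [map_smul, hc]
    ext a b
    simp only [Matrix.mul_apply, Matrix.sum_apply, Matrix.smul_apply, Matrix.single_apply,
      Matrix.col_apply, smul_eq_mul]
    by_cases hb : o = b
    · subst hb
      simp only [and_true, mul_ite, mul_one, mul_zero, Finset.sum_ite_eq', Finset.mem_univ, if_true]
      rw [Finset.sum_eq_single j (fun x _ hx => by rw [Pi.single_eq_of_ne hx, mul_zero]) (by simp),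
        Pi.single_eq_same, mul_one]
    · simp [hb]
  refine ⟨P, ?_, hcomm⟩
  rw [← Matrix.mulVec_injective_iff_isUnit]
  refine (injective_iff_map_eq_zero (Matrix.mulVecLin P)).2 fun w hw => ?_
  by_contra hw0
  obtain ⟨a, ha⟩ : ∃ a, w a ≠ 0 := by
    by_contra! h
    exact hw0 (funext h)
  obtain ⟨f, hf⟩ := hρ (Matrix.single o a (1 : k))
  have h1 : P *ᵥ (ρ f *ᵥ w) = 0 := by
    rw [Matrix.mulVec_mulVec, ← hcomm, ← Matrix.mulVec_mulVec]
    rw [Matrix.mulVecLin_apply] at hw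
    rw [hw, Matrix.mulVec_zero]
  rw [hf, hP] at h1
  have h2 : ∑ j, (Matrix.single o a (1 : k) *ᵥ w) j • c j = w a • c o := by
    rw [Finset.sum_eq_single o]
    · simp [Matrix.mulVec, dotProduct, Matrix.single_apply]
    · intro j _ hj
      simp [Matrix.mulVec, dotProduct, Ne.symm hj]
    · simp
  rw [h2, map_smul, Matrix.smul_mulVec] at h1
  exact (smul_ne_zero ha hv) h1

theorem finrank_range_le_of_ker_le [FiniteDimensional k R] {V W : Type*} [AddCommGroup V]
    [Module k V]
    [AddCommGroup W] [Module k W] {φ : R →ₗ[k] V} {ρ : R →ₗ[k] W} (hρ : Function.Surjective ρ)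
    [FiniteDimensional k V]
    (h : ∀ f, φ f = 0 → ρ f = 0) : Module.finrank k W ≤ Module.finrank k V := by
  have h1 := φ.finrank_range_add_finrank_ker
  have h2 := ρ.finrank_range_add_finrank_ker
  have h3 : Module.finrank k (LinearMap.ker φ) ≤ Module.finrank k (LinearMap.ker ρ) :=
    Submodule.finrank_mono h
  have h4 := Submodule.finrank_le (LinearMap.range φ)
  rw [LinearMap.range_eq_top.2 hρ, finrank_top] at h2
  omega

theorem simple_toMatrix_surjective [IsAlgClosed k] {M : Type*} [AddCommGroup M] [Module k M]
    [Module R M] [IsScalarTower k R M] [IsSimpleModule R M] [FiniteDimensional k M]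
    (b : Module.Basis n k M) :
    Function.Surjective
      ((LinearMap.toMatrixAlgEquiv b).toAlgHom.comp (Algebra.lsmul k k M : R →ₐ[k] Module.End k M)) := by
  intro X
  classical
  have hbij := IsSimpleModule.algebraMap_end_bijective_of_isAlgClosed (A := R) (V := M) k
  let T : Module.End k M := (LinearMap.toMatrixAlgEquiv b).symm X
  let T' : Module.End (Module.End R M) M :=
    { toFun := T
      map_add' := T.map_add
      map_smul' := fun φ m => by
        obtain ⟨c, rfl⟩ := hbij.2 φ
        simp }
  obtain ⟨r, hr⟩ := jacobson_density T' (Finset.univ.image b)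
  refine ⟨r, ?_⟩
  have : (Algebra.lsmul k k M : R →ₐ[k] Module.End k M) r = T := by
    refine b.ext fun i => ?_
    exact (hr (b i) (Finset.mem_image_of_mem _ (Finset.mem_univ i))).symm
  change LinearMap.toMatrixAlgEquiv b ((Algebra.lsmul k k M : R →ₐ[k] Module.End k M) r) = X
  rw [this, AlgEquiv.apply_symm_apply]

end Algebra

end HopfClass

end

section

open TensorProduct Coalgebra HopfAlgebra Matrix WithConv

namespace HopfClass

universe u

variable {k : Type*} [Field k]

section Algebra

theorem exists_rep_of_simple [IsAlgClosed k] {R : Type*} [Ring R] [Algebra k R] (M : Type*)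
    [AddCommGroup M] [Module k M] [Module R M] [IsScalarTower k R M] [IsSimpleModule R M]
    [FiniteDimensional k M] :
    ∃ (n : ℕ) (_ : n ≠ 0) (ρ : R →ₐ[k] Matrix (Fin n) (Fin n) k),
      Function.Surjective ρ ∧ ∀ f, (∀ m : M, f • m = 0) → ρ f = 0 := by
  have : Nontrivial M := IsSimpleModule.nontrivial R _
  refine ⟨Module.finrank k M, Module.finrank_pos.ne', _,
    simple_toMatrix_surjective (R := R) (Module.finBasis k M), fun f hf => ?_⟩
  have h0 : (Algebra.lsmul k k M : R →ₐ[k] Module.End k M) f = 0 := LinearMap.ext hf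
  change LinearMap.toMatrixAlgEquiv _ ((Algebra.lsmul k k M : R →ₐ[k] Module.End k M) f) = 0
  rw [h0, map_zero]

/-- Over an algebraically closed field, a proper left ideal of an algebra is
annihilated by some irreducible matrix representation, if it is two-sided. -/
theorem exists_rep_of_ideal [IsAlgClosed k] {R : Type*} [Ring R] [Algebra k R]
    [FiniteDimensional k R] {J : Ideal R}
    (hJ : ∀ f ∈ J, ∀ g, f * g ∈ J) (hJ1 : J ≠ ⊤) :
    ∃ (n : ℕ) (_ : n ≠ 0) (ρ : R →ₐ[k] Matrix (Fin n) (Fin n) k),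
      Function.Surjective ρ ∧ ∀ f ∈ J, ρ f = 0 := by
  obtain ⟨L, hL, hJL⟩ := Ideal.exists_le_maximal J hJ1
  have : IsSimpleModule R (R ⧸ L) := isSimpleModule_iff_isCoatom.2 hL.out
  have : FiniteDimensional k (R ⧸ L) :=
    FiniteDimensional.of_surjective ((Submodule.mkQ L).restrictScalars k) (Submodule.mkQ_surjective L)
  obtain ⟨n, hn, ρ, hρ, h⟩ := exists_rep_of_simple (k := k) (R := R) (R ⧸ L)
  refine ⟨n, hn, ρ, hρ, fun f hf => h f fun m => ?_⟩
  obtain ⟨r, rfl⟩ := Submodule.mkQ_surjective L m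
  change f • Submodule.Quotient.mk r = 0
  rw [← Submodule.Quotient.mk_smul, Submodule.Quotient.mk_eq_zero]
  exact hJL (hJ f hf r)

end Algebra

section Coalgebra

variable {C : Type u} [AddCommGroup C] [Module k C] [Coalgebra k C]

theorem eq_zero_of_forall_conv {x : C} (h : ∀ f : ConvDual k C, f.ofConv x = 0) : x = 0 :=
  (Module.forall_dual_apply_eq_zero_iff k x).1 fun f => h (toConv f)

theorem exists_conv_ne_zero {D : Submodule k C} {x : C} (hx : x ∉ D) :
    ∃ f : ConvDual k C, f.ofConv x ≠ 0 ∧ ∀ y ∈ D, f.ofConv y = 0 := by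
  obtain ⟨f, hf, hf'⟩ := Submodule.exists_le_ker_of_notMem hx
  exact ⟨toConv f, hf, fun y hy => hf' hy⟩

/-- The left ideal of functionals vanishing on a subcoalgebra. -/
noncomputable def annihIdeal (D : Submodule k C) (hD : IsSubcoalgWrt k (comulL k C) D) :
    Ideal (ConvDual k C) where
  carrier := {f | ∀ x ∈ D, f.ofConv x = 0}
  zero_mem' := fun _ _ => rfl
  add_mem' := fun {f g} hf hg x hx => by
    rw [ofConv_add, LinearMap.add_apply, hf x hx, hg x hx, add_zero]
  smul_mem' := fun g _ hf => mul_apply_eq_zero_right hD hf g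

theorem mem_annihIdeal {D : Submodule k C} {hD : IsSubcoalgWrt k (comulL k C) D}
    {f : ConvDual k C} : f ∈ annihIdeal D hD ↔ ∀ x ∈ D, f.ofConv x = 0 := Iff.rfl

namespace IsComatrix

variable {n : Type*} [Fintype n] [DecidableEq n] {e : Matrix n n C}

theorem rep_eq_zero_iff (he : IsComatrix k e) (f : ConvDual k C) :
    he.rep f = 0 ↔ ∀ x ∈ Submodule.span k (Set.range fun p : n × n => e p.1 p.2),
      f.ofConv x = 0 := by
  constructor
  · intro h x hx
    have : Submodule.span k (Set.range fun p : n × n => e p.1 p.2) ≤ LinearMap.ker f.ofConv := by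
      rw [Submodule.span_le]
      rintro _ ⟨p, rfl⟩
      exact congr_fun (congr_fun h p.1) p.2
    exact this hx
  · intro h
    ext i j
    exact h _ (Submodule.subset_span ⟨(i, j), rfl⟩)

theorem rep_surjective (he : IsComatrix k e)
    (hli : LinearIndependent k (fun p : n × n => e p.1 p.2)) : Function.Surjective he.rep := by
  intro X
  obtain ⟨f, hf⟩ := LinearMap.exists_extend
    ((Module.Basis.span hli).constr k fun p : n × n => X p.1 p.2)
  refine ⟨toConv f, ?_⟩
  ext i j
  have h := LinearMap.congr_fun hf (Module.Basis.span hli (i, j))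
  rw [Module.Basis.constr_basis, LinearMap.comp_apply, Submodule.subtype_apply,
    Module.Basis.span_apply] at h
  exact h

theorem linearIndependent (he : IsComatrix k e) (hs : Function.Surjective he.rep) :
    LinearIndependent k (fun p : n × n => e p.1 p.2) := by
  rw [Fintype.linearIndependent_iff]
  intro w hw p
  obtain ⟨f, hf⟩ := hs (Matrix.single p.1 p.2 (1 : k))
  have h := congrArg f.ofConv hw
  simp only [map_sum, map_smul, map_zero, ← he.rep_apply, hf, Matrix.single_apply, smul_eq_mul] at h
  rwa [Finset.sum_eq_single p (fun q _ hq => by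
    rw [if_neg fun h => hq (Prod.ext h.1 h.2).symm, mul_zero]) (by simp), if_pos ⟨rfl, rfl⟩,
    mul_one] at h

theorem isSubcoalgWrt_span (he : IsComatrix k e) : IsSubcoalgWrt k (comulL k C)
    (Submodule.span k (Set.range fun p : n × n => e p.1 p.2)) := by
  set D := Submodule.span k (Set.range fun p : n × n => e p.1 p.2) with hD
  have hm : ∀ i j, e i j ∈ D := fun i j => Submodule.subset_span ⟨(i, j), rfl⟩
  have : D ≤ (LinearMap.range (TensorProduct.map D.subtype D.subtype)).comap (comulL k C) := by
    rw [hD, Submodule.span_le]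
    rintro _ ⟨⟨i, j⟩, rfl⟩
    refine ⟨∑ l, (⟨e i l, hm i l⟩ : D) ⊗ₜ (⟨e l j, hm l j⟩ : D), ?_⟩
    rw [map_sum]
    exact (he.comul_apply i j).symm
  exact this

theorem isSimpleSubcoalgWrt_span [Nonempty n] (he : IsComatrix k e)
    (hs : Function.Surjective he.rep) : IsSimpleSubcoalgWrt k (comulL k C)
    (Submodule.span k (Set.range fun p : n × n => e p.1 p.2)) := by
  refine ⟨he.isSubcoalgWrt_span, ?_, fun D hD hlt => ?_⟩
  · intro h
    have h1 : he.rep 1 = 0 := (he.rep_eq_zero_iff 1).2 fun x hx => by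
      rw [h, Submodule.mem_bot] at hx
      rw [hx, map_zero]
    rw [map_one] at h1
    exact one_ne_zero h1
  · obtain ⟨x, hx, hxD⟩ := SetLike.exists_of_lt hlt
    obtain ⟨f, hfx, hfD⟩ := exists_conv_ne_zero (k := k) hxD
    obtain ⟨g, hgD, hg⟩ := exists_mem_map_eq_one hs (J := annihIdeal D hD)
      (fun f hf g => mul_apply_eq_zero_left hD hf g) (f := f) hfD
      (fun h0 => hfx ((he.rep_eq_zero_iff f).1 h0 x hx))
    rw [eq_bot_iff]
    intro y hy
    refine eq_zero_of_forall_conv (k := k) fun f' => ?_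
    have h1 : he.rep (g * f' - f') = 0 := by rw [map_sub, map_mul, hg, one_mul, sub_self]
    have h2 := (he.rep_eq_zero_iff _).1 h1 y (hlt.le hy)
    rwa [ofConv_sub, LinearMap.sub_apply, mul_apply_eq_zero_left hD hgD f' y hy, zero_sub,
      neg_eq_zero] at h2

end IsComatrix

theorem IsMultMatrix.isComatrix {n : ℕ} {D : Submodule k C} {e : Fin n → Fin n → C}
    (h : IsMultMatrix k C n D e) : IsComatrix k (Matrix.of e) where
  comul_apply := h.2.2.1
  counit_apply := h.2.2.2

/-- A simple subcoalgebra over an algebraically closed field is spanned by a comatrix. -/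
theorem IsSimpleSubcoalgWrt.exists_comatrix [IsAlgClosed k] [FiniteDimensional k C]
    {D : Submodule k C} (hD : IsSimpleSubcoalgWrt k (comulL k C) D) :
    ∃ (n : ℕ) (_ : n ≠ 0) (e : Matrix (Fin n) (Fin n) C) (he : IsComatrix k e),
      Function.Surjective he.rep ∧
        D = Submodule.span k (Set.range fun p : Fin n × Fin n => e p.1 p.2) := by
  obtain ⟨hsub, hne, hmin⟩ := hD
  have : FiniteDimensional k (ConvDual k C) :=
    (WithConv.linearEquiv k (C →ₗ[k] k)).symm.finiteDimensional
  obtain ⟨n, hn, ρ, hρ, hker⟩ := exists_rep_of_ideal (k := k) (J := annihIdeal D hsub)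
    (fun f hf g => mul_apply_eq_zero_left hsub hf g) (fun h => hne (by
      rw [eq_bot_iff]
      intro x hx
      refine eq_zero_of_forall_conv (k := k) fun f => ?_
      exact mem_annihIdeal.1 (h ▸ Submodule.mem_top : f ∈ annihIdeal D hsub) x hx))
  obtain ⟨e, he, rfl⟩ := HopfClass.exists_comatrix ρ
  refine ⟨n, hn, e, he, hρ, ?_⟩
  have : Nonempty (Fin n) := Fin.pos_iff_nonempty.1 (Nat.pos_of_ne_zero hn)
  have hle : Submodule.span k (Set.range fun p : Fin n × Fin n => e p.1 p.2) ≤ D := by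
    intro x hx
    by_contra hxD
    obtain ⟨f, hfx, hfD⟩ := exists_conv_ne_zero (k := k) hxD
    exact hfx ((he.rep_eq_zero_iff f).1 (hker f hfD) x hx)
  by_contra hneq
  exact (he.isSimpleSubcoalgWrt_span hρ).2.1
    (hmin _ he.isSubcoalgWrt_span (lt_of_le_of_ne hle (Ne.symm hneq)))

end Coalgebra

end HopfClass

end

section

open TensorProduct Coalgebra HopfAlgebra Matrix WithConv

namespace HopfClass

universe u

variable {k : Type*} [Field k]

section Hopf

variable {H : Type u} [Ring H] [HopfAlgebra k H]

namespace IsComatrix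

variable {n : Type*} [Fintype n] [DecidableEq n] {e : Matrix n n H}

theorem mul_map_antipode (he : IsComatrix k e) : e * e.map (antipode k) = 1 := by
  ext i j
  have := HopfAlgebra.mul_antipode_lTensor_comul_apply (R := k) (e i j)
  rw [he.comul_apply, he.counit_apply] at this
  simp only [map_sum, LinearMap.lTensor_tmul, LinearMap.mul'_apply] at this
  rw [Matrix.mul_apply]
  refine this.trans ?_
  rw [Matrix.one_apply]; split_ifs <;> simp

theorem map_antipode_mul (he : IsComatrix k e) : e.map (antipode k) * e = 1 := by
  ext i j
  have := HopfAlgebra.mul_antipode_rTensor_comul_apply (R := k) (e i j)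
  rw [he.comul_apply, he.counit_apply] at this
  simp only [map_sum, LinearMap.rTensor_tmul, LinearMap.mul'_apply] at this
  rw [Matrix.mul_apply]
  refine this.trans ?_
  rw [Matrix.one_apply]; split_ifs <;> simp

theorem map_comul (he : IsComatrix k e) : e.map (Bialgebra.comulAlgHom k H) =
    e.map (Algebra.TensorProduct.includeLeft : H →ₐ[k] H ⊗[k] H) *
      e.map (Algebra.TensorProduct.includeRight : H →ₐ[k] H ⊗[k] H) := by
  ext i j
  rw [Matrix.mul_apply]
  simp [he.comul_apply]

theorem map_counit (he : IsComatrix k e) : e.map (Bialgebra.counitAlgHom k H) = 1 := by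
  ext i j
  simp [he.counit_apply, Matrix.one_apply]

/-- The antipode reverses the comultiplication of a comatrix. -/
theorem antipode_transpose (he : IsComatrix k e) : IsComatrix k (e.map (antipode k))ᵀ where
  comul_apply i j := by
    set L : H →ₐ[k] H ⊗[k] H := Algebra.TensorProduct.includeLeft
    set R : H →ₐ[k] H ⊗[k] H := Algebra.TensorProduct.includeRight
    set D : H →ₐ[k] H ⊗[k] H := Bialgebra.comulAlgHom k H
    have key : ∀ F : H →ₐ[k] H ⊗[k] H, e.map F * (e.map (antipode k)).map F = 1 ∧
        (e.map (antipode k)).map F * e.map F = 1 := fun F => by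
      rw [← Matrix.map_mul, ← Matrix.map_mul, he.mul_map_antipode, he.map_antipode_mul,
        Matrix.map_one _ (map_zero F) (map_one F)]
      exact ⟨rfl, rfl⟩
    have h1 : ((e.map (antipode k)).map R * (e.map (antipode k)).map L) * e.map D = 1 := by
      rw [he.map_comul, mul_assoc, ← mul_assoc (Matrix.map (Matrix.map e _) L), (key L).2, one_mul,
        (key R).2]
    have h3 := left_inv_eq_right_inv h1 (key D).1
    have h2 := congr_fun (congr_fun h3 j) i
    rw [Matrix.mul_apply] at h2
    refine Eq.trans h2.symm (Finset.sum_congr rfl fun l _ => ?_)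
    simp [L, R]
  counit_apply i j := by
    simp [he.counit_apply, eq_comm]

/-- The comatrix of the coadjoint action on matrices. -/
theorem adjoint (he : IsComatrix k e) : IsComatrix k
    (Matrix.of fun p q : n × n => e p.1 q.1 * antipode k (e q.2 p.2)) where
  comul_apply p q := by
    have h := he.antipode_transpose.comul_apply p.2 q.2
    simp only [Matrix.transpose_apply, Matrix.map_apply] at h
    rw [Matrix.of_apply, Bialgebra.comul_mul, he.comul_apply, h, Finset.sum_mul_sum,
      Fintype.sum_prod_type]
    simp
  counit_apply p q := by
    rw [Matrix.of_apply, Bialgebra.counit_mul, counit_antipode, he.counit_apply, he.counit_apply]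
    rcases p with ⟨a, b⟩
    rcases q with ⟨c, d⟩
    by_cases h1 : a = c <;> by_cases h2 : d = b <;> simp [h1, h2, eq_comm (a := b)]

theorem isFormMat {e : Matrix (Fin 2) (Fin 2) H} (he : IsComatrix k e)
    (hs : Function.Surjective he.rep) {E : Matrix (Fin 2) (Fin 2) k}
    (form : eᵀ * E.map (algebraMap k H) * e = E.map (algebraMap k H)) (det : IsUnit E) :
    IsFormMat e E where
  comul := he.map_comul
  counit := he.map_counit
  indep w hw := by
    have h := Fintype.linearIndependent_iff.1 (he.linearIndependent hs) (fun p => w p.2 p.1) (by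
      rw [← hw, Matrix.trace, Fintype.sum_prod_type, Finset.sum_comm]
      simp [Matrix.mul_apply, Algebra.smul_def])
    ext i j
    exact h (j, i)
  form := form
  det := det

end IsComatrix

/-- Intertwiners between representations of the convolution algebra intertwine the comatrices. -/
theorem IsComatrix.map_mul_of_intertwines {n : Type*} [Fintype n] [DecidableEq n]
    {e e' : Matrix n n H} (he : IsComatrix k e) (he' : IsComatrix k e') {P : Matrix n n k}
    (h : ∀ f, he'.rep f * P = P * he.rep f) :
    e' * P.map (algebraMap k H) = P.map (algebraMap k H) * e := by
  ext i j
  rw [← sub_eq_zero]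
  refine eq_zero_of_forall_conv (k := k) fun f => ?_
  have h1 := congr_fun (congr_fun (h f) i) j
  simp only [Matrix.mul_apply, IsComatrix.rep_apply] at h1
  rw [map_sub, sub_eq_zero, Matrix.mul_apply, Matrix.mul_apply, map_sum, map_sum]
  refine Eq.trans ?_ (h1.trans ?_)
  · refine Finset.sum_congr rfl fun l _ => ?_
    rw [Matrix.map_apply, ← Algebra.commutes, ← Algebra.smul_def, map_smul, smul_eq_mul, mul_comm]
  · refine Finset.sum_congr rfl fun l _ => ?_
    rw [Matrix.map_apply, ← Algebra.smul_def, map_smul, smul_eq_mul]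

/-- A four-dimensional simple subcoalgebra stable under the antipode is spanned by a comatrix
preserving a nondegenerate bilinear form. -/
theorem IsSimpleSubcoalgWrt.exists_isFormMat [IsAlgClosed k] [FiniteDimensional k H]
    {D : Submodule k H} (hD : IsSimpleSubcoalgWrt k (comulL k H) D)
    (hdim : Module.finrank k D = 4) (hS : Submodule.map (antipode k) D = D) :
    ∃ (e : Matrix (Fin 2) (Fin 2) H) (E : Matrix (Fin 2) (Fin 2) k), IsFormMat e E := by
  obtain ⟨n, hn, e, he, hs, rfl⟩ := hD.exists_comatrix
  obtain rfl : n = 2 := by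
    rw [finrank_span_eq_card (he.linearIndependent hs), Fintype.card_prod, Fintype.card_fin] at hdim
    nlinarith
  obtain ⟨P, hP, hPc⟩ := exists_intertwiner (ρ' := he.antipode_transpose.rep) hs (fun f hf => by
    rw [he.rep_eq_zero_iff] at hf
    ext i j
    refine hf _ ?_
    rw [← hS]
    exact Submodule.mem_map_of_mem (Submodule.subset_span ⟨(j, i), rfl⟩))
  have h := he.map_mul_of_intertwines he.antipode_transpose hPc
  refine ⟨e, Pᵀ, he.isFormMat hs ?_ (by
    rw [Matrix.isUnit_iff_isUnit_det] at hP ⊢; rwa [Matrix.det_transpose])⟩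
  have h1 := congrArg Matrix.transpose h
  rw [transpose_mul_map_algebraMap, transpose_map_algebraMap_mul, Matrix.transpose_transpose] at h1
  rw [← h1, mul_assoc, he.map_antipode_mul, mul_one]

end Hopf

end HopfClass

end

section

open TensorProduct Coalgebra HopfAlgebra Matrix WithConv

namespace HopfClass

universe u

variable {k : Type*} [Field k]

section Hopf

variable {H : Type u} [Ring H] [HopfAlgebra k H]

/-- The identity matrix is a comatrix. -/
theorem isComatrix_one {n : Type*} [Fintype n] [DecidableEq n] :
    IsComatrix k (1 : Matrix n n H) where
  comul_apply i j := by
    by_cases h : i = j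
    · subst h
      simp [Matrix.one_apply, ite_tmul, Algebra.TensorProduct.one_def]
    · rw [Matrix.one_apply_ne h, map_zero, Finset.sum_eq_zero]
      intro l _
      by_cases hl : i = l
      · subst hl; rw [Matrix.one_apply_ne h, tmul_zero]
      · rw [Matrix.one_apply_ne hl, zero_tmul]
  counit_apply i j := by
    by_cases h : i = j <;> simp [Matrix.one_apply, h]

theorem mul_apply_one (f g : ConvDual k H) : (f * g).ofConv 1 = f.ofConv 1 * g.ofConv 1 := by
  change LinearMap.mul' k k (TensorProduct.map f.ofConv g.ofConv (comul 1)) = _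
  simp [Algebra.TensorProduct.one_def]

theorem one_apply_one : (1 : ConvDual k H).ofConv 1 = 1 := by
  change counit (R := k) (1 : H) = 1
  simp

/-- The coradical is spanned by `1` and by some matrix subcoalgebras of dimension four. -/
structure HasCoradical (k : Type*) [Field k] {H : Type u} [Ring H] [HopfAlgebra k H] {ι : Type*}
    (e : ι → Matrix (Fin 2) (Fin 2) H) : Prop where
  comatrix : ∀ i, IsComatrix k (e i)
  surjective : ∀ i, Function.Surjective (comatrix i).rep
  le : coradical k H ≤ Submodule.span k {(1 : H)} ⊔
    ⨆ i, Submodule.span k (Set.range fun p : Fin 2 × Fin 2 => e i p.1 p.2)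

namespace HasCoradical

variable {ι : Type*} {e : ι → Matrix (Fin 2) (Fin 2) H}

theorem exists_ker_le_ker [Fintype ι] [FiniteDimensional k H] (h : HasCoradical k e)
    {n : Type*} [Fintype n] [DecidableEq n] [Nonempty n] {ρ : ConvDual k H →ₐ[k] Matrix n n k}
    (hρ : Function.Surjective ρ) :
    (∀ f : ConvDual k H, f.ofConv 1 = 0 → ρ f = 0) ∨
      ∃ i, ∀ f, (h.comatrix i).rep f = 0 → ρ f = 0 := by
  let φ : Option ι → (ConvDual k H →ₐ[k] Matrix (Fin 2) (Fin 2) k) := fun o =>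
    o.elim (isComatrix_one (k := k) (n := Fin 2)).rep fun i => (h.comatrix i).rep
  obtain ⟨u, hu, rfl⟩ := HopfClass.exists_comatrix ρ
  obtain ⟨o, -, ho⟩ := HopfClass.exists_ker_le_ker hρ φ Finset.univ (fun f hf => by
    rw [hu.rep_eq_zero_iff]
    have hle : Submodule.span k (Set.range fun p : n × n => u p.1 p.2) ≤ coradical k H :=
      le_sSup (hu.isSimpleSubcoalgWrt_span hρ)
    have hker : coradical k H ≤ LinearMap.ker f.ofConv := by
      refine h.le.trans (sup_le ?_ (iSup_le fun i => ?_))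
      · rw [Submodule.span_singleton_le_iff_mem]
        exact congr_fun (congr_fun (hf none (Finset.mem_univ _)) 0) 0
      · exact ((h.comatrix i).rep_eq_zero_iff f).1 (hf (some i) (Finset.mem_univ _))
    exact fun x hx => hker (hle hx))
  cases o with
  | some i => exact Or.inr ⟨i, ho⟩
  | none =>
    refine Or.inl fun f hf => ho f ?_
    ext i j
    change f.ofConv ((1 : Matrix (Fin 2) (Fin 2) H) i j) = 0
    by_cases hij : i = j
    · rw [hij, Matrix.one_apply_eq, hf]
    · rw [Matrix.one_apply_ne hij, map_zero]

theorem le_two [Fintype ι] [FiniteDimensional k H] (h : HasCoradical k e) {n : ℕ} (hn : n ≠ 0)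
    {ρ : ConvDual k H →ₐ[k] Matrix (Fin n) (Fin n) k} (hρ : Function.Surjective ρ) : n ≤ 2 := by
  have : Nonempty (Fin n) := Fin.pos_iff_nonempty.1 (Nat.pos_of_ne_zero hn)
  have : FiniteDimensional k (ConvDual k H) :=
    (WithConv.linearEquiv k (H →ₗ[k] k)).symm.finiteDimensional
  rcases h.exists_ker_le_ker hρ with h1 | ⟨i, hi⟩
  · have := finrank_range_le_of_ker_le
      (φ := (LinearMap.applyₗ (1 : H) : (H →ₗ[k] k) →ₗ[k] k) ∘ₗ
        (WithConv.linearEquiv k (H →ₗ[k] k)).toLinearMap)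
      (ρ := ρ.toLinearMap) hρ h1
    simp only [Module.finrank_matrix, Module.finrank_self, Fintype.card_fin, mul_one] at this
    nlinarith
  · have := finrank_range_le_of_ker_le (φ := (h.comatrix i).rep.toLinearMap)
      (ρ := ρ.toLinearMap) hρ hi
    simp only [Module.finrank_matrix, Module.finrank_self, Fintype.card_fin, mul_one] at this
    nlinarith

theorem char_apply [Fintype ι] [FiniteDimensional k H] (h : HasCoradical k e)
    (χ : ConvDual k H →ₐ[k] k) (f : ConvDual k H) : χ f = f.ofConv 1 := by
  let ρ : ConvDual k H →ₐ[k] Matrix (Fin 1) (Fin 1) k := (Matrix.scalarAlgHom (Fin 1) k).comp χ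
  have hρa : ∀ f, ρ f = Matrix.scalar (Fin 1) (χ f) := fun _ => rfl
  have hρ0 : ∀ f, ρ f = 0 → χ f = 0 := fun f hf => by
    have := congr_fun (congr_fun hf 0) 0
    simpa [hρa] using this
  have hρ : Function.Surjective ρ := fun X => ⟨algebraMap k _ (X 0 0), by
    rw [hρa, AlgHom.commutes]
    ext i j
    fin_cases i; fin_cases j
    simp⟩
  rcases h.exists_ker_le_ker hρ with h1 | ⟨i, hi⟩
  · have h2 := hρ0 _ (h1 (f - algebraMap k _ (f.ofConv 1)) (by
      rw [ofConv_sub, LinearMap.sub_apply, Algebra.algebraMap_eq_smul_one, ofConv_smul,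
        LinearMap.smul_apply, one_apply_one, smul_eq_mul, mul_one, sub_self]))
    rw [map_sub, AlgHom.commutes, sub_eq_zero] at h2
    exact h2
  · exfalso
    obtain ⟨a, ha⟩ := h.surjective i !![0, 1; 0, 0]
    obtain ⟨b, hb⟩ := h.surjective i !![0, 0; 1, 0]
    have h1 := hρ0 _ (hi (a * a) (by
      rw [map_mul, ha]
      ext i j; fin_cases i <;> fin_cases j <;> simp))
    have h2 := hρ0 _ (hi (1 - a * b - b * a) (by
      rw [map_sub, map_sub, map_mul, map_mul, map_one, ha, hb]
      ext i j; fin_cases i <;> fin_cases j <;> simp))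
    rw [map_mul, mul_self_eq_zero] at h1
    simp [h1] at h2

end HasCoradical

theorem hasCoradical_of_isMatrixSubcoalg {ι : Type*} {Cs : ι → Submodule k H}
    (hCs : ∀ i, IsMatrixSubcoalg k H 2 (Cs i))
    (h : coradical k H = Submodule.span k {(1 : H)} ⊔ ⨆ i, Cs i) :
    ∃ e : ι → Matrix (Fin 2) (Fin 2) H, HasCoradical k e := by
  choose e he using hCs
  have hcom := fun i => IsMultMatrix.isComatrix (he i)
  refine ⟨fun i => Matrix.of (e i), hcom, fun i => (hcom i).rep_surjective (he i).1, ?_⟩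
  rw [h]
  exact sup_le_sup_left (iSup_mono fun i => (he i).2.1.le) _

end Hopf

end HopfClass

end

section

open TensorProduct Coalgebra HopfAlgebra Matrix WithConv

namespace HopfClass

section Algebra

variable {k : Type*} [Field k] {R : Type*} [Ring R] [Algebra k R]

theorem finrank_quotient_add_finrank_tower {V : Type*} [AddCommGroup V] [Module k V] [Module R V]
    [IsScalarTower k R V] [FiniteDimensional k V] (L : Submodule R V) :
    Module.finrank k (V ⧸ L) + Module.finrank k L = Module.finrank k V := by
  have h := (L.mkQ.restrictScalars k).finrank_range_add_finrank_ker
  rw [LinearMap.range_eq_top.2 (by exact L.mkQ_surjective), finrank_top] at h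
  have hk : LinearMap.ker (L.mkQ.restrictScalars k) = L.restrictScalars k := by
    ext x
    exact Submodule.Quotient.mk_eq_zero L
  rw [hk] at h
  exact h

/-- One-dimensional modules are given by characters. -/
theorem exists_char {M : Type*} [AddCommGroup M] [Module k M] [Module R M] [IsScalarTower k R M]
    (h : Module.finrank k M = 1) : ∃ χ : R →ₐ[k] k, ∀ (f : R) (m : M), f • m = χ f • m := by
  have h0 : ∃ v : M, v ≠ 0 ∧ ∀ w : M, ∃ c : k, c • v = w := finrank_eq_one_iff'.1 h
  obtain ⟨v, hv, hw⟩ := h0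
  choose c hc using fun f : R => hw (f • v)
  have hinj : ∀ {a b : k}, a • v = b • v → a = b := fun h => smul_left_injective k hv h
  have hcm : ∀ (f : R) (m : M), f • m = c f • m := fun f m => by
    obtain ⟨r, rfl⟩ := hw m
    rw [← smul_comm r f v, ← hc, smul_comm]
  refine ⟨AlgHom.ofLinearMap ⟨⟨c, fun f g => hinj ?_⟩, fun r f => hinj ?_⟩ (hinj ?_)
    fun f g => hinj ?_, hcm⟩
  · rw [hc, add_smul, add_smul, hc, hc]
  · rw [hc, RingHom.id_apply, smul_assoc, smul_assoc, hc]
  · change c 1 • v = _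
    rw [hc, one_smul, one_smul]
  · change c (f * g) • v = (c f * c g) • v
    rw [hc, mul_smul, mul_smul, hcm f, hc]

/-- In a four-dimensional module over an algebra with a single character and no irreducible
representations of dimension larger than two, a line which is isolated among the invariants is the
bottom of a chain of submodules with factors of dimension one, two and one. -/
theorem exists_middle_rep [IsAlgClosed k] {V : Type*} [AddCommGroup V] [Module k V] [Module R V]
    [IsScalarTower k R V] [FiniteDimensional k V] (hdim : Module.finrank k V = 4) (ε : R →ₐ[k] k)
    (hrep : ∀ (n : ℕ), n ≠ 0 → ∀ ρ : R →ₐ[k] Matrix (Fin n) (Fin n) k,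
      Function.Surjective ρ → n ≤ 2)
    (hchar : ∀ χ : R →ₐ[k] k, χ = ε) {v₀ : V} (hv₀ : v₀ ≠ 0) (hinv : ∀ f : R, f • v₀ = ε f • v₀)
    (hfix : ∀ v : V, (∀ f : R, f • v - ε f • v ∈ Submodule.span k {v₀}) → v ∈ Submodule.span k {v₀}) :
    ∃ (v : Fin 2 → V) (ρ : R →ₐ[k] Matrix (Fin 2) (Fin 2) k) (θ : V →ₗ[k] k),
      Function.Surjective ρ ∧ (∀ f j, f • v j - ∑ i, ρ f i j • v i ∈ Submodule.span k {v₀}) ∧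
      (∀ a b : k, a • v 0 + b • v 1 ∈ Submodule.span k {v₀} → a = 0 ∧ b = 0) ∧
      θ ≠ 0 ∧ θ v₀ = 0 ∧ (∀ j, θ (v j) = 0) ∧ ∀ (f : R) (x : V), θ (f • x) = ε f * θ x := by
  let L : Submodule R V :=
    { toAddSubmonoid := (Submodule.span k {v₀}).toAddSubmonoid
      smul_mem' := by
        intro f x hx
        obtain ⟨c, rfl⟩ := Submodule.mem_span_singleton.1 hx
        refine Submodule.mem_span_singleton.2 ⟨c * ε f, ?_⟩
        rw [mul_smul, ← hinv, smul_comm] }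
  have hLmem : ∀ x, x ∈ L ↔ x ∈ Submodule.span k {v₀} := fun _ => Iff.rfl
  have hL1 : Module.finrank k L = 1 := finrank_span_singleton (K := k) hv₀
  have hQ := finrank_quotient_add_finrank_tower (k := k) L
  have hQfin : FiniteDimensional k (V ⧸ L) :=
    FiniteDimensional.of_surjective (L.mkQ.restrictScalars k) L.mkQ_surjective
  have hQ3 : Module.finrank k (V ⧸ L) = 3 := by omega
  have hQnt : Nontrivial (V ⧸ L) := Module.nontrivial_of_finrank_pos (R := k) (by omega)
  have hart : IsArtinian R (V ⧸ L) := isArtinian_of_tower k inferInstance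
  obtain ⟨Y, hY⟩ := IsAtomic.exists_atom (Submodule R (V ⧸ L))
  have hYs : IsSimpleModule R Y := isSimpleModule_iff_isAtom.2 hY
  have hYfin : FiniteDimensional k Y := FiniteDimensional.of_injective (Y.subtype.restrictScalars k)
    Y.subtype_injective
  have hYnt : Nontrivial Y := IsSimpleModule.nontrivial R Y
  have hY2 := hrep _ Module.finrank_pos.ne' _
    (simple_toMatrix_surjective (R := R) (Module.finBasis k Y))
  have hYne : Module.finrank k Y ≠ 1 := by
    intro h1
    obtain ⟨χ, hχ⟩ := exists_char (R := R) h1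
    obtain ⟨y, hy⟩ := exists_ne (0 : Y)
    obtain ⟨v, hv⟩ := L.mkQ_surjective y
    refine hy (Subtype.ext ?_)
    rw [← hv]
    refine (Submodule.Quotient.mk_eq_zero L).2 (hfix v fun f => ?_)
    rw [← hLmem, ← Submodule.Quotient.mk_eq_zero L]
    have h2 : f • (y : V ⧸ L) = ε f • (y : V ⧸ L) := by
      have := congrArg Subtype.val (hχ f y)
      rw [hchar χ] at this
      exact this
    rw [← hv] at h2
    change L.mkQ (f • v - ε f • v) = 0
    rw [map_sub, map_smul, h2, sub_eq_zero]
    rfl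
  have hY2' : Module.finrank k Y = 2 := by
    have := Module.finrank_pos (R := k) (M := Y)
    omega
  have hW := finrank_quotient_add_finrank_tower (k := k) Y
  obtain ⟨χ, hχ⟩ := exists_char (R := R) (M := (V ⧸ L) ⧸ Y) (k := k) (by omega)
  obtain ⟨φ⟩ : Nonempty (((V ⧸ L) ⧸ Y) ≃ₗ[k] k) :=
    have : FiniteDimensional k ((V ⧸ L) ⧸ Y) :=
      FiniteDimensional.of_surjective (Y.mkQ.restrictScalars k) Y.mkQ_surjective
    FiniteDimensional.nonempty_linearEquiv_of_finrank_eq (by rw [Module.finrank_self]; omega)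
  let b : Module.Basis (Fin 2) k Y := Module.finBasisOfFinrankEq k Y hY2'
  choose v hv using fun i => L.mkQ_surjective (b i : V ⧸ L)
  refine ⟨v, _, φ.toLinearMap ∘ₗ (Y.mkQ.restrictScalars k) ∘ₗ (L.mkQ.restrictScalars k),
    simple_toMatrix_surjective (R := R) b, fun f j => ?_, fun r s hrs => ?_, ?_, ?_, fun j => ?_,
    fun f x => ?_⟩
  · rw [← hLmem, ← Submodule.Quotient.mk_eq_zero L]
    change (L.mkQ.restrictScalars k) (f • v j - _) = 0
    rw [map_sub, map_sum]
    simp only [map_smul]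
    change f • L.mkQ (v j) - ∑ i, _ • L.mkQ (v i) = 0
    simp only [hv]
    have h1 := congrArg Subtype.val (b.sum_repr (f • b j))
    rw [sub_eq_zero]
    refine h1.symm.trans ?_
    rw [AddSubmonoidClass.coe_finsetSum]
    refine Finset.sum_congr rfl fun i _ => ?_
    change b.repr (f • b j) i • (b i : V ⧸ L) = LinearMap.toMatrix b b _ i j • (b i : V ⧸ L)
    rw [LinearMap.toMatrix_apply]
    rfl
  · have h1 : r • b 0 + s • b 1 = 0 := by
      refine Subtype.ext ?_
      change r • (b 0 : V ⧸ L) + s • (b 1 : V ⧸ L) = 0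
      rw [← hv, ← hv]
      exact (Submodule.Quotient.mk_eq_zero L).2 hrs
    have h2 := Fintype.linearIndependent_iff.1 b.linearIndependent ![r, s] (by simpa using h1)
    exact ⟨h2 0, h2 1⟩
  · intro h0
    obtain ⟨x, hx⟩ := φ.surjective 1
    obtain ⟨y, rfl⟩ := Y.mkQ_surjective x
    obtain ⟨z, rfl⟩ := L.mkQ_surjective y
    exact one_ne_zero (hx.symm.trans (LinearMap.congr_fun h0 z))
  · change φ (Y.mkQ (L.mkQ v₀)) = 0
    have : L.mkQ v₀ = 0 := (Submodule.Quotient.mk_eq_zero L).2 (Submodule.mem_span_singleton_self v₀)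
    rw [this, map_zero, map_zero]
  · change φ (Y.mkQ (L.mkQ (v j))) = 0
    have : Y.mkQ (L.mkQ (v j)) = 0 := (Submodule.Quotient.mk_eq_zero Y).2 (by rw [hv]; exact (b j).2)
    rw [this, map_zero]
  · change φ (Y.mkQ (L.mkQ (f • x))) = ε f * φ (Y.mkQ (L.mkQ x))
    rw [map_smul, map_smul, hχ, hchar χ, map_smul, smul_eq_mul]

end Algebra

end HopfClass

end

section

open TensorProduct Coalgebra HopfAlgebra Matrix WithConv

namespace HopfClass

universe u

variable {k : Type*} [Field k]

section Hopf

variable {H : Type u} [Ring H] [HopfAlgebra k H]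

/-- In characteristic zero a finite dimensional bialgebra has no nonzero primitive elements. -/
theorem eq_zero_of_isPrimitive [CharZero k] [FiniteDimensional k H] {y : H}
    (hy : comul (R := k) y = y ⊗ₜ[k] 1 + 1 ⊗ₜ[k] y) : y = 0 := by
  have hε : counit (R := k) y = 0 := by
    have h := congrArg (TensorProduct.lid k H) (Coalgebra.rTensor_counit_comul (R := k) y)
    rw [hy] at h
    simp only [map_add, LinearMap.rTensor_tmul, TensorProduct.lid_tmul, Bialgebra.counit_one,
      one_smul, add_eq_right] at h
    have h2 := congrArg (counit (R := k)) h
    simpa using h2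
  let W : ℕ → Submodule k H := fun n => Submodule.span k ((fun i => y ^ i) '' Set.Iio n)
  have hmem {i n : ℕ} (h : i < n) : y ^ i ∈ W n := Submodule.subset_span ⟨i, h, rfl⟩
  have hex : ∃ n, y ^ n ∈ W n := by
    refine ⟨(minpoly k y).natDegree, ?_⟩
    have hInt : IsIntegral k y := Algebra.IsIntegral.isIntegral y
    have h := congrArg (Polynomial.aeval y) (minpoly.monic hInt).as_sum
    rw [minpoly.aeval, map_add, map_pow, Polynomial.aeval_X, eq_comm,
      add_eq_zero_iff_eq_neg] at h
    rw [h, map_sum]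
    refine Submodule.neg_mem _ (Submodule.sum_mem _ fun i hi => ?_)
    rw [map_mul, Polynomial.aeval_C, map_pow, Polynomial.aeval_X, ← Algebra.smul_def]
    exact Submodule.smul_mem _ _ (hmem (Finset.mem_range.1 hi))
  classical
  obtain ⟨n, hn, hmin⟩ : ∃ n, y ^ n ∈ W n ∧ ∀ m < n, y ^ m ∉ W m :=
    ⟨Nat.find hex, Nat.find_spec hex, fun m hm => Nat.find_min hex hm⟩
  obtain _ | m := n
  · have : (1 : H) = 0 := by simpa [W] using hn
    rw [← mul_one y, this, mul_zero]
  obtain ⟨φ, hφ, hφW⟩ := Submodule.exists_le_ker_of_notMem (hmin m m.lt_succ_self)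
  have hφ0 {i : ℕ} (h : i < m) : φ (y ^ i) = 0 := hφW (hmem h)
  let P : H →ₗ[k] H := (TensorProduct.lid k H).toLinearMap ∘ₗ
    TensorProduct.map φ LinearMap.id ∘ₗ comul
  have hP (r : ℕ) : P (y ^ r) =
      ∑ j ∈ Finset.range (r + 1), φ (y ^ j) • ((r.choose j : k) • y ^ (r - j)) := by
    have hc : Commute (y ⊗ₜ[k] (1 : H)) ((1 : H) ⊗ₜ[k] y) := by
      simp [Commute, SemiconjBy, Algebra.TensorProduct.tmul_mul_tmul]
    change TensorProduct.lid k H (TensorProduct.map φ LinearMap.id (comul (y ^ r))) = _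
    rw [Bialgebra.comul_pow, hy, hc.add_pow, map_sum, map_sum]
    refine Finset.sum_congr rfl fun j _ => ?_
    rw [Algebra.TensorProduct.tmul_pow, Algebra.TensorProduct.tmul_pow,
      Algebra.TensorProduct.tmul_mul_tmul, one_pow, one_pow, one_mul, mul_one,
      ← nsmul_eq_mul', ← Nat.cast_smul_eq_nsmul k, map_smul, TensorProduct.map_tmul, map_smul,
      TensorProduct.lid_tmul, LinearMap.id_apply, smul_comm]
  have h1 : P (y ^ (m + 1)) ∈ Submodule.span k {(1 : H)} := by
    have hle : W (m + 1) ≤ (Submodule.span k {(1 : H)}).comap P := by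
      refine Submodule.span_le.2 ?_
      rintro _ ⟨i, hi, rfl⟩
      change P (y ^ i) ∈ Submodule.span k {(1 : H)}
      rw [hP, Finset.sum_range_succ, Finset.sum_eq_zero, zero_add]
      · simpa using Submodule.smul_mem _ _ (Submodule.mem_span_singleton_self _)
      · intro j hj
        have := Finset.mem_range.1 hj
        have : i < m + 1 := hi
        rw [hφ0 (by omega), zero_smul]
    exact hle hn
  rw [hP, Finset.sum_range_succ, Finset.sum_range_succ, Finset.sum_eq_zero, zero_add] at h1
  · simp only [Nat.choose_succ_self_right, Nat.add_sub_cancel_left, pow_one, Nat.choose_self,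
      Nat.cast_one, tsub_self, pow_zero, one_smul] at h1
    have h2 := (Submodule.add_mem_iff_left _
      (Submodule.smul_mem _ _ (Submodule.mem_span_singleton_self (1 : H)))).1 h1
    rw [smul_smul, Submodule.smul_mem_iff _ (mul_ne_zero hφ (Nat.cast_ne_zero.2 m.succ_ne_zero)),
      Submodule.mem_span_singleton] at h2
    obtain ⟨c, rfl⟩ := h2
    have : c = 0 := by simpa using hε
    rw [this, zero_smul]
  · intro j hj
    rw [hφ0 (Finset.mem_range.1 hj), zero_smul]

end Hopf

section Algebra

variable {R : Type*} [Ring R] [Algebra k R]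

/-- The module structure defined by a representation, as in `exists_middle_rep`. -/
theorem exists_middle_rep_of_algHom [IsAlgClosed k] {V : Type*} [AddCommGroup V] [Module k V]
    [FiniteDimensional k V] (φ : R →ₐ[k] Module.End k V) (hdim : Module.finrank k V = 4)
    (ε : R →ₐ[k] k)
    (hrep : ∀ n : ℕ, n ≠ 0 → ∀ ρ : R →ₐ[k] Matrix (Fin n) (Fin n) k, Function.Surjective ρ → n ≤ 2)
    (hchar : ∀ χ : R →ₐ[k] k, χ = ε) {v₀ : V} (hv₀ : v₀ ≠ 0) (hinv : ∀ f, φ f v₀ = ε f • v₀)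
    (hfix : ∀ v, (∀ f, φ f v - ε f • v ∈ Submodule.span k {v₀}) → v ∈ Submodule.span k {v₀}) :
    ∃ (v : Fin 2 → V) (ρ : R →ₐ[k] Matrix (Fin 2) (Fin 2) k) (θ : V →ₗ[k] k),
      Function.Surjective ρ ∧
      (∀ f j, φ f (v j) - ∑ i, ρ f i j • v i ∈ Submodule.span k {v₀}) ∧
      (∀ a b : k, a • v 0 + b • v 1 ∈ Submodule.span k {v₀} → a = 0 ∧ b = 0) ∧
      θ ≠ 0 ∧ θ v₀ = 0 ∧ (∀ j, θ (v j) = 0) ∧ ∀ f x, θ (φ f x) = ε f * θ x := by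
  let _ : Module R V := Module.compHom V φ.toRingHom
  have : IsScalarTower k R V := ⟨fun r f x => by
    change φ (r • f) x = r • φ f x
    rw [map_smul]; rfl⟩
  exact exists_middle_rep hdim ε hrep hchar hv₀ hinv hfix

end Algebra

end HopfClass

end

section

open TensorProduct Coalgebra HopfAlgebra Matrix WithConv

namespace HopfClass

universe u

variable {k : Type*} [Field k]

section Hopf

variable {H : Type u} [Ring H] [HopfAlgebra k H] {n : Type*} [Fintype n]

/-- Evaluation at `1`, as a character of the convolution algebra. -/
noncomputable def evalOne (k : Type*) [Field k] (H : Type u) [Ring H] [HopfAlgebra k H] :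
    ConvDual k H →ₐ[k] k :=
  AlgHom.ofLinearMap
    (LinearMap.applyₗ (1 : H) ∘ₗ (WithConv.linearEquiv k (H →ₗ[k] k)).toLinearMap)
    one_apply_one mul_apply_one

theorem evalOne_apply (f : ConvDual k H) : evalOne k H f = f.ofConv 1 := rfl

/-- The coadjoint coaction of a comatrix on matrices, `X ↦ e X S(e)`. -/
noncomputable def conjMat (e : Matrix n n H) (X : Matrix n n k) : Matrix n n H :=
  e * X.map (algebraMap k H) * e.map (antipode k)

theorem conjMat_apply (e : Matrix n n H) (X : Matrix n n k) (i j : n) :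
    conjMat e X i j = ∑ q : n × n, X q.1 q.2 • (e i q.1 * antipode k (e q.2 j)) := by
  rw [conjMat, Matrix.mul_apply, Fintype.sum_prod_type, Finset.sum_comm]
  refine Finset.sum_congr rfl fun b _ => ?_
  rw [Matrix.mul_apply, Finset.sum_mul]
  refine Finset.sum_congr rfl fun a _ => ?_
  rw [Matrix.map_apply, Matrix.map_apply, ← Algebra.commutes, ← Algebra.smul_def, smul_mul_assoc]

variable [DecidableEq n]

/-- The action of the convolution algebra on matrices defined by the coadjoint coaction. -/
noncomputable def coadj {e : Matrix n n H} (he : IsComatrix k e) :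
    ConvDual k H →ₐ[k] Module.End k (Matrix n n k) :=
  ((LinearEquiv.curry k k n n).conjAlgEquiv k).toAlgHom.comp
    ((Matrix.toLinAlgEquiv' (R := k) (n := n × n)).toAlgHom.comp he.adjoint.rep)

theorem coadj_apply {e : Matrix n n H} (he : IsComatrix k e) (f : ConvDual k H) (X : Matrix n n k)
    (i j : n) : coadj he f X i j = f.ofConv (conjMat e X i j) := by
  change (he.adjoint.rep f *ᵥ fun q : n × n => X q.1 q.2) (i, j) = _
  rw [conjMat_apply, map_sum, Matrix.mulVec, dotProduct]
  refine Finset.sum_congr rfl fun q _ => ?_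
  rw [map_smul, smul_eq_mul, mul_comm]
  rfl

namespace IsComatrix

variable {e : Matrix n n H}

theorem conjMat_mul (he : IsComatrix k e) (X Y : Matrix n n k) :
    conjMat e X * conjMat e Y = conjMat e (X * Y) := by
  rw [conjMat, conjMat, conjMat, Matrix.map_mul,
    show ∀ a b c d : Matrix n n H, a * b * c * (a * d * c) = a * b * (c * a) * d * c by
      intros; noncomm_ring, he.map_antipode_mul, mul_one, ← mul_assoc]

theorem conjMat_one (he : IsComatrix k e) : conjMat e (1 : Matrix n n k) = 1 := by
  rw [conjMat, Matrix.map_one _ (map_zero _) (map_one _), mul_one, he.mul_map_antipode]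

theorem comul_conjMat (he : IsComatrix k e) (X : Matrix n n k) (i j : n) :
    comul (R := k) (conjMat e X i j) =
      ∑ l : n × n, (e i l.1 * antipode k (e l.2 j)) ⊗ₜ[k] conjMat e X l.1 l.2 := by
  have h (q : n × n) := he.adjoint.comul_apply (i, j) q
  simp only [Matrix.of_apply] at h
  simp only [conjMat_apply, map_sum, map_smul, h, tmul_sum, Finset.smul_sum, tmul_smul]
  exact Finset.sum_comm

/-- Matrices commuting with a comatrix are scalar. -/
theorem mem_span_one_of_commute (he : IsComatrix k e) (hs : Function.Surjective he.rep)
    {X : Matrix n n k}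
    (h : e * X.map (algebraMap k H) = X.map (algebraMap k H) * e) :
    X ∈ Submodule.span k {(1 : Matrix n n k)} := by
  have h1 (f : ConvDual k H) : he.rep f * X = X * he.rep f := by
    ext i j
    have h2 := congrArg f.ofConv (congr_fun (congr_fun h i) j)
    rw [Matrix.mul_apply, Matrix.mul_apply, map_sum, map_sum] at h2
    rw [Matrix.mul_apply, Matrix.mul_apply]
    refine Eq.trans (Finset.sum_congr rfl fun l _ => ?_) (h2.trans
      (Finset.sum_congr rfl fun l _ => ?_))
    · rw [Matrix.map_apply, ← Algebra.commutes, ← Algebra.smul_def, map_smul, smul_eq_mul, mul_comm,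
        he.rep_apply]
    · rw [Matrix.map_apply, ← Algebra.smul_def, map_smul, smul_eq_mul, he.rep_apply]
  obtain ⟨c, rfl⟩ := Matrix.mem_range_scalar_of_commute_single (M := X) fun i j _ => by
    obtain ⟨f, hf⟩ := hs (Matrix.single i j 1)
    rw [← hf]
    exact h1 f
  rw [Submodule.mem_span_singleton]
  exact ⟨c, by rw [Matrix.smul_one_eq_diagonal]; rfl⟩

end IsComatrix

/-- A matrix whose images under all functionals are scalar is a scalar matrix. -/
theorem exists_eq_smul_of_forall_conv {m : Type*} [DecidableEq m] [Nonempty m] {M : Matrix m m H}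
    (h : ∀ f : ConvDual k H, M.map f.ofConv ∈ Submodule.span k {(1 : Matrix m m k)}) :
    ∃ y : H, ∀ i j, M i j = (1 : Matrix m m k) i j • y := by
  obtain ⟨a⟩ := ‹Nonempty m›
  refine ⟨M a a, fun i j => ?_⟩
  rw [← sub_eq_zero]
  refine eq_zero_of_forall_conv (k := k) fun f => ?_
  obtain ⟨c, hc⟩ := Submodule.mem_span_singleton.1 (h f)
  have hc' (i j : m) : f.ofConv (M i j) = c * (1 : Matrix m m k) i j :=
    (congr_fun (congr_fun hc i) j).symm
  rw [map_sub, map_smul, hc', hc', smul_eq_mul, Matrix.one_apply_eq]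
  ring

/-- Matrices which are invariant under the coadjoint action up to scalar matrices are scalar. -/
theorem IsComatrix.mem_span_one_of_coadj [CharZero k] [FiniteDimensional k H]
    {e : Matrix (Fin 2) (Fin 2) H} (he : IsComatrix k e) (hs : Function.Surjective he.rep)
    {X : Matrix (Fin 2) (Fin 2) k}
    (h : ∀ f, coadj he f X - evalOne k H f • X ∈
      Submodule.span k {(1 : Matrix (Fin 2) (Fin 2) k)}) :
    X ∈ Submodule.span k {(1 : Matrix (Fin 2) (Fin 2) k)} := by
  obtain ⟨y, hT⟩ := exists_eq_smul_of_forall_conv (k := k)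
    (M := Matrix.of fun i j => conjMat e X i j - X i j • (1 : H)) fun f => by
      convert h f using 1
      ext i j
      rw [Matrix.sub_apply, Matrix.smul_apply, coadj_apply, evalOne_apply, Matrix.map_apply,
        Matrix.of_apply, map_sub, map_smul, smul_eq_mul, smul_eq_mul, mul_comm]
  replace hT (i j : Fin 2) : conjMat e X i j = X i j • (1 : H) +
      (1 : Matrix (Fin 2) (Fin 2) k) i j • y := sub_eq_iff_eq_add'.1 (hT i j)
  have hprim : comul (R := k) y = y ⊗ₜ[k] 1 + 1 ⊗ₜ[k] y := by
    have h1 := he.comul_conjMat X 0 0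
    simp only [hT, tmul_add, tmul_smul, Finset.sum_add_distrib] at h1
    have h2 : ∑ l : Fin 2 × Fin 2, X l.1 l.2 • ((e 0 l.1 * antipode k (e l.2 0)) ⊗ₜ[k] (1 : H)) =
        conjMat e X 0 0 ⊗ₜ[k] 1 := by
      rw [conjMat_apply, sum_tmul]
      simp only [smul_tmul']
    have h3 : ∑ l : Fin 2 × Fin 2, (1 : Matrix (Fin 2) (Fin 2) k) l.1 l.2 •
        ((e 0 l.1 * antipode k (e l.2 0)) ⊗ₜ[k] y) = 1 ⊗ₜ[k] y := by
      have h4 := congr_fun (congr_fun he.conjMat_one 0) 0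
      rw [conjMat_apply, Matrix.one_apply_eq] at h4
      rw [← h4, sum_tmul]
      simp only [smul_tmul']
    rw [h2, h3, hT, map_add, map_smul, map_smul, Bialgebra.comul_one, Algebra.TensorProduct.one_def,
      add_tmul, Matrix.one_apply_eq, one_smul, one_smul, smul_tmul', add_assoc] at h1
    exact add_left_cancel h1
  have hy0 := eq_zero_of_isPrimitive hprim
  refine he.mem_span_one_of_commute hs ?_
  have h5 : conjMat e X = X.map (algebraMap k H) := by
    ext i j
    rw [hT, hy0, smul_zero, add_zero, Matrix.map_apply, Algebra.algebraMap_eq_smul_one]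
  conv_rhs => rw [← h5, conjMat, mul_assoc _ _ e, he.map_antipode_mul, mul_one]

end Hopf

end HopfClass

end

section

open TensorProduct Coalgebra HopfAlgebra Matrix WithConv

namespace HopfClass

universe u

variable {k : Type*} [Field k]

section Hopf

variable {H : Type u} [Ring H] [HopfAlgebra k H] {n : Type*} [Fintype n]

/-- The matrix with entries `X i j • h`. -/
def tmulMat (X : Matrix n n k) (h : H) : Matrix n n H := Matrix.of fun i j => X i j • h

theorem tmulMat_mul (X Y : Matrix n n k) (g h : H) :
    tmulMat X g * tmulMat Y h = tmulMat (X * Y) (g * h) := by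
  ext i j
  simp [tmulMat, Matrix.mul_apply, Finset.sum_smul, smul_smul, mul_comm]

variable [DecidableEq n]

/-- The extension of scalars of a linear functional on matrices. -/
noncomputable def extendScalars (θ : Matrix n n k →ₗ[k] k) (H : Type u) [Ring H] [HopfAlgebra k H] :
    Matrix n n H →ₗ[k] H :=
  ∑ q : n × n, θ (Matrix.single q.1 q.2 1) • Matrix.entryLinearMap k H q.1 q.2

theorem extendScalars_apply (θ : Matrix n n k →ₗ[k] k) (M : Matrix n n H) :
    extendScalars θ H M = ∑ q : n × n, θ (Matrix.single q.1 q.2 1) • M q.1 q.2 := by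
  simp [extendScalars]

theorem sum_apply_single (θ : Matrix n n k →ₗ[k] k) (X : Matrix n n k) :
    θ X = ∑ q : n × n, θ (Matrix.single q.1 q.2 1) * X q.1 q.2 := by
  conv_lhs => rw [Matrix.matrix_eq_sum_single X]
  simp only [map_sum, Fintype.sum_prod_type]
  refine Finset.sum_congr rfl fun i _ => Finset.sum_congr rfl fun j _ => ?_
  rw [show Matrix.single i j (X i j) = X i j • Matrix.single i j (1 : k) by simp, map_smul,
    smul_eq_mul, mul_comm]

theorem extendScalars_tmulMat (θ : Matrix n n k →ₗ[k] k) (X : Matrix n n k) (h : H) :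
    extendScalars θ H (tmulMat X h) = θ X • h := by
  rw [extendScalars_apply, sum_apply_single, Finset.sum_smul]
  simp [tmulMat, smul_smul]

theorem IsComatrix.extendScalars_conjMat {e : Matrix n n H} (he : IsComatrix k e)
    {θ : Matrix n n k →ₗ[k] k} (hθ : ∀ f X, θ (coadj he f X) = evalOne k H f * θ X)
    (X : Matrix n n k) : extendScalars θ H (conjMat e X) = θ X • (1 : H) := by
  rw [← sub_eq_zero]
  refine eq_zero_of_forall_conv (k := k) fun f => ?_
  rw [map_sub, map_smul, smul_eq_mul, mul_comm, ← evalOne_apply, ← hθ, extendScalars_apply,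
    sum_apply_single θ (coadj he f X), map_sum, sub_eq_zero]
  simp [coadj_apply]

/-- An invariant functional on matrices defines a nondegenerate bilinear form. -/
theorem IsComatrix.isUnit_of_invariant {e : Matrix n n H} (he : IsComatrix k e)
    (hs : Function.Surjective he.rep) {θ : Matrix n n k →ₗ[k] k}
    (hθ : ∀ f X, θ (coadj he f X) = evalOne k H f * θ X) (hθ0 : θ ≠ 0) :
    IsUnit (Matrix.of fun i j => θ (Matrix.single i j 1)) := by
  obtain ⟨g, hg⟩ : ∃ g : Matrix n n k, g = Matrix.of fun i j => θ (Matrix.single i j 1) := ⟨_, rfl⟩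
  have hgij (i j : n) : θ (Matrix.single i j 1) = g i j := by rw [hg]; rfl
  rw [← hg, Matrix.isUnit_iff_isUnit_det, isUnit_iff_ne_zero]
  intro hdet
  obtain ⟨u, hu, hug⟩ := Matrix.exists_vecMul_eq_zero_iff.2 hdet
  have h1 : eᵀ * g.map (algebraMap k H) * (e.map (antipode k))ᵀ = g.map (algebraMap k H) := by
    ext a b
    have h2 := he.extendScalars_conjMat hθ (Matrix.single a b 1)
    rw [extendScalars_apply, hgij, ← Algebra.algebraMap_eq_smul_one] at h2
    rw [Matrix.map_apply, ← h2, Matrix.mul_apply, Fintype.sum_prod_type, Finset.sum_comm]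
    refine Finset.sum_congr rfl fun j _ => ?_
    rw [Matrix.mul_apply, Finset.sum_mul]
    refine Finset.sum_congr rfl fun i _ => ?_
    rw [conjMat_apply, hgij, Finset.sum_eq_single (a, b)]
    · simp [← Algebra.commutes, ← Algebra.smul_def]
    · rintro ⟨c, d⟩ _ hne
      rw [Matrix.single_apply_of_ne, zero_smul]
      rintro ⟨rfl, rfl⟩
      exact hne rfl
    · simp
  have h2 : eᵀ * g.map (algebraMap k H) =
      g.map (algebraMap k H) * ((e.map (antipode k))ᵀ).map (antipode k) := by
    conv_rhs => rw [← h1, mul_assoc, he.antipode_transpose.mul_map_antipode, mul_one]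
  have h3 (f : ConvDual k H) (j : n) : ∑ i, (∑ a, u a * he.rep f i a) * g i j = 0 := by
    have h4 : ∑ a, u a • (eᵀ * g.map (algebraMap k H)) a j = 0 := by
      rw [h2]
      simp only [Matrix.mul_apply, Finset.smul_sum, Matrix.map_apply, ← Algebra.smul_def,
        smul_smul]
      rw [Finset.sum_comm]
      refine Finset.sum_eq_zero fun l _ => ?_
      have h5 : ∑ a, u a * g a l = 0 := congr_fun hug l
      rw [← Finset.sum_smul, h5, zero_smul]
    have h5 := congrArg f.ofConv h4
    rw [map_zero, map_sum] at h5
    rw [← h5]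
    simp only [Finset.sum_mul]
    rw [Finset.sum_comm]
    refine Finset.sum_congr rfl fun a _ => ?_
    rw [Matrix.mul_apply, map_smul, map_sum, smul_eq_mul, Finset.mul_sum]
    refine Finset.sum_congr rfl fun i _ => ?_
    rw [Matrix.map_apply, ← Algebra.commutes, ← Algebra.smul_def, map_smul, smul_eq_mul,
      he.rep_apply, Matrix.transpose_apply]
    ring
  obtain ⟨a, ha⟩ := Function.ne_iff.1 hu
  refine hθ0 (LinearMap.ext fun X => ?_)
  rw [sum_apply_single, LinearMap.zero_apply]
  refine Finset.sum_eq_zero fun q _ => ?_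
  obtain ⟨f, hf⟩ := hs (Matrix.single q.1 a 1)
  have h6 := h3 f q.2
  rw [hf, Finset.sum_eq_single q.1, Finset.sum_eq_single a, Matrix.single_apply_same, mul_one] at h6
  · rw [hgij, (mul_eq_zero.1 h6).resolve_left ha, zero_mul]
  · intro b _ hb
    rw [Matrix.single_apply_of_ne, mul_zero]
    exact fun h => hb h.2.symm
  · simp
  · intro i _ hi
    rw [Finset.sum_eq_zero, zero_mul]
    intro b _
    rw [Matrix.single_apply_of_ne, mul_zero]
    exact fun h => hi h.1.symm
  · simp

end Hopf

end HopfClass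

end

section

open TensorProduct Coalgebra HopfAlgebra Matrix WithConv

namespace HopfClass

universe u

variable {k : Type*} [Field k]

section Hopf

/-- Nondegeneracy of the form `(i, j) ↦ θ (v i * v j)` when `v` spans a complement of the
scalar matrices in the kernel of `θ`. -/
theorem isUnit_of_span_ker {θ : Matrix (Fin 2) (Fin 2) k →ₗ[k] k}
    {v : Fin 2 → Matrix (Fin 2) (Fin 2) k}
    (hθ : IsUnit (Matrix.of fun i j => θ (Matrix.single i j 1)))
    (hv : ∀ a b : k, a • v 0 + b • v 1 ∈ Submodule.span k {(1 : Matrix (Fin 2) (Fin 2) k)} →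
      a = 0 ∧ b = 0) (hθ0 : θ ≠ 0) (hθ1 : θ 1 = 0) (hθv : ∀ j, θ (v j) = 0) :
    IsUnit (Matrix.of fun i j => θ (v i * v j)) := by
  rw [Matrix.isUnit_iff_isUnit_det, isUnit_iff_ne_zero]
  intro hdet
  obtain ⟨c, hc, hcE⟩ := Matrix.exists_vecMul_eq_zero_iff.2 hdet
  refine hc ?_
  obtain ⟨x, hx⟩ : ∃ x, x = c 0 • v 0 + c 1 • v 1 := ⟨_, rfl⟩
  have hxv (j : Fin 2) : θ (x * v j) = 0 := by
    have h := congr_fun hcE j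
    rw [Matrix.vecMul, dotProduct, Fin.sum_univ_two] at h
    rw [hx, add_mul, smul_mul_assoc, smul_mul_assoc, map_add, map_smul, map_smul]
    exact h
  have hx1 : θ x = 0 := by simp [hx, hθv]
  obtain ⟨z, hz⟩ : ∃ z, θ z ≠ 0 := by
    by_contra! h
    exact hθ0 (LinearMap.ext h)
  have hli : LinearIndependent k ![1, v 0, v 1] := by
    rw [Fintype.linearIndependent_iff]
    intro g hg
    simp only [Fin.sum_univ_three, Matrix.cons_val_zero, Matrix.cons_val_one, Matrix.cons_val] at hg
    have h1 := hv (g 1) (g 2) (Submodule.mem_span_singleton.2 ⟨-g 0, by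
      rw [neg_smul, neg_eq_iff_add_eq_zero, ← add_assoc]; exact hg⟩)
    rw [h1.1, h1.2, zero_smul, zero_smul, add_zero, add_zero] at hg
    have h0 := (smul_eq_zero.1 hg).resolve_right one_ne_zero
    intro i
    fin_cases i
    exacts [h0, h1.1, h1.2]
  have hker : LinearMap.ker θ = Submodule.span k (Set.range ![1, v 0, v 1]) := by
    symm
    refine Submodule.eq_of_le_of_finrank_le (Submodule.span_le.2 ?_) ?_
    · rintro _ ⟨i, rfl⟩
      fin_cases i
      exacts [hθ1, hθv 0, hθv 1]
    · rw [finrank_span_eq_card hli, Fintype.card_fin]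
      have h1 := LinearMap.finrank_range_add_finrank_ker θ
      have h2 : 0 < Module.finrank k (LinearMap.range θ) :=
        Module.finrank_pos_iff_exists_ne_zero.2 ⟨⟨θ z, z, rfl⟩,
          fun h => hz (congrArg Subtype.val h)⟩
      rw [Module.finrank_matrix] at h1
      simp at h1
      omega
  obtain ⟨r, hr⟩ : ∃ r, r = θ (x * z) / θ z := ⟨_, rfl⟩
  have hprop (Y : Matrix (Fin 2) (Fin 2) k) : θ ((x - r • 1) * Y) = 0 := by
    have h1 : Y - (θ Y / θ z) • z ∈ LinearMap.ker θ := by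
      rw [LinearMap.mem_ker, map_sub, map_smul, smul_eq_mul, div_mul_cancel₀ _ hz, sub_self]
    have h2 : ∀ W ∈ LinearMap.ker θ, θ (x * W) = 0 := by
      have hle : LinearMap.ker θ ≤ LinearMap.ker (θ ∘ₗ LinearMap.mulLeft k x) := by
        rw [hker, Submodule.span_le]
        rintro _ ⟨i, rfl⟩
        change θ (x * _) = 0
        fin_cases i
        · simpa using hx1
        exacts [hxv 0, hxv 1]
      exact hle
    have h3 := h2 _ h1
    rw [mul_sub, mul_smul_comm, map_sub, map_smul, smul_eq_mul, sub_eq_zero] at h3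
    rw [sub_mul, smul_mul_assoc, one_mul, map_sub, map_smul, smul_eq_mul, h3, hr]
    field_simp
    ring
  have hxr : x - r • 1 = 0 := by
    obtain ⟨Z, hZ⟩ : ∃ Z, Z = x - r • (1 : Matrix (Fin 2) (Fin 2) k) := ⟨_, rfl⟩
    rw [← hZ] at hprop ⊢
    have h1 : Zᵀ * (Matrix.of fun i j => θ (Matrix.single i j 1)) = 0 := by
      ext l j
      have h2 := hprop (Matrix.single l j 1)
      have h3 : Z * Matrix.single l j 1 = ∑ i, Z i l • Matrix.single i j (1 : k) := by
        ext a b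
        rw [Matrix.sum_apply, Matrix.mul_apply]
        fin_cases a <;> fin_cases l <;> simp [Matrix.single_apply]
      rw [h3, map_sum] at h2
      rw [Matrix.mul_apply, Matrix.zero_apply, ← h2]
      refine Finset.sum_congr rfl fun i _ => ?_
      rw [map_smul]; rfl
    have h2 := hθ.mul_left_eq_zero.1 h1
    simpa using h2
  have h := hv (c 0) (c 1) (Submodule.mem_span_singleton.2 ⟨r, by
    rw [← hx, eq_comm, ← sub_eq_zero]; exact hxr⟩)
  ext i
  fin_cases i
  exacts [h.1, h.2]

variable {H : Type u} [Ring H] [HopfAlgebra k H]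

/-- If the coradical is spanned by `1` and matrix subcoalgebras of dimension four, then one of them
preserves a nondegenerate bilinear form. -/
theorem HasCoradical.exists_isFormMat [IsAlgClosed k] [CharZero k] [FiniteDimensional k H]
    {ι : Type*} [Fintype ι] [Nonempty ι] {e : ι → Matrix (Fin 2) (Fin 2) H}
    (h : HasCoradical k e) :
    ∃ (w : Matrix (Fin 2) (Fin 2) H) (E : Matrix (Fin 2) (Fin 2) k), IsFormMat w E := by
  obtain ⟨ι₀⟩ := ‹Nonempty ι›
  have he := h.comatrix ι₀
  have hs := h.surjective ι₀
  have hfd : FiniteDimensional k (ConvDual k H) :=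
    (WithConv.linearEquiv k (H →ₗ[k] k)).symm.finiteDimensional
  obtain ⟨v, ρ, θ, hρ, hv, hvi, hθ0, hθ1, hθv, hθ⟩ := exists_middle_rep_of_algHom (coadj he)
    (by rw [Module.finrank_matrix]; simp) (evalOne k H) (fun n hn ρ hρ => h.le_two hn hρ)
    (fun χ => AlgHom.ext fun f => h.char_apply χ f) (v₀ := 1) one_ne_zero (fun f => by
      ext i j
      rw [coadj_apply, he.conjMat_one, Matrix.smul_apply, evalOne_apply]
      by_cases hij : i = j
      · rw [hij, Matrix.one_apply_eq, Matrix.one_apply_eq, smul_eq_mul, mul_one]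
      · simp [Matrix.one_apply_ne hij])
    (fun X hX => he.mem_span_one_of_coadj hs hX)
  obtain ⟨w, hw, rfl⟩ := HopfClass.exists_comatrix ρ
  obtain ⟨y, hy⟩ : ∃ y : Fin 2 → H, ∀ j, conjMat (e ι₀) (v j) =
      ∑ i, tmulMat (v i) (w i j) + tmulMat (1 : Matrix (Fin 2) (Fin 2) k) (y j) := by
    have hex (j : Fin 2) : ∃ y : H, conjMat (e ι₀) (v j) =
        ∑ i, tmulMat (v i) (w i j) + tmulMat (1 : Matrix (Fin 2) (Fin 2) k) y := by
      obtain ⟨y, hy⟩ := exists_eq_smul_of_forall_conv (k := k)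
        (M := conjMat (e ι₀) (v j) - ∑ i, tmulMat (v i) (w i j)) fun f => by
          convert hv f j using 1
          ext a b
          simp only [Matrix.map_apply, Matrix.sub_apply, Matrix.sum_apply, map_sub, map_sum,
            coadj_apply, Matrix.smul_apply, hw.rep_apply, tmulMat, Matrix.of_apply, map_smul,
            smul_eq_mul, mul_comm]
      refine ⟨y, ?_⟩
      rw [← sub_eq_iff_eq_add']
      ext a b
      exact hy a b
    choose y hy using hex
    exact ⟨y, hy⟩
  refine ⟨w, Matrix.of fun i j => θ (v i * v j), hw.isFormMat hρ ?_
    (isUnit_of_span_ker (he.isUnit_of_invariant hs hθ hθ0) hvi hθ0 hθ1 hθv)⟩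
  ext i j
  have h1 := he.extendScalars_conjMat hθ (v i * v j)
  rw [← he.conjMat_mul, hy, hy, add_mul, mul_add, mul_add, Finset.sum_mul_sum, Finset.sum_mul,
    Finset.mul_sum] at h1
  simp only [tmulMat_mul, map_add, map_sum, extendScalars_tmulMat, one_mul, mul_one, hθ1, hθv,
    zero_smul, Finset.sum_const_zero, add_zero] at h1
  rw [Matrix.map_apply, Matrix.of_apply, Algebra.algebraMap_eq_smul_one, ← h1, Matrix.mul_apply,
    Finset.sum_comm]
  refine Finset.sum_congr rfl fun b _ => ?_
  rw [Matrix.mul_apply, Finset.sum_mul]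
  refine Finset.sum_congr rfl fun a _ => ?_
  rw [Matrix.map_apply, Matrix.of_apply, Matrix.transpose_apply, ← Algebra.commutes,
    ← Algebra.smul_def, smul_mul_assoc]

end Hopf

end HopfClass

end

open HopfClass in
/-- Let `p` be an odd prime and `H` a non-copointed Hopf algebra of dimension `p³`. Then `H`
has no simple 4-dimensional subcoalgebra stable under the antipode; in particular `H₀` is not
isomorphic as a coalgebra to `k·1 ⊕ M*(2,k)`. Moreover, if `H₀ ≅ k·1 ⊕ M*(2,k)^t` with
`t > 1`, then `dim H ≥ dim H₀ + 24` if `p ≡ 1 (mod 4)` and `dim H ≥ dim H₀ + 22` if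
`p ≡ 3 (mod 4)`. -/
theorem non_copointed_dim_p_cubed_no_antipode_stable_4_dim_simple_subcoalgebra
    (k : Type*) [Field k] [IsAlgClosed k] [CharZero k]
    (H : Type*) [Ring H] [HopfAlgebra k H] [FiniteDimensional k H]
    (p : ℕ) (hp : p.Prime) (hodd : Odd p)
    (hdim : Module.finrank k H = p ^ 3)
    (hncop : ¬ IsCopointed k H) :
    (∀ D : Submodule k H, IsSimpleSubcoalgWrt k (comulL k H) D → Module.finrank k ↥D = 4 →
      Submodule.map (HopfAlgebra.antipode (R := k)) D ≠ D) ∧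
    (¬ ∃ C : Submodule k H, IsMatrixSubcoalg k H 2 C ∧
      Disjoint (Submodule.span k {(1 : H)}) C ∧
      coradical k H = Submodule.span k {(1 : H)} ⊔ C) ∧
    (∀ t : ℕ, 1 < t → ∀ Cs : Fin t → Submodule k H,
      (∀ i, IsMatrixSubcoalg k H 2 (Cs i)) →
      iSupIndep (fun i : Option (Fin t) => i.elim (Submodule.span k {(1 : H)}) Cs) →
      coradical k H = Submodule.span k {(1 : H)} ⊔ ⨆ i, Cs i →
      (p % 4 = 1 → Module.finrank k ↥(coradical k H) + 24 ≤ Module.finrank k H) ∧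
      (p % 4 = 3 → Module.finrank k ↥(coradical k H) + 22 ≤ Module.finrank k H)) := by
  have key {w : Matrix (Fin 2) (Fin 2) H} {E : Matrix (Fin 2) (Fin 2) k} (h : IsFormMat w E) :
      False := hncop (h.isCopointed hp hodd hdim)
  refine ⟨fun D hD hD4 hS => ?_, ?_, ?_⟩
  · obtain ⟨w, E, h⟩ := hD.exists_isFormMat hD4 hS
    exact key h
  · rintro ⟨C, hC, -, hcor⟩
    obtain ⟨e, he⟩ := hasCoradical_of_isMatrixSubcoalg (k := k) (H := H) (ι := Unit)
      (Cs := fun _ => C) (fun _ => hC) (by rw [hcor, iSup_const])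
    obtain ⟨w, E, h⟩ := he.exists_isFormMat
    exact key h
  · intro t ht Cs hCs _ hcor
    have : Nonempty (Fin t) := ⟨⟨0, by omega⟩⟩
    obtain ⟨e, he⟩ := hasCoradical_of_isMatrixSubcoalg hCs hcor
    obtain ⟨w, E, h⟩ := he.exists_isFormMat
    exact (key h).elim
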